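/- Let T_w ⊂ S² denote a regular spherical triangle of width w with 0 < w ≤ π/2. There exists a constant c_w > 0 depending only on w such that for every ε ≥ 0 and every convex body K ⊂ S² with w(K) = w and area(K) ≤ area(T_w) + ε, the inradius satisfies r(K) ≤ r(T_w) + c_w·ε. -/

import Mathlib

open scoped RealInnerProductSpace
open Real MeasureTheory

noncomputable section

namespace SphericalPal

/-- Ambient Euclidean space of the sphere `Sⁿ`. -/
abbrev E (n : ℕ) := EuclideanSpace ℝ (Fin (n + 1))

/-- The unit sphere `Sⁿ ⊂ ℝⁿ⁺¹`. -/
def unitSphere (n : ℕ) : Set (E n) := Metric.sphere 0 1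

variable {n : ℕ}

/-- Geodesic (angular) distance on the unit sphere. -/
def gdist (x y : E n) : ℝ := Real.arccos ⟪x, y⟫

/-- The geodesic segment joining `x` and `y` on the sphere. -/
def seg (x y : E n) : Set (E n) :=
  {z ∈ unitSphere n | gdist x z + gdist z y = gdist x y}

/-- A subset of the sphere is spherically convex if it lies on the sphere, is contained
in an open hemisphere and contains the geodesic segment joining any two of its points. -/
def SConvex (X : Set (E n)) : Prop :=
  X ⊆ unitSphere n ∧
  (∃ u ∈ unitSphere n, ∀ x ∈ X, 0 < ⟪u, x⟫) ∧
  ∀ x ∈ X, ∀ y ∈ X, seg x y ⊆ X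

/-- Spherical convex hull. -/
def sconv (X : Set (E n)) : Set (E n) := ⋂₀ {C | SConvex C ∧ X ⊆ C}

/-- Relative (spherical) interior of a subset of the sphere. -/
def sInterior (X : Set (E n)) : Set (E n) :=
  {x ∈ X | ∃ ε > 0, ∀ y ∈ unitSphere n, gdist x y < ε → y ∈ X}

/-- A spherical convex body: compact, spherically convex, with nonempty relative interior. -/
def IsConvexBody (K : Set (E n)) : Prop :=
  SConvex K ∧ IsCompact K ∧ (sInterior K).Nonempty

/-- The lune determined by `u` and `v` (intersection of the closed hemispheres
opposite to `u` and to `v`). -/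
def lune (u v : E n) : Set (E n) := {x ∈ unitSphere n | ⟪x, u⟫ ≤ 0 ∧ ⟪x, v⟫ ≤ 0}

/-- The bounding hemisphere of `lune u v` contained in the great sphere orthogonal to `u`. -/
def luneFace (u v : E n) : Set (E n) := {x ∈ unitSphere n | ⟪x, u⟫ = 0 ∧ ⟪x, v⟫ ≤ 0}

/-- The center (midpoint) of the bounding hemisphere `luneFace u v`. -/
def luneFaceCenter (u v : E n) : E n :=
  ‖(⟪u, v⟫ • u - v : E n)‖⁻¹ • (⟪u, v⟫ • u - v)

/-- The breadth of the lune `lune u v`: the geodesic distance of the centers of the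
two bounding hemispheres. -/
def breadth (u v : E n) : ℝ := gdist (luneFaceCenter u v) (luneFaceCenter v u)

/-- `lune u v` is a supporting lune of `K`. -/
def IsSupportingLune (K : Set (E n)) (u v : E n) : Prop :=
  u ∈ unitSphere n ∧ v ∈ unitSphere n ∧ u ≠ v ∧ u ≠ -v ∧
  K ⊆ lune u v ∧ (K ∩ luneFace u v).Nonempty ∧ (K ∩ luneFace v u).Nonempty

/-- The (minimal) width of a spherical convex body. -/
def width (K : Set (E n)) : ℝ :=
  sInf {b | ∃ u v : E n, IsSupportingLune K u v ∧ b = breadth u v}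

/-- The width of `K` with respect to the supporting great hypersphere orthogonal to `u`:
the minimal breadth among supporting lunes of `K` having one bounding hemisphere
contained in that great hypersphere. -/
def widthAt (K : Set (E n)) (u : E n) : ℝ :=
  sInf {b | ∃ v : E n, IsSupportingLune K u v ∧ b = breadth u v}

/-- The great hypersphere orthogonal to `u` supports `K`. -/
def IsSupportingSphere (K : Set (E n)) (u : E n) : Prop :=
  u ∈ unitSphere n ∧ (∀ x ∈ K, ⟪x, u⟫ ≤ 0) ∧ ∃ x ∈ K, ⟪x, u⟫ = 0

/-- `K` is of constant width `w`. -/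
def HasConstantWidth (K : Set (E n)) (w : ℝ) : Prop :=
  ∀ u : E n, IsSupportingSphere K u → widthAt K u = w

/-- `K` is a reduced convex body. -/
def IsReduced (K : Set (E n)) : Prop :=
  IsConvexBody K ∧ ∀ L : Set (E n), IsConvexBody L → L ⊆ K → L ≠ K → width L < width K

/-- The spherical polar set. -/
def polar (A : Set (E n)) : Set (E n) := {u ∈ unitSphere n | ∀ a ∈ A, ⟪a, u⟫ ≤ 0}

/-- Closed geodesic ball on the sphere. -/
def gball (p : E n) (r : ℝ) : Set (E n) := {x ∈ unitSphere n | gdist p x ≤ r}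

/-- The inradius of `K`: the largest `r` such that some geodesic ball of radius `r`
is contained in `K`. -/
def inradius (K : Set (E n)) : ℝ :=
  sSup {r | 0 ≤ r ∧ ∃ p ∈ unitSphere n, gball p r ⊆ K}

/-- Geodesic distance from a point to a set. -/
def sdist (x : E n) (A : Set (E n)) : ℝ := sInf (gdist x '' A)

/-- Hausdorff distance with respect to the geodesic metric. -/
def hausdorffG (A B : Set (E n)) : ℝ :=
  max (sSup ((fun x => sdist x B) '' A)) (sSup ((fun y => sdist y A) '' B))

/-- Two subsets of the sphere are congruent, i.e., isometric by an orthogonal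
transformation of the ambient Euclidean space. -/
def Congruent (A B : Set (E n)) : Prop :=
  ∃ f : E n ≃ₗᵢ[ℝ] E n, f '' A = B

/-- Spherical surface measure on `S²` (2-dimensional Hausdorff measure). -/
def area (X : Set (E 2)) : ℝ := (μH[2] X).toReal

/-- The spherical angle `∠(x, p, y)` at `p` between the geodesic segments `[p,x]`, `[p,y]`. -/
def sangle (x p y : E 2) : ℝ :=
  InnerProductGeometry.angle (x - ⟪p, x⟫ • p) (y - ⟪p, y⟫ • p)

/-- `T` is a regular spherical triangle: the spherical convex hull of three points
with equal pairwise geodesic distances, not lying on a common great circle. -/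
def IsRegularTriangle (T : Set (E 2)) : Prop :=
  ∃ v₁ v₂ v₃ : E 2, v₁ ∈ unitSphere 2 ∧ v₂ ∈ unitSphere 2 ∧ v₃ ∈ unitSphere 2 ∧
    LinearIndependent ℝ ![v₁, v₂, v₃] ∧
    gdist v₁ v₂ = gdist v₂ v₃ ∧ gdist v₂ v₃ = gdist v₁ v₃ ∧
    T = sconv {v₁, v₂, v₃}

/-- Three points on the sphere with equal pairwise geodesic distance `a`
(the vertices of a regular spherical triangle of side length `a`). -/
def IsRegularCenters (x₁ x₂ x₃ : E 2) (a : ℝ) : Prop :=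
  x₁ ∈ unitSphere 2 ∧ x₂ ∈ unitSphere 2 ∧ x₃ ∈ unitSphere 2 ∧
  gdist x₁ x₂ = a ∧ gdist x₂ x₃ = a ∧ gdist x₁ x₃ = a

/-- `U` is a spherical Reuleaux triangle: intersection of three geodesic balls of radius `r`
whose centers have pairwise geodesic distance `r`. -/
def IsReuleaux (U : Set (E 2)) (r : ℝ) : Prop :=
  ∃ x₁ x₂ x₃ : E 2, IsRegularCenters x₁ x₂ x₃ r ∧
    U = gball x₁ r ∩ gball x₂ r ∩ gball x₃ r

/-- The body `U°_{π-w}` for `w > π/2`: the spherical convex hull of three geodesic balls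
of radius `w - π/2` (whose centers are meant to form a regular triangle of side `π - w`). -/
def polarReuleaux (x₁ x₂ x₃ : E 2) (w : ℝ) : Set (E 2) :=
  sconv (gball x₁ (w - π / 2) ∪ gball x₂ (w - π / 2) ∪ gball x₃ (w - π / 2))

end SphericalPal

open SphericalPal

section
open MeasureTheory Metric Set

namespace SPaux

theorem unif_unique {X : Type*} [MetricSpace X] [CompactSpace X] [MeasurableSpace X] [BorelSpace X]
    (μ ν : Measure X) [IsFiniteMeasure μ] [IsFiniteMeasure ν] (g h : ℝ → ℝ)
    (hμ : ∀ x r, μ.real (ball x r) = g r) (hν : ∀ x r, ν.real (ball x r) = h r)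
    (hpos : ∀ r > 0, 0 < h r) (f : BoundedContinuousFunction X ℝ) :
    ν.real univ * ∫ x, f x ∂μ = μ.real univ * ∫ x, f x ∂ν := by
  have hS : ∀ r : ℝ, MeasurableSet {p : X × X | dist p.1 p.2 < r} := fun r =>
    (isOpen_lt (by fun_prop) (by fun_prop)).measurableSet
  have hint1 : Integrable (fun p : X × X => f p.1) (μ.prod ν) :=
    (f.integrable μ).comp_fst ν
  have hint2 : Integrable (fun p : X × X => f p.2) (μ.prod ν) :=
    (f.integrable ν).comp_snd μ
  -- first formula
  have key1 : ∀ (r : ℝ) (F : BoundedContinuousFunction X ℝ),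
      ∫ p in {p : X × X | dist p.1 p.2 < r}, F p.1 ∂(μ.prod ν) = h r * ∫ x, F x ∂μ := by
    intro r F
    rw [← integral_indicator (hS r), integral_prod _ (((F.integrable μ).comp_fst ν).indicator (hS r)),
      ← integral_const_mul]
    congr 1; ext x
    have : (fun y => Set.indicator {p : X × X | dist p.1 p.2 < r} (fun p => F p.1) (x, y))
        = (ball x r).indicator (fun _ => F x) := by
      ext y; simp [Set.indicator, dist_comm]
    rw [this, integral_indicator measurableSet_ball, setIntegral_const, hν, smul_eq_mul]
  have key2 : ∀ (r : ℝ) (F : BoundedContinuousFunction X ℝ),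
      ∫ p in {p : X × X | dist p.1 p.2 < r}, F p.2 ∂(μ.prod ν) = g r * ∫ x, F x ∂ν := by
    intro r F
    rw [← integral_indicator (hS r), integral_prod_symm _ (((F.integrable ν).comp_snd μ).indicator (hS r)),
      ← integral_const_mul]
    congr 1; ext y
    have : (fun x => Set.indicator {p : X × X | dist p.1 p.2 < r} (fun p => F p.2) (x, y))
        = (ball y r).indicator (fun _ => F y) := by
      ext x; simp [Set.indicator]
    rw [this, integral_indicator measurableSet_ball, setIntegral_const, hμ, smul_eq_mul]
  have tot1 : ∀ r, h r * μ.real univ = (μ.prod ν).real {p : X × X | dist p.1 p.2 < r} := by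
    intro r
    have := key1 r 1
    simpa using this.symm
  have tot2 : ∀ r, g r * ν.real univ = (μ.prod ν).real {p : X × X | dist p.1 p.2 < r} := by
    intro r
    have := key2 r 1
    simpa using this.symm
  have huc : UniformContinuous f := CompactSpace.uniformContinuous_of_continuous f.continuous
  have main : ∀ ε > 0, |ν.real univ * ∫ x, f x ∂μ - μ.real univ * ∫ x, f x ∂ν|
      ≤ ε * (μ.real univ * ν.real univ) := by
    intro ε hε
    obtain ⟨r, hr, hr'⟩ := Metric.uniformContinuous_iff.1 huc ε hε
    have hb : |h r * ∫ x, f x ∂μ - g r * ∫ x, f x ∂ν| ≤ ε * (h r * μ.real univ) := by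
      rw [← key1, ← key2, ← integral_sub hint1.integrableOn hint2.integrableOn, tot1]
      rw [← Real.norm_eq_abs]
      refine norm_setIntegral_le_of_norm_le_const (measure_lt_top _ _) ?_
      intro p hp
      exact (hr' hp).le
    have hh := hpos r hr
    have e : h r * (ν.real univ * ∫ x, f x ∂μ - μ.real univ * ∫ x, f x ∂ν)
        = ν.real univ * (h r * ∫ x, f x ∂μ - g r * ∫ x, f x ∂ν) := by
      have := (tot1 r).trans (tot2 r).symm
      linear_combination (- ∫ x, f x ∂ν) * this
    have : h r * |ν.real univ * ∫ x, f x ∂μ - μ.real univ * ∫ x, f x ∂ν|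
        ≤ h r * (ε * (μ.real univ * ν.real univ)) := by
      rw [← abs_of_pos hh, ← abs_mul, abs_of_pos hh, e, abs_mul, abs_of_nonneg measureReal_nonneg]
      have := mul_le_mul_of_nonneg_left hb (measureReal_nonneg (μ := ν) (s := univ))
      linarith
    exact le_of_mul_le_mul_left this hh
  by_contra hne
  have hpos' : 0 < |ν.real univ * ∫ x, f x ∂μ - μ.real univ * ∫ x, f x ∂ν| :=
    abs_pos.2 (sub_ne_zero.2 hne)
  set D := |ν.real univ * ∫ x, f x ∂μ - μ.real univ * ∫ x, f x ∂ν|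
  set M := μ.real univ * ν.real univ
  have hM : 0 ≤ M := mul_nonneg measureReal_nonneg measureReal_nonneg
  have := main (D / (2 * (M + 1))) (by positivity)
  rw [div_mul_eq_mul_div, le_div_iff₀ (by positivity)] at this
  nlinarith

end SPaux

end

section
open MeasureTheory Metric Set SphericalPal
open scoped Pointwise

namespace SPaux

abbrev S2 := Metric.sphere (0 : E 2) 1

theorem exists_iso (x y : S2) : ∃ A : E 2 ≃ₗᵢ[ℝ] E 2, A x = y :=
  ⟨Submodule.reflection (ℝ ∙ ((x : E 2) - y))ᗮ, by
    apply Submodule.reflection_sub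
    rw [mem_sphere_zero_iff_norm.1 x.2, mem_sphere_zero_iff_norm.1 y.2]⟩

theorem val_ball (x : S2) (r : ℝ) : (Subtype.val '' (ball x r) : Set (E 2)) = sphere 0 1 ∩ ball (x : E 2) r := by
  ext z; constructor
  · rintro ⟨z, hz, rfl⟩; exact ⟨z.2, hz⟩
  · rintro ⟨h1, h2⟩; exact ⟨⟨z, h1⟩, h2, rfl⟩

theorem iso_ball (A : E 2 ≃ₗᵢ[ℝ] E 2) (x y : S2) (h : A x = y) (r : ℝ) :
    A '' (sphere 0 1 ∩ ball (x : E 2) r) = sphere 0 1 ∩ ball (y : E 2) r := by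
  rw [Set.image_inter A.injective]
  have h1 := A.image_sphere 0 1
  have h2 := A.image_ball (x : E 2) r
  rw [map_zero] at h1
  rw [h1, h2, h]

theorem iso_smul (A : E 2 ≃ₗᵢ[ℝ] E 2) (B : Set (E 2)) :
    A '' (Ioo (0:ℝ) 1 • B) = Ioo (0:ℝ) 1 • (A '' B) := by
  ext z; constructor
  · rintro ⟨_, ⟨t, ht, b, hb, rfl⟩, rfl⟩
    exact ⟨t, ht, A b, ⟨b, hb, rfl⟩, by simp⟩
  · rintro ⟨t, ht, _, ⟨b, hb, rfl⟩, rfl⟩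
    exact ⟨t • b, ⟨t, ht, b, hb, rfl⟩, by simp⟩

theorem iso_vol (A : E 2 ≃ₗᵢ[ℝ] E 2) (B : Set (E 2)) : volume (A '' B) = volume B := by
  have := A.symm.measurePreserving.measure_preimage_equiv (f := A.symm.toMeasurableEquiv) B
  rw [← this]; congr 1; ext z; simp [LinearIsometryEquiv.toMeasurableEquiv]
  exact ⟨fun ⟨a, ha, e⟩ => by rw [← e]; simpa using ha, fun h => ⟨_, h, by simp⟩⟩

theorem hmeas_const (x y : S2) (r : ℝ) :
    (μH[2] : Measure S2) (ball x r) = (μH[2] : Measure S2) (ball y r) := by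
  obtain ⟨A, hA⟩ := exists_iso x y
  have hi : Isometry (Subtype.val : S2 → E 2) := isometry_subtype_coe
  rw [← hi.hausdorffMeasure_image (Or.inl (by norm_num)) (ball x r),
    ← hi.hausdorffMeasure_image (Or.inl (by norm_num)) (ball y r), val_ball, val_ball,
    ← iso_ball A x y hA, A.isometry.hausdorffMeasure_image (Or.inl (by norm_num))]

theorem tmeas_const (x y : S2) (r : ℝ) :
    (volume : Measure (E 2)).toSphere (ball x r) = (volume : Measure (E 2)).toSphere (ball y r) := by
  obtain ⟨A, hA⟩ := exists_iso x y
  rw [Measure.toSphere_apply' _ measurableSet_ball, Measure.toSphere_apply' _ measurableSet_ball,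
    val_ball, val_ball, ← iso_ball A x y hA, ← iso_smul, iso_vol]

noncomputable def sph (p : ℝ × ℝ) : E 2 := !₂[Real.cos p.1, Real.sin p.1 * Real.cos p.2, Real.sin p.1 * Real.sin p.2]

theorem sph_surj : sphere (0 : E 2) 1 ⊆ sph '' (Icc (0:ℝ) Real.pi ×ˢ Icc (-Real.pi) Real.pi) := by
  intro x hx
  have hx : ‖x‖ = 1 := by simpa using hx
  have hsq : x 0 ^ 2 + x 1 ^ 2 + x 2 ^ 2 = 1 := by
    have := EuclideanSpace.norm_sq_eq x
    rw [hx] at this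
    simp [Fin.sum_univ_three] at this; linarith
  have h0 : -1 ≤ x 0 ∧ x 0 ≤ 1 := by constructor <;> nlinarith
  refine ⟨(Real.arccos (x 0), Complex.arg ⟨x 1, x 2⟩), ⟨⟨Real.arccos_nonneg _, Real.arccos_le_pi _⟩,
    ⟨(Complex.neg_pi_lt_arg _).le, Complex.arg_le_pi _⟩⟩, ?_⟩
  have hn : ‖(⟨x 1, x 2⟩ : ℂ)‖ = Real.sqrt (1 - x 0 ^ 2) := by
    rw [Complex.norm_def]; congr 1; simp [Complex.normSq]; linarith
  have hc := Complex.norm_mul_cos_arg (⟨x 1, x 2⟩ : ℂ)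
  have hs := Complex.norm_mul_sin_arg (⟨x 1, x 2⟩ : ℂ)
  rw [hn] at hc hs
  ext i
  fin_cases i
  · simp [sph, Real.cos_arccos h0.1 h0.2]
  · simp [sph, Real.sin_arccos, hc]
  · simp [sph, Real.sin_arccos, hs]

theorem hmeas_finite : μH[2] (sphere (0 : E 2) 1) < ⊤ := by
  have hd : ContDiff ℝ 1 sph := by
    rw [contDiff_euclidean]
    intro i; fin_cases i <;> simp [sph] <;> fun_prop
  have hconv : Convex ℝ (Icc (0:ℝ) Real.pi ×ˢ Icc (-Real.pi) Real.pi) :=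
    (convex_Icc _ _).prod (convex_Icc _ _)
  have hcomp : IsCompact (Icc (0:ℝ) Real.pi ×ˢ Icc (-Real.pi) Real.pi) :=
    isCompact_Icc.prod isCompact_Icc
  obtain ⟨C, hC⟩ := hd.contDiffOn.exists_lipschitzOnWith one_ne_zero hconv hcomp
  refine (measure_mono sph_surj).trans_lt ?_
  refine (hC.hausdorffMeasure_image_le (by norm_num : (0:ℝ) ≤ 2)).trans_lt ?_
  rw [hausdorffMeasure_prod_real]
  exact ENNReal.mul_lt_top (by simp) hcomp.measure_lt_top

theorem hmeas_pos : 0 < μH[2] (sphere (0 : E 2) 1) := by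
  let P : E 2 → ℝ × ℝ := fun x => (x 1, x 2)
  have hP : LipschitzWith 1 P := by
    apply LipschitzWith.of_dist_le_mul
    intro x y
    simp only [P, Prod.dist_eq, NNReal.coe_one, one_mul]
    refine max_le ?_ ?_
    · simpa [Real.dist_eq, dist_eq_norm] using PiLp.norm_apply_le (x - y) 1
    · simpa [Real.dist_eq, dist_eq_norm] using PiLp.norm_apply_le (x - y) 2
  have h1 := hP.hausdorffMeasure_image_le (by norm_num : (0:ℝ) ≤ 2) (sphere (0 : E 2) 1)
  rw [hausdorffMeasure_prod_real] at h1
  simp at h1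
  refine lt_of_lt_of_le ?_ h1
  have : Icc (0:ℝ) (1/2) ×ˢ Icc (0:ℝ) (1/2) ⊆ P '' sphere 0 1 := by
    rintro ⟨a, b⟩ ⟨⟨ha, ha'⟩, ⟨hb, hb'⟩⟩
    dsimp at ha ha' hb hb'
    refine ⟨!₂[Real.sqrt (1 - a^2 - b^2), a, b], ?_, ?_⟩
    · rw [mem_sphere_zero_iff_norm, EuclideanSpace.norm_eq]
      simp [Fin.sum_univ_three, Real.sq_sqrt (by nlinarith : 0 ≤ 1 - a^2 - b^2)]
      ring
    · simp [P]
  refine lt_of_lt_of_le ?_ (measure_mono this)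
  rw [Measure.volume_eq_prod, Measure.prod_prod]
  simp

theorem area_eq : ∃ C : ℝ, 0 < C ∧ ∀ K : Set (E 2), MeasurableSet K → K ⊆ sphere 0 1 →
    area K = C * volume.real (Ioo (0:ℝ) 1 • K) := by
  have hi : Isometry (Subtype.val : S2 → E 2) := isometry_subtype_coe
  set μ : Measure S2 := μH[2] with hμ
  set ν : Measure S2 := (volume : Measure (E 2)).toSphere with hν
  have hu : μ univ = μH[2] (sphere (0 : E 2) 1) := by
    rw [hμ, ← hi.hausdorffMeasure_image (Or.inl (by norm_num)), image_univ, Subtype.range_coe]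
  have : IsFiniteMeasure μ := ⟨by rw [hu]; exact hmeas_finite⟩
  let x0 : S2 := ⟨EuclideanSpace.single 0 1, by simp⟩
  have hνpos : ∀ r > 0, 0 < ν.real (ball x0 r) := by
    intro r hr
    exact ENNReal.toReal_pos (measure_ball_pos _ _ hr).ne' (measure_ne_top _ _)
  have hνu : 0 < ν.real univ := 
    lt_of_lt_of_le (hνpos 1 one_pos) (measureReal_mono (subset_univ _))
  have hμu : 0 < μ.real univ := by
    apply ENNReal.toReal_pos _ (measure_ne_top _ _)
    rw [hu]; exact hmeas_pos.ne'
  have key := unif_unique μ ν (fun r => μ.real (ball x0 r)) (fun r => ν.real (ball x0 r))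
    (fun x r => by simp only [Measure.real]; rw [hmeas_const x x0 r])
    (fun x r => by simp only [Measure.real]; rw [tmeas_const x x0 r]) hνpos
  have heq : ENNReal.ofReal (ν.real univ) • μ = ENNReal.ofReal (μ.real univ) • ν := by
    have : IsFiniteMeasure (ENNReal.ofReal (ν.real univ) • μ) := Measure.smul_finite _ (by simp)
    have : IsFiniteMeasure (ENNReal.ofReal (μ.real univ) • ν) := Measure.smul_finite _ (by simp)
    apply ext_of_forall_integral_eq_of_IsFiniteMeasure
    intro f
    rw [integral_smul_measure, integral_smul_measure, ENNReal.toReal_ofReal hνu.le,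
      ENNReal.toReal_ofReal hμu.le]
    exact key f
  refine ⟨3 * μ.real univ / ν.real univ, by positivity, ?_⟩
  intro K hK hKS
  have e1 : (Subtype.val '' (Subtype.val ⁻¹' K : Set S2)) = K := by
    rw [Subtype.image_preimage_coe]; exact inter_eq_right.2 hKS
  have hm : MeasurableSet (Subtype.val ⁻¹' K : Set S2) := measurable_subtype_coe hK
  have a1 : area K = μ.real (Subtype.val ⁻¹' K : Set S2) := by
    rw [area, Measure.real, hμ, ← hi.hausdorffMeasure_image (Or.inl (by norm_num)), e1]
  have a2 : ν.real (Subtype.val ⁻¹' K : Set S2) = 3 * volume.real (Ioo (0:ℝ) 1 • K) := by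
    rw [Measure.real, hν, Measure.toSphere_apply' _ hm, e1]
    simp [Measure.real]
  have a3 : ν.real univ * μ.real (Subtype.val ⁻¹' K : Set S2)
      = μ.real univ * ν.real (Subtype.val ⁻¹' K : Set S2) := by
    have := congrArg (fun m : Measure S2 => m.real (Subtype.val ⁻¹' K : Set S2)) heq
    simpa [Measure.real, hνu.le, hμu.le] using this
  rw [a2] at a3
  rw [a1]
  field_simp
  linarith

end SPaux

end

section
open MeasureTheory Metric Set SphericalPal Real
open scoped Pointwise ENNReal

namespace SPaux

theorem lint_cart (f : E 2 → ℝ≥0∞) (hf : Measurable f) :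
    ∫⁻ X, f X = ∫⁻ z : ℝ, ∫⁻ q : ℝ × ℝ, f !₂[z, q.1, q.2] := by
  have h1 := PiLp.volume_preserving_toLp (Fin 3)
  have h2 := (volume_preserving_piFinSuccAbove (fun _ : Fin 3 => ℝ) 0).symm
  have h3 : MeasurePreserving (Prod.map id (MeasurableEquiv.finTwoArrow (α := ℝ)).symm)
      (volume : Measure (ℝ × (ℝ × ℝ))) (volume : Measure (ℝ × (Fin 2 → ℝ))) := by
    exact (MeasurePreserving.id volume).prod (volume_preserving_finTwoArrow ℝ).symm
  have h := h1.comp (h2.comp h3)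
  have hm := h.lintegral_comp hf
  rw [← hm, Measure.volume_eq_prod]
  refine (lintegral_prod _ (hf.comp h.measurable).aemeasurable).trans ?_
  refine lintegral_congr fun z => lintegral_congr fun q => congrArg f ?_
  ext i
  fin_cases i <;> simp [Fin.insertNthEquiv, MeasurableEquiv.piFinSuccAbove, MeasurableEquiv.finTwoArrow] <;> rfl

theorem meas_vec {X : Type*} [MeasurableSpace X] {a b c : X → ℝ} (ha : Measurable a) (hb : Measurable b)
    (hc : Measurable c) : Measurable (fun x => (!₂[a x, b x, c x] : E 2)) := by
  apply (PiLp.volume_preserving_toLp (Fin 3)).measurable.comp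
  rw [measurable_pi_iff]
  intro i; fin_cases i <;> simpa

theorem lint_sph (f : E 2 → ℝ≥0∞) (hf : Measurable f) :
    ∫⁻ X, f X = ∫⁻ θ in Ioo (-π) π, ∫⁻ p in Ioi (0:ℝ) ×ˢ Ioo (0:ℝ) π,
      ENNReal.ofReal (p.1 ^ 2 * sin p.2) * f (p.1 • sph (p.2, θ)) := by
  rw [lint_cart f hf]
  have step1 : ∀ z : ℝ, ∫⁻ q : ℝ × ℝ, f !₂[z, q.1, q.2] =
      ∫⁻ θ in Ioo (-π) π, ∫⁻ ϱ in Ioi (0:ℝ), ENNReal.ofReal ϱ * f !₂[z, ϱ * cos θ, ϱ * sin θ] := by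
    intro z
    rw [← lintegral_comp_polarCoord_symm, polarCoord_target, Measure.volume_eq_prod,
      ← Measure.prod_restrict, lintegral_prod_symm]
    · simp [polarCoord]
    · apply Measurable.aemeasurable
      simp only [polarCoord, smul_eq_mul]
      apply Measurable.mul (by fun_prop)
      apply hf.comp
      exact meas_vec (by fun_prop) (by simp; fun_prop) (by simp; fun_prop)
  simp_rw [step1]
  rw [lintegral_lintegral_swap]
  swap
  · apply Measurable.aemeasurable
    refine Measurable.lintegral_prod_right' (ν := volume.restrict (Ioi 0)) (f := fun q : (ℝ × ℝ) × ℝ => 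
      ENNReal.ofReal q.2 * f !₂[q.1.1, q.2 * cos q.1.2, q.2 * sin q.1.2]) ?_
    apply Measurable.mul (by fun_prop)
    apply hf.comp
    exact meas_vec (by fun_prop) (by fun_prop) (by fun_prop)
  congr 1; ext θ
  have hmeas : Measurable (fun q : ℝ × ℝ => ENNReal.ofReal q.2 * f !₂[q.1, q.2 * cos θ, q.2 * sin θ]) := by
    apply Measurable.mul (by fun_prop)
    apply hf.comp
    exact meas_vec (by fun_prop) (by fun_prop) (by fun_prop)
  have step2 : ∫⁻ z : ℝ, ∫⁻ ϱ in Ioi (0:ℝ), ENNReal.ofReal ϱ * f !₂[z, ϱ * cos θ, ϱ * sin θ]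
      = ∫⁻ q : ℝ × ℝ, ENNReal.ofReal q.2 * f !₂[q.1, q.2 * cos θ, q.2 * sin θ] := by
    rw [Measure.volume_eq_prod, lintegral_prod _ hmeas.aemeasurable]
    congr 1; ext z
    rw [← lintegral_indicator measurableSet_Ioi]
    congr 1; ext ϱ
    by_cases h : 0 < ϱ
    · simp [h]
    · simp [h, ENNReal.ofReal_of_nonpos (not_lt.1 h)]
  rw [step2, ← lintegral_comp_polarCoord_symm, polarCoord_target]
  have hset : Ioi (0:ℝ) ×ˢ Ioo (0:ℝ) π = (Ioi (0:ℝ) ×ˢ Ioo (-π) π) ∩ (Ioi (0:ℝ) ×ˢ Ioo (0:ℝ) π) := by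
    rw [right_eq_inter]; intro p hp
    exact ⟨hp.1, by have := hp.2.1; have := pi_pos; linarith, hp.2.2⟩
  have hms : MeasurableSet (Ioi (0:ℝ) ×ˢ Ioo (0:ℝ) π) := measurableSet_Ioi.prod measurableSet_Ioo
  have hms' : MeasurableSet (Ioi (0:ℝ) ×ˢ Ioo (-π) π) := measurableSet_Ioi.prod measurableSet_Ioo
  rw [← lintegral_indicator hms, ← lintegral_indicator hms']
  congr 1; ext p
  rcases p with ⟨t, s⟩
  simp only [Set.indicator, mem_prod, mem_Ioi, mem_Ioo]
  by_cases h1 : 0 < t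
  · by_cases h2 : 0 < s
    · by_cases h3 : s < π
      · have h4 : -π < s := by linarith [pi_pos]
        simp only [h1, h2, h3, h4, and_self, if_true, polarCoord]
        simp only [OpenPartialHomeomorph.coe_mk_symm, PartialEquiv.coe_symm_mk, smul_eq_mul]
        rw [← mul_assoc, ← ENNReal.ofReal_mul h1.le]
        congr 2
        · ring
        · ext i; fin_cases i <;> simp [sph] <;> ring
      · simp [h3]
    · have : sin s ≤ 0 ∨ ¬ (-π < s) := by
        by_cases h : -π < s
        · left; exact sin_nonpos_of_nonpos_of_neg_pi_le (not_lt.1 h2) h.le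
        · right; exact h
      rcases this with h | h
      · have : t * sin s ≤ 0 := mul_nonpos_of_nonneg_of_nonpos h1.le h
        simp [h2, polarCoord, ENNReal.ofReal_of_nonpos this]
      · simp [h2, h]
  · simp [h1]

/-- Volume of a cone whose section is described in spherical coordinates. -/
theorem vol_sph (B : Set (E 2)) (hB : MeasurableSet B) (a b : ℝ → ℝ)
    (hab : ∀ θ ∈ Ioo (-π) π, 0 ≤ a θ ∧ a θ ≤ b θ ∧ b θ ≤ π)
    (h : ∀ t : ℝ, 0 < t → ∀ s ∈ Ioo (0:ℝ) π, ∀ θ ∈ Ioo (-π) π, t • sph (s, θ) ∈ B ↔ t < 1 ∧ a θ < s ∧ s ≤ b θ) :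
    volume B = ∫⁻ θ in Ioo (-π) π, ENNReal.ofReal ((cos (a θ) - cos (b θ)) / 3) := by
  rw [← lintegral_indicator_one hB, lint_sph _ (measurable_one.indicator hB)]
  apply setLIntegral_congr_fun measurableSet_Ioo
  intro θ hθ
  obtain ⟨h0, h1, h2⟩ := hab θ hθ
  dsimp only
  have hms : MeasurableSet (Ioi (0:ℝ) ×ˢ Ioo (0:ℝ) π) := measurableSet_Ioi.prod measurableSet_Ioo
  rw [← lintegral_indicator hms]
  have e : (Ioi (0:ℝ) ×ˢ Ioo (0:ℝ) π).indicator (fun p : ℝ × ℝ => ENNReal.ofReal (p.1 ^ 2 * sin p.2) *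
      B.indicator 1 (p.1 • sph (p.2, θ))) =ᵐ[volume]
      (fun p : ℝ × ℝ => (Ioc (0:ℝ) 1).indicator (fun t => ENNReal.ofReal (t^2)) p.1 *
        (Ioc (a θ) (b θ)).indicator (fun s => ENNReal.ofReal (sin s)) p.2) := by
    have hn1 : ∀ᵐ p : ℝ × ℝ, p.1 ≠ 1 := by
      have : ∀ᵐ x : ℝ, x ≠ 1 := Measure.ae_ne volume 1
      exact (Measure.quasiMeasurePreserving_fst (μ := volume) (ν := volume)).ae this
    have hn2 : ∀ᵐ p : ℝ × ℝ, p.2 ≠ π := by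
      have : ∀ᵐ x : ℝ, x ≠ π := Measure.ae_ne volume π
      exact (Measure.quasiMeasurePreserving_snd (μ := volume) (ν := volume)).ae this
    filter_upwards [hn1, hn2] with p hp1 hp2
    rcases p with ⟨t, s⟩
    dsimp at hp1 hp2
    simp only [Set.indicator, mem_prod, mem_Ioi, mem_Ioo, mem_Ioc]
    by_cases ht : 0 < t
    · by_cases hs : 0 < s ∧ s < π
      · rw [if_pos ⟨ht, hs⟩]
        have := h t ht s hs θ hθ
        simp only [this]
        by_cases ht1 : t < 1
        · by_cases hs1 : a θ < s ∧ s ≤ b θ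
          · simp [ht, ht1, hs1, ht1.le, ENNReal.ofReal_mul (sq_nonneg t)]
          · simp [hs1]
        · have : ¬ t ≤ 1 := fun h => ht1 (lt_of_le_of_ne h hp1)
          simp [ht1, this]
      · have : ¬ (a θ < s ∧ s ≤ b θ) := fun h' => hs ⟨by linarith, lt_of_le_of_ne (by linarith) hp2⟩
        simp [hs, this]
    · simp [ht]
  rw [lintegral_congr_ae e, Measure.volume_eq_prod, lintegral_prod_mul
    (by apply Measurable.aemeasurable; apply Measurable.indicator (by fun_prop) measurableSet_Ioc)
    (by apply Measurable.aemeasurable; apply Measurable.indicator (by fun_prop) measurableSet_Ioc),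
    lintegral_indicator measurableSet_Ioc, lintegral_indicator measurableSet_Ioc]
  have i1 : ∫⁻ t in Ioc (0:ℝ) 1, ENNReal.ofReal (t^2) = ENNReal.ofReal (1/3) := by
    rw [← ofReal_integral_eq_lintegral_ofReal, ← intervalIntegral.integral_of_le zero_le_one]
    · congr 1; rw [integral_pow]; norm_num
    · exact (Continuous.integrableOn_Icc (by fun_prop)).mono_set Ioc_subset_Icc_self
    · filter_upwards with t; positivity
  have i2 : ∫⁻ s in Ioc (a θ) (b θ), ENNReal.ofReal (sin s) = ENNReal.ofReal (cos (a θ) - cos (b θ)) := by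
    rw [← ofReal_integral_eq_lintegral_ofReal, ← intervalIntegral.integral_of_le h1]
    · congr 1; rw [integral_sin]
    · exact (Continuous.integrableOn_Icc (by fun_prop)).mono_set Ioc_subset_Icc_self
    · filter_upwards [ae_restrict_mem measurableSet_Ioc] with s hs
      exact sin_nonneg_of_nonneg_of_le_pi (by linarith [hs.1]) (by linarith [hs.2])
  rw [i1, i2, ← ENNReal.ofReal_mul (by norm_num)]
  congr 1; ring

end SPaux

end

section
open MeasureTheory Metric Set SphericalPal Real
open scoped Pointwise ENNReal RealInnerProductSpace

namespace SPaux

/-- Frames. -/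
def Frame (p f g : E 2) : Prop := Orthonormal ℝ ![p, f, g]

theorem Frame.basis {p f g : E 2} (h : Frame p f g) :
    ∃ b : OrthonormalBasis (Fin 3) ℝ (E 2), b 0 = p ∧ b 1 = f ∧ b 2 = g := by
  have hs : ⊤ ≤ Submodule.span ℝ (Set.range ![p, f, g]) := by
    rw [h.linearIndependent.span_eq_top_of_card_eq_finrank' (by simp)]
  refine ⟨OrthonormalBasis.mk h hs, ?_, ?_, ?_⟩ <;>
    rw [OrthonormalBasis.coe_mk h hs] <;> simp

theorem Frame.expand {p f g : E 2} (h : Frame p f g) (X : E 2) :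
    X = ⟪p, X⟫ • p + ⟪f, X⟫ • f + ⟪g, X⟫ • g := by
  obtain ⟨b, rfl, rfl, rfl⟩ := h.basis
  have := b.sum_repr X
  rw [Fin.sum_univ_three] at this
  simp only [b.repr_apply_apply] at this
  exact this.symm

theorem Frame.norm_sq {p f g : E 2} (h : Frame p f g) (X : E 2) :
    ‖X‖ ^ 2 = ⟪p, X⟫ ^ 2 + ⟪f, X⟫ ^ 2 + ⟪g, X⟫ ^ 2 := by
  obtain ⟨b, rfl, rfl, rfl⟩ := h.basis
  have := b.sum_sq_norm_inner_right X
  rw [Fin.sum_univ_three] at this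
  simp only [Real.norm_eq_abs, sq_abs] at this
  exact this.symm

theorem Frame.inners {p f g : E 2} (h : Frame p f g) : ⟪p, p⟫ = (1:ℝ) ∧ ⟪f, f⟫ = (1:ℝ) ∧ ⟪g, g⟫ = (1:ℝ) ∧
    ⟪p, f⟫ = (0:ℝ) ∧ ⟪p, g⟫ = (0:ℝ) ∧ ⟪f, g⟫ = (0:ℝ) := by
  have h1 := h.1
  have h2 := h.2
  refine ⟨?_, ?_, ?_, ?_, ?_, ?_⟩
  · have := h1 0; simp only [Matrix.cons_val] at this; simp [this]
  · have := h1 1; simp only [Matrix.cons_val] at this; simp [this]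
  · have := h1 2; simp only [Matrix.cons_val] at this; simp [this]
  · exact h2 (show (0:Fin 3) ≠ 1 by decide)
  · exact h2 (show (0:Fin 3) ≠ 2 by decide)
  · exact h2 (show (1:Fin 3) ≠ 2 by decide)

theorem exists_frame {p f : E 2} (hp : ‖p‖ = 1) (hf : ‖f‖ = 1) (hpf : ⟪p, f⟫ = (0:ℝ)) :
    ∃ g, Frame p f g := by
  have ho : Orthonormal ℝ (({0, 1} : Set (Fin 3)).domRestrict ![p, f, 0]) := by
    constructor
    · rintro ⟨i, hi⟩
      rcases hi with rfl | hi
      · simpa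
      · obtain rfl : i = 1 := hi
        simpa
    · rintro ⟨i, hi⟩ ⟨j, hj⟩ hij
      rcases hi with rfl | hi <;> rcases hj with rfl | hj
      · simp at hij
      · obtain rfl : j = 1 := hj
        simpa
      · obtain rfl : i = 1 := hi
        rw [real_inner_comm]; simpa
      · obtain rfl : i = 1 := hi
        obtain rfl : j = 1 := hj
        simp at hij
  obtain ⟨b, hb⟩ := ho.exists_orthonormalBasis_extension_of_card_eq (by simp)
  refine ⟨b 2, ?_⟩
  have h0 := hb 0 (by simp)
  have h1 := hb 1 (by simp)
  simp at h0 h1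
  unfold Frame
  have : ![p, f, b 2] = b := by
    ext i j
    fin_cases i <;> simp [h0, h1]
  rw [this]; exact b.orthonormal

theorem vol_frame {p f g : E 2} (h : Frame p f g) (B : Set (E 2)) (hB : MeasurableSet B) :
    volume {X : E 2 | !₂[⟪p, X⟫, ⟪f, X⟫, ⟪g, X⟫] ∈ B} = volume B := by
  obtain ⟨b, rfl, rfl, rfl⟩ := h.basis
  rw [← b.measurePreserving_repr.measure_preimage hB.nullMeasurableSet]
  congr 1
  ext X
  have : b.repr X = (!₂[⟪b 0, X⟫, ⟪b 1, X⟫, ⟪b 2, X⟫] : E 2) := by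
    ext i; fin_cases i <;> simp [b.repr_apply_apply]
  simp [this]

/-- Cone over a disk. -/
noncomputable def disk (p : E 2) (r : ℝ) : Set (E 2) := {X | X ≠ 0 ∧ ‖X‖ < 1 ∧ cos r * ‖X‖ ≤ ⟪p, X⟫}

/-- Cone over a cap. -/
noncomputable def cap (p f g : E 2) (r a : ℝ) : Set (E 2) :=
  {X | ‖X‖ < 1 ∧ cos a * √(⟪f, X⟫ ^ 2 + ⟪g, X⟫ ^ 2) < ⟪f, X⟫ ∧ ⟪p, X⟫ < cos r * ‖X‖ ∧
    -sin r * ⟪p, X⟫ + cos r * (cos a * ⟪f, X⟫ + sin a * ⟪g, X⟫) ≤ 0 ∧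
    -sin r * ⟪p, X⟫ + cos r * (cos a * ⟪f, X⟫ - sin a * ⟪g, X⟫) ≤ 0}

theorem meas_disk (p : E 2) (r : ℝ) : MeasurableSet (disk p r) := by
  simp only [disk, ofPred_and]
  refine .inter ?_ (.inter ?_ ?_)
  · exact (measurableSet_singleton (0 : E 2)).compl
  · exact measurableSet_lt (by fun_prop) (by fun_prop)
  · exact measurableSet_le (by fun_prop) (by fun_prop)

theorem meas_cap (p f g : E 2) (r a : ℝ) : MeasurableSet (cap p f g r a) := by
  simp only [cap, ofPred_and]
  refine .inter ?_ (.inter ?_ (.inter ?_ (.inter ?_ ?_)))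
  · exact measurableSet_lt (by fun_prop) (by fun_prop)
  · exact measurableSet_lt (by fun_prop) (by fun_prop)
  · exact measurableSet_lt (by fun_prop) (by fun_prop)
  · exact measurableSet_le (by fun_prop) (by fun_prop)
  · exact measurableSet_le (by fun_prop) (by fun_prop)

theorem norm_vec (a b c : ℝ) : ‖(!₂[a, b, c] : E 2)‖ = √(a ^ 2 + b ^ 2 + c ^ 2) := by
  rw [EuclideanSpace.norm_eq]; congr 1; rw [Fin.sum_univ_three]; simp

theorem norm_sph (s θ : ℝ) : ‖sph (s, θ)‖ = 1 := by
  rw [sph, norm_vec]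
  rw [Real.sqrt_eq_one]
  nlinarith [sin_sq_add_cos_sq s, sin_sq_add_cos_sq θ]

/-- The standard basis. -/
noncomputable def sb (i : Fin 3) : E 2 := EuclideanSpace.single i 1

theorem sb_inner (i : Fin 3) (X : E 2) : ⟪sb i, X⟫ = X i := by
  simp [sb, EuclideanSpace.inner_single_left]

theorem frame_norm {p f g : E 2} (h : Frame p f g) (X : E 2) :
    ‖(!₂[⟪p, X⟫, ⟪f, X⟫, ⟪g, X⟫] : E 2)‖ = ‖X‖ := by
  rw [norm_vec, ← h.norm_sq, Real.sqrt_sq (norm_nonneg _)]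

theorem vol_disk0 (r : ℝ) (h0 : 0 ≤ r) (h1 : r ≤ π) :
    volume (disk (sb 0) r) = ENNReal.ofReal (2 * π / 3 * (1 - cos r)) := by
  rw [vol_sph _ (meas_disk _ _) (fun _ => 0) (fun _ => r)]
  · simp only [lintegral_const, cos_zero]
    rw [Measure.restrict_apply MeasurableSet.univ, univ_inter, Real.volume_Ioo, ← ENNReal.ofReal_mul]
    · congr 1; ring
    · have := cos_le_one r; linarith
  · intro θ _; exact ⟨le_rfl, h0, h1⟩
  · intro t ht s hs θ hθ
    simp only [disk, mem_ofPred_eq, sb_inner, norm_smul, norm_sph]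
    have e : (t • sph (s, θ)) 0 = t * cos s := by simp [sph]
    have hne : t • sph (s, θ) ≠ 0 := by
      rw [← norm_pos_iff, norm_smul, norm_sph]; simp [ht.ne']
    rw [e]
    simp only [Real.norm_eq_abs, abs_of_pos ht, mul_one, hne, ne_eq, not_false_eq_true, true_and, hs.1]
    have : cos r * t ≤ t * cos s ↔ s ≤ r := by
      rw [mul_comm, mul_le_mul_iff_right₀ ht]
      exact strictAntiOn_cos.le_iff_ge ⟨h0, h1⟩ ⟨hs.1.le, hs.2.le⟩
    rw [this]

theorem vol_disk {p f g : E 2} (h : Frame p f g) (r : ℝ) (h0 : 0 ≤ r) (h1 : r ≤ π) :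
    volume (disk p r) = ENNReal.ofReal (2 * π / 3 * (1 - cos r)) := by
  rw [← vol_disk0 r h0 h1, ← vol_frame h (disk (sb 0) r) (meas_disk _ _)]
  congr 1
  ext X
  simp only [disk, mem_ofPred_eq, sb_inner, frame_norm h]
  rw [← norm_ne_zero_iff, ← norm_ne_zero_iff (a := (!₂[⟪p, X⟫, ⟪f, X⟫, ⟪g, X⟫] : E 2)), frame_norm h]
  simp

end SPaux

end

section
open MeasureTheory Metric Set SphericalPal Real
open scoped Pointwise ENNReal RealInnerProductSpace

namespace SPaux

/-- Denominator. -/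
noncomputable def Dn (r φ : ℝ) : ℝ := √(1 - (sin φ * cos r) ^ 2)

theorem Dn_pos {r φ : ℝ} (h0 : 0 < r) (h1 : r < π / 2) : 0 < 1 - (sin φ * cos r) ^ 2 := by
  have hs : 0 < sin r := sin_pos_of_pos_of_lt_pi h0 (by linarith [pi_pos])
  nlinarith [sin_sq_add_cos_sq r, sin_sq_add_cos_sq φ, mul_nonneg (sq_nonneg (cos φ)) (sq_nonneg (cos r)), mul_pos hs hs]

theorem arcsin_deriv {r φ : ℝ} (h0 : 0 < r) (h1 : r < π / 2) :
    HasDerivAt (fun x => arcsin (sin x * cos r)) (cos φ * cos r / Dn r φ) φ := by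
  have hD := Dn_pos (φ := φ) h0 h1
  have h2 : sin φ * cos r ≠ -1 := by intro h; rw [h] at hD; norm_num at hD
  have h3 : sin φ * cos r ≠ 1 := by intro h; rw [h] at hD; norm_num at hD
  have := (hasDerivAt_arcsin h2 h3).comp φ ((hasDerivAt_sin φ).mul_const (cos r))
  refine this.congr_deriv ?_
  simp only [Dn]; ring

/-- Upper boundary in polar coordinates -/
noncomputable def bb (r φ : ℝ) : ℝ := arccos (cos φ * cos r / Dn r φ)

theorem bb_spec {r φ : ℝ} (h0 : 0 < r) (h1 : r < π / 2) (hφ0 : 0 ≤ φ) (hφ1 : φ < π / 2) :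
    cos (bb r φ) = cos φ * cos r / Dn r φ ∧ sin (bb r φ) = sin r / Dn r φ ∧ 0 ≤ bb r φ ∧ bb r φ ≤ π ∧ r ≤ bb r φ := by
  have hD := Dn_pos (φ := φ) h0 h1
  have hs : 0 < sin r := sin_pos_of_pos_of_lt_pi h0 (by linarith [pi_pos])
  have hc : 0 < cos r := cos_pos_of_mem_Ioo ⟨by linarith, h1⟩
  have hcφ : 0 < cos φ := cos_pos_of_mem_Ioo ⟨by linarith [pi_pos], hφ1⟩
  have hDp : 0 < Dn r φ := Real.sqrt_pos.2 hD
  have hDsq : Dn r φ ^ 2 = 1 - (sin φ * cos r) ^ 2 := Real.sq_sqrt hD.le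
  have hid : (cos φ * cos r) ^ 2 + sin r ^ 2 = Dn r φ ^ 2 := by
    rw [hDsq, mul_pow, mul_pow, cos_sq' φ, sin_sq r]; ring
  have hle : cos φ * cos r / Dn r φ ≤ 1 := by
    rw [div_le_one hDp]; nlinarith [mul_pos hcφ hc, sq_nonneg (sin r)]
  have h00 : 0 ≤ cos φ * cos r / Dn r φ := by positivity
  have c1 : cos (bb r φ) = cos φ * cos r / Dn r φ := cos_arccos (by linarith) hle
  have b0 : 0 ≤ bb r φ := arccos_nonneg _
  have b1 : bb r φ ≤ π := arccos_le_pi _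
  have c2 : sin (bb r φ) = sin r / Dn r φ := by
    have : 0 ≤ sin (bb r φ) := sin_nonneg_of_nonneg_of_le_pi b0 b1
    rw [← sq_eq_sq₀ this (by positivity), sin_sq, c1, div_pow, div_pow]
    field_simp; linarith
  refine ⟨c1, c2, b0, b1, ?_⟩
  by_contra hcon
  push Not at hcon
  have : 0 < sin (r - bb r φ) := sin_pos_of_pos_of_lt_pi (by linarith) (by linarith)
  rw [sin_sub, c1, c2] at this
  have h5 : sin r * (cos φ * cos r / Dn r φ) - cos r * (sin r / Dn r φ) = -(sin r * cos r * (1 - cos φ) / Dn r φ) := by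
    field_simp; ring
  rw [h5] at this
  have : 0 ≤ sin r * cos r * (1 - cos φ) / Dn r φ := by
    have := cos_le_one φ
    have : 0 ≤ 1 - cos φ := by linarith
    positivity
  linarith

theorem bb_iff {r φ s : ℝ} (h0 : 0 < r) (h1 : r < π / 2) (hφ0 : 0 ≤ φ) (hφ1 : φ < π / 2) (hs : s ∈ Ioo 0 π) :
    -sin r * cos s + cos r * (sin s * cos φ) ≤ 0 ↔ s ≤ bb r φ := by
  obtain ⟨c1, c2, b0, b1, -⟩ := bb_spec h0 h1 hφ0 hφ1
  have hD := Dn_pos (φ := φ) h0 h1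
  have hDp : 0 < Dn r φ := Real.sqrt_pos.2 hD
  have e : sin (s - bb r φ) = (-sin r * cos s + cos r * (sin s * cos φ)) / Dn r φ := by
    rw [sin_sub, c1, c2]; field_simp; ring
  constructor
  · intro h
    by_contra hcon
    push Not at hcon
    have : 0 < sin (s - bb r φ) := sin_pos_of_pos_of_lt_pi (by linarith) (by linarith [hs.2])
    rw [e] at this
    have := (div_pos_iff_of_pos_right hDp).1 this
    linarith
  · intro h
    have : sin (s - bb r φ) ≤ 0 := sin_nonpos_of_nonpos_of_neg_pi_le (by linarith) (by linarith [hs.1])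
    rw [e] at this
    by_contra hcon
    push Not at hcon
    have := div_pos hcon hDp
    linarith

theorem cap_coords {r a t s θ : ℝ} (h0 : 0 < r) (h1 : r < π / 2) (ha0 : 0 < a) (ha1 : a < π / 2)
    (ht : 0 < t) (hs : s ∈ Ioo 0 π) (hθ : θ ∈ Ioo (-π) π) :
    t • sph (s, θ) ∈ cap (sb 0) (sb 1) (sb 2) r a ↔
      t < 1 ∧ |θ| < a ∧ r < s ∧ s ≤ bb r (a - |θ|) := by
  have hsp : 0 < sin s := sin_pos_of_mem_Ioo hs
  have hts : 0 < t * sin s := by positivity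
  have e0 : (t • sph (s, θ)) 0 = t * cos s := by simp [sph]
  have e1 : (t • sph (s, θ)) 1 = t * (sin s * cos θ) := by simp [sph]
  have e2 : (t • sph (s, θ)) 2 = t * (sin s * sin θ) := by simp [sph]
  have e3 : √((t * (sin s * cos θ)) ^ 2 + (t * (sin s * sin θ)) ^ 2) = t * sin s := by
    rw [show (t * (sin s * cos θ)) ^ 2 + (t * (sin s * sin θ)) ^ 2 = (t * sin s) ^ 2 by
      linear_combination (t * sin s) ^ 2 * sin_sq_add_cos_sq θ]
    exact Real.sqrt_sq hts.le
  simp only [cap, mem_ofPred_eq, sb_inner, norm_smul, norm_sph, e0, e1, e2, e3]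
  simp only [Real.norm_eq_abs, abs_of_pos ht, mul_one]
  have k1 : cos a * (t * sin s) < t * (sin s * cos θ) ↔ |θ| < a := by
    rw [← mul_assoc t, mul_comm (t * sin s), mul_lt_mul_iff_left₀ hts, ← cos_abs θ]
    exact strictAntiOn_cos.lt_iff_gt ⟨ha0.le, by linarith⟩ ⟨abs_nonneg θ, (abs_lt.2 hθ).le⟩
  have k2 : t * cos s < cos r * t ↔ r < s := by
    rw [mul_comm, mul_lt_mul_iff_left₀ ht]
    exact strictAntiOn_cos.lt_iff_gt ⟨hs.1.le, hs.2.le⟩ ⟨h0.le, by linarith⟩ 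
  have k3 : -sin r * (t * cos s) + cos r * (cos a * (t * (sin s * cos θ)) + sin a * (t * (sin s * sin θ))) ≤ 0 ↔
      -sin r * cos s + cos r * (sin s * cos (a - θ)) ≤ 0 := by
    rw [show -sin r * (t * cos s) + cos r * (cos a * (t * (sin s * cos θ)) + sin a * (t * (sin s * sin θ))) = 
       t * (-sin r * cos s + cos r * (sin s * cos (a - θ))) by rw [cos_sub]; ring]
    exact mul_nonpos_iff_pos_imp_nonpos.trans ⟨fun h => h.1 ht, fun h => ⟨fun _ => h, fun _ => ht.le⟩⟩
  have k4 : -sin r * (t * cos s) + cos r * (cos a * (t * (sin s * cos θ)) - sin a * (t * (sin s * sin θ))) ≤ 0 ↔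
      -sin r * cos s + cos r * (sin s * cos (a + θ)) ≤ 0 := by
    rw [show -sin r * (t * cos s) + cos r * (cos a * (t * (sin s * cos θ)) - sin a * (t * (sin s * sin θ))) = 
       t * (-sin r * cos s + cos r * (sin s * cos (a + θ))) by rw [cos_add]; ring]
    exact mul_nonpos_iff_pos_imp_nonpos.trans ⟨fun h => h.1 ht, fun h => ⟨fun _ => h, fun _ => ht.le⟩⟩
  rw [k1, k2, k3, k4]
  have hc : 0 < cos r := cos_pos_of_mem_Ioo ⟨by linarith, h1⟩
  refine and_congr_right fun _ => and_congr_right fun hθa => and_congr_right fun _ => ?_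
  rw [← bb_iff h0 h1 (by linarith) (by linarith [abs_nonneg θ]) hs]
  have mono : cos (a + |θ|) ≤ cos (a - |θ|) := 
    cos_le_cos_of_nonneg_of_le_pi (by linarith) (by linarith) (by linarith [abs_nonneg θ])
  have mono2 : -sin r * cos s + cos r * (sin s * cos (a + |θ|)) ≤ -sin r * cos s + cos r * (sin s * cos (a - |θ|)) := by
    gcongr
  rcases le_total 0 θ with h | h
  · rw [abs_of_nonneg h] at *
    exact ⟨fun h => h.1, fun h => ⟨h, by linarith⟩⟩
  · rw [abs_of_nonpos h] at *
    rw [sub_neg_eq_add] at *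
    exact ⟨fun h => h.2, fun h => ⟨by rw [← sub_eq_add_neg] at mono2; linarith, h⟩⟩

theorem vol_cap0 (r a : ℝ) (h0 : 0 < r) (h1 : r < π / 2) (ha0 : 0 < a) (ha1 : a < π / 2) :
    volume (cap (sb 0) (sb 1) (sb 2) r a) =
      ENNReal.ofReal (2 / 3 * (a * cos r - arcsin (sin a * cos r))) := by
  rw [vol_sph _ (meas_cap _ _ _ _ _) (fun _ => r) (fun θ => if |θ| < a then bb r (a - |θ|) else r)]
  · let G : ℝ → ℝ := fun θ => (cos r - cos (a - |θ|) * cos r / Dn r (a - |θ|)) / 3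
    have hpt : ∀ θ, |θ| < a → cos (bb r (a - |θ|)) = cos (a - |θ|) * cos r / Dn r (a - |θ|) ∧ 
        r ≤ bb r (a - |θ|) ∧ bb r (a - |θ|) ≤ π := fun θ hθ => by
      obtain ⟨c1, c2, b0, b1, b2⟩ := bb_spec h0 h1 (show 0 ≤ a - |θ| by linarith) (by linarith [abs_nonneg θ])
      exact ⟨c1, b2, b1⟩
    have hG : Continuous G := by
      have : ∀ θ, Dn r (a - |θ|) ≠ 0 := fun θ => (Real.sqrt_pos.2 (Dn_pos h0 h1)).ne'
      have hDc : Continuous (fun θ => Dn r (a - |θ|)) := by unfold Dn; fun_prop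
      exact ((continuous_const.sub (Continuous.div (by fun_prop) hDc this)).div_const 3)
    have hGn : ∀ θ, |θ| < a → 0 ≤ G θ := fun θ hθ => by
      obtain ⟨c1, b2, b3⟩ := hpt θ hθ
      have : cos (bb r (a - |θ|)) ≤ cos r := cos_le_cos_of_nonneg_of_le_pi h0.le b3 b2
      simp only [G]; rw [← c1]; linarith
    have e1 : ∫⁻ θ in Ioo (-π) π, ENNReal.ofReal ((cos r - cos (if |θ| < a then bb r (a - |θ|) else r)) / 3)
        = ∫⁻ θ in Ioc (-a) a, ENNReal.ofReal (G θ) := by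
      rw [← restrict_Ioo_eq_restrict_Ioc, ← lintegral_indicator measurableSet_Ioo, ← lintegral_indicator measurableSet_Ioo]
      congr 1; ext θ
      by_cases h : |θ| < a
      · have h2 := abs_lt.1 h
        have h3 : θ ∈ Ioo (-a) a := h2
        have h4 : θ ∈ Ioo (-π) π := ⟨by linarith [h2.1], by linarith [h2.2]⟩
        simp only [Set.indicator_of_mem h3, Set.indicator_of_mem h4, if_pos h, (hpt θ h).1, G]
      · have h3 : θ ∉ Ioo (-a) a := fun h' => h (abs_lt.2 h')
        rw [Set.indicator_of_notMem h3]; simp [h, Set.indicator]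
    rw [e1, ← ofReal_integral_eq_lintegral_ofReal, ← intervalIntegral.integral_of_le (by linarith)]
    · congr 1
      rw [← intervalIntegral.integral_add_adjacent_intervals (b := 0) (hG.intervalIntegrable _ _) (hG.intervalIntegrable _ _)]
      have i1 : ∫ θ in (-a)..0, G θ = ∫ θ in (0:ℝ)..a, G θ := by
        have := intervalIntegral.integral_comp_neg G (a := -a) (b := 0)
        simp only [neg_zero, neg_neg] at this
        rw [← this]
        congr 1; ext θ; simp [G]
      have i2 : ∫ θ in (0:ℝ)..a, G θ = (a * cos r - arcsin (sin a * cos r)) / 3 := by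
        have hd : ∀ x ∈ uIcc (0:ℝ) a, HasDerivAt (fun θ => (θ * cos r + arcsin (sin (a - θ) * cos r)) / 3) (G x) x := by
          intro x hx
          rw [uIcc_of_le ha0.le] at hx
          have d1 := (arcsin_deriv (φ := a - x) h0 h1).comp x ((hasDerivAt_id x).const_sub a)
          have d2 := (((hasDerivAt_id x).mul_const (cos r)).add d1).div_const 3
          refine d2.congr_deriv ?_
          simp only [G, abs_of_nonneg hx.1]; ring
        rw [intervalIntegral.integral_eq_sub_of_hasDerivAt hd (hG.intervalIntegrable _ _)]
        simp; ring
      rw [i1, i2]; ring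
    · exact (Continuous.integrableOn_Icc hG).mono_set Ioc_subset_Icc_self
    · rw [← restrict_Ioo_eq_restrict_Ioc]
      filter_upwards [ae_restrict_mem measurableSet_Ioo] with θ hθ
      exact hGn θ (abs_lt.2 hθ)
  · intro θ _
    refine ⟨h0.le, ?_⟩
    split_ifs with h
    · obtain ⟨c1, c2, b0, b1, b2⟩ := bb_spec h0 h1 (show 0 ≤ a - |θ| by linarith) (by linarith [abs_nonneg θ])
      exact ⟨b2, b1⟩
    · exact ⟨le_rfl, by linarith⟩
  · intro t ht s hs θ hθ
    rw [cap_coords h0 h1 ha0 ha1 ht hs hθ]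
    split_ifs with h
    · simp [h]
    · simp only [h, false_and, and_false, false_iff]
      intro h; linarith

theorem vol_cap {p f g : E 2} (h : Frame p f g) (r a : ℝ) (h0 : 0 < r) (h1 : r < π / 2) (ha0 : 0 < a) (ha1 : a < π / 2) :
    volume (cap p f g r a) = ENNReal.ofReal (2 / 3 * (a * cos r - arcsin (sin a * cos r))) := by
  rw [← vol_cap0 r a h0 h1 ha0 ha1, ← vol_frame h (cap (sb 0) (sb 1) (sb 2) r a) (meas_cap _ _ _ _ _)]
  congr 1
  ext X
  simp [cap, sb_inner, frame_norm h]

end SPaux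

end

section
open Set Real

namespace SPaux

/-- cosine of the half angle of a cap -/
noncomputable def ka (w r : ℝ) : ℝ := sin r * cos (w - r) / (cos r * sin (w - r))
noncomputable def al (w r : ℝ) : ℝ := arccos (ka w r)
noncomputable def Ph (w r : ℝ) : ℝ := π / 3 * (1 - cos r) + al w r * cos r - arcsin (sin (al w r) * cos r)

theorem trig_pos {w r : ℝ} (hw0 : 0 < w) (hw : w ≤ π / 2) (hr0 : 0 < r) (hr : r ≤ w / 2) :
    0 < sin r ∧ 0 < cos r ∧ 0 < sin (w - r) ∧ 0 < cos (w - r) ∧ 0 < sin w := by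
  refine ⟨sin_pos_of_pos_of_lt_pi ?_ ?_, cos_pos_of_mem_Ioo ⟨?_, ?_⟩, sin_pos_of_pos_of_lt_pi ?_ ?_, 
    cos_pos_of_mem_Ioo ⟨?_, ?_⟩, sin_pos_of_pos_of_lt_pi ?_ ?_⟩ <;> linarith [pi_pos]

theorem ka_pos {w r : ℝ} (hw0 : 0 < w) (hw : w ≤ π / 2) (hr0 : 0 < r) (hr : r ≤ w / 2) : 0 < ka w r := by
  obtain ⟨h1, h2, h3, h4, h5⟩ := trig_pos hw0 hw hr0 hr
  unfold ka; positivity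

theorem sin_w2 (w r : ℝ) : sin (w - 2 * r) = sin (w - r) * cos r - cos (w - r) * sin r := by
  rw [← sin_sub]; congr 1; ring

theorem sin_w (w r : ℝ) : sin w = sin (w - r) * cos r + cos (w - r) * sin r := by
  rw [← sin_add]; congr 1; ring

theorem ka_le {w r : ℝ} (hw0 : 0 < w) (hw : w ≤ π / 2) (hr0 : 0 < r) (hr : r ≤ w / 2) : ka w r ≤ 1 := by
  obtain ⟨h1, h2, h3, h4, h5⟩ := trig_pos hw0 hw hr0 hr
  have : 0 ≤ sin (w - 2 * r) := sin_nonneg_of_nonneg_of_le_pi (by linarith) (by linarith [pi_pos])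
  rw [sin_w2] at this
  unfold ka; rw [div_le_one (by positivity)]; linarith

theorem ka_lt {w r : ℝ} (hw0 : 0 < w) (hw : w ≤ π / 2) (hr0 : 0 < r) (hr : r < w / 2) : ka w r < 1 := by
  obtain ⟨h1, h2, h3, h4, h5⟩ := trig_pos hw0 hw hr0 hr.le
  have : 0 < sin (w - 2 * r) := sin_pos_of_pos_of_lt_pi (by linarith) (by linarith [pi_pos])
  rw [sin_w2] at this
  unfold ka; rw [div_lt_one (by positivity)]; linarith

theorem cos_al {w r : ℝ} (hw0 : 0 < w) (hw : w ≤ π / 2) (hr0 : 0 < r) (hr : r ≤ w / 2) : 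
    cos (al w r) = ka w r :=
  cos_arccos (by linarith [ka_pos hw0 hw hr0 hr]) (ka_le hw0 hw hr0 hr)

theorem al_lt {w r : ℝ} (hw0 : 0 < w) (hw : w ≤ π / 2) (hr0 : 0 < r) (hr : r ≤ w / 2) : 
    al w r < π / 2 := arccos_lt_pi_div_two.2 (ka_pos hw0 hw hr0 hr)

theorem al_pos {w r : ℝ} (hw0 : 0 < w) (hw : w ≤ π / 2) (hr0 : 0 < r) (hr : r < w / 2) : 
    0 < al w r := arccos_pos.2 (ka_lt hw0 hw hr0 hr)

theorem al_half {w : ℝ} (hw0 : 0 < w) (hw : w ≤ π / 2) : al w (w / 2) = 0 := by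
  obtain ⟨h1, h2, h3, h4, h5⟩ := trig_pos hw0 hw (half_pos hw0) le_rfl
  unfold al ka
  rw [show w - w / 2 = w / 2 by ring, mul_comm, div_self (by positivity), arccos_one]

theorem al_le_third {w r₀ r : ℝ} (hw0 : 0 < w) (hw : w ≤ π / 2) (hr0 : 0 < r₀) (hk : ka w r₀ = 1 / 2)
    (hr₀ : r₀ ≤ r) (hr : r ≤ w / 2) : al w r ≤ π / 3 := by
  obtain ⟨h1, h2, h3, h4, h5⟩ := trig_pos hw0 hw (hr0.trans_le hr₀) hr
  obtain ⟨g1, g2, g3, g4, g5⟩ := trig_pos hw0 hw hr0 (hr₀.trans hr)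
  have hm : sin (w - 2 * r) ≤ sin (w - 2 * r₀) := by
    apply sin_le_sin_of_le_of_le_pi_div_two <;> linarith [pi_pos]
  rw [sin_w2, sin_w2] at hm
  unfold ka at hk
  rw [div_eq_iff (by positivity)] at hk
  have e1 := sin_w w r
  have e2 := sin_w w r₀
  have : 1 / 2 ≤ ka w r := by
    unfold ka; rw [le_div_iff₀ (by positivity)]; nlinarith
  have h := arccos_le_arccos this
  rw [← cos_pi_div_three, arccos_cos (by positivity) (by linarith [pi_pos])] at h
  exact h

theorem al_r0 {w r₀ : ℝ} (hk : ka w r₀ = 1 / 2) : al w r₀ = π / 3 := by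
  unfold al; rw [hk, ← cos_pi_div_three, arccos_cos (by positivity) (by linarith [pi_pos])]

theorem ka_cont {w : ℝ} (hw0 : 0 < w) (hw : w ≤ π / 2) {r₀ : ℝ} (hr0 : 0 < r₀) :
    ContinuousOn (ka w) (Icc r₀ (w / 2)) := by
  unfold ka
  apply ContinuousOn.div (by fun_prop) (by fun_prop)
  intro r hr
  obtain ⟨h1, h2, h3, h4, h5⟩ := trig_pos hw0 hw (hr0.trans_le hr.1) hr.2
  positivity

theorem al_cont {w : ℝ} (hw0 : 0 < w) (hw : w ≤ π / 2) {r₀ : ℝ} (hr0 : 0 < r₀) :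
    ContinuousOn (al w) (Icc r₀ (w / 2)) := continuous_arccos.comp_continuousOn (ka_cont hw0 hw hr0)

theorem Ph_cont {w : ℝ} (hw0 : 0 < w) (hw : w ≤ π / 2) {r₀ : ℝ} (hr0 : 0 < r₀) :
    ContinuousOn (Ph w) (Icc r₀ (w / 2)) := by
  have := al_cont hw0 hw hr0
  unfold Ph
  apply ContinuousOn.sub (by fun_prop)
  apply continuous_arcsin.comp_continuousOn
  fun_prop

noncomputable def Hh (w r : ℝ) : ℝ := (π / 3 - al w r) * sin r + sin w * (1 - cos (w - 2 * r))

theorem ka_deriv {w r : ℝ} (hw0 : 0 < w) (hw : w ≤ π / 2) (hr0 : 0 < r) (hr : r ≤ w / 2) :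
    HasDerivAt (ka w) (sin w * cos (w - 2 * r) / (cos r * sin (w - r)) ^ 2) r := by
  obtain ⟨h1, h2, h3, h4, h5⟩ := trig_pos hw0 hw hr0 hr
  have ds : HasDerivAt (fun x => sin (w - x)) (-cos (w - r)) r := by
    have := (hasDerivAt_sin (w - r)).comp r ((hasDerivAt_id r).const_sub w)
    exact this.congr_deriv (by ring)
  have dc : HasDerivAt (fun x => cos (w - x)) (sin (w - r)) r := by
    have := (hasDerivAt_cos (w - r)).comp r ((hasDerivAt_id r).const_sub w)
    exact this.congr_deriv (by ring)
  have := ((hasDerivAt_sin r).mul dc).div ((hasDerivAt_cos r).mul ds) (by simp only [Pi.mul_apply]; positivity)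
  refine this.congr_deriv ?_
  have e2 : cos (w - 2 * r) = cos (w - r) * cos r + sin (w - r) * sin r := by
    rw [← cos_sub]; congr 1; ring
  congr 1
  rw [e2, sin_w w r]
  simp only [Pi.mul_apply]
  ring

theorem Ph_deriv {w r : ℝ} (hw0 : 0 < w) (hw : w ≤ π / 2) (hr0 : 0 < r) (hr : r < w / 2) :
    ∃ D, HasDerivAt (Ph w) D r ∧ Hh w r ≤ D := by
  obtain ⟨h1, h2, h3, h4, h5⟩ := trig_pos hw0 hw hr0 hr.le
  have k0 := ka_pos hw0 hw hr0 hr.le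
  have k1 := ka_lt hw0 hw hr0 hr
  have hS : 0 < sin (w - 2 * r) := sin_pos_of_pos_of_lt_pi (by linarith) (by linarith [pi_pos])
  have hsa : 0 < sin (al w r) := sin_pos_of_pos_of_lt_pi (al_pos hw0 hw hr0 hr) (by linarith [al_lt hw0 hw hr0 hr.le, pi_pos])
  have hca := cos_al hw0 hw hr0 hr.le
  have hsq : sin (al w r) = √(1 - ka w r ^ 2) := by rw [al, sin_arccos]
  have hkc : ka w r * (cos r * sin (w - r)) = sin r * cos (w - r) := by
    unfold ka; field_simp
  set A := al w r with hA
  set κ := ka w r with hκ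
  set d := w - r with hd
  have da : HasDerivAt (al w) (-(sin w * cos (w - 2 * r) / (cos r * sin d) ^ 2) / sin A) r := by
    have := (hasDerivAt_arccos (x := κ) (by linarith) (by linarith)).comp r (ka_deriv hw0 hw hr0 hr.le)
    refine this.congr_deriv ?_
    rw [← hsq]; ring
  have hq : (sin A) ^ 2 = 1 - κ ^ 2 := by rw [← hca]; linarith [sin_sq_add_cos_sq A]
  have hroot : √(1 - (sin A * cos r) ^ 2) = sin r / sin d := by
    have : 1 - (sin A * cos r) ^ 2 = (sin r / sin d) ^ 2 := by
      rw [mul_pow, hq, div_pow, eq_div_iff (by positivity)]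
      linear_combination (κ * (cos r * sin d) + sin r * cos d) * hkc + sin d ^ 2 * sin_sq_add_cos_sq r * (-1) +
        sin r ^ 2 * sin_sq_add_cos_sq d
    rw [this, Real.sqrt_sq (by positivity)]
  have hlt : (sin A * cos r) ^ 2 < 1 := by
    have : 0 < √(1 - (sin A * cos r) ^ 2) := by rw [hroot]; positivity
    have := Real.sqrt_pos.1 this
    linarith
  have hne1 : sin A * cos r ≠ 1 := by intro h; rw [h] at hlt; norm_num at hlt
  have hne2 : sin A * cos r ≠ -1 := by intro h; rw [h] at hlt; norm_num at hlt
  have db := (hasDerivAt_arcsin (x := sin (al w r) * cos r) hne2 hne1).comp r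
    (((hasDerivAt_sin (al w r)).comp r da).mul (hasDerivAt_cos r))
  have dP := ((((hasDerivAt_cos r).const_sub 1).const_mul (π / 3)).add (da.mul (hasDerivAt_cos r))).sub db
  refine ⟨_, dP, ?_⟩
  rw [← hA, hroot, hca]
  set W := sin w * cos (w - 2 * r) / (cos r * sin d) ^ 2 with hW
  have hWm : W * (cos r * sin d) ^ 2 = sin w * cos (w - 2 * r) := by rw [hW]; field_simp
  have hs2 : sin A ^ 2 * (cos r * sin d) ^ 2 = sin (w - 2 * r) * sin w := by
    rw [hq, sin_w2, sin_w w r, ← hd]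
    linear_combination (-(κ * (cos r * sin d)) - sin r * cos d) * hkc
  have e2 : cos r = cos (w - 2 * r) * cos d + sin (w - 2 * r) * sin d := by
    rw [← cos_sub, hd, ← cos_neg]; congr 1; ring
  have hN : (sin A ^ 2 * sin d - W * (cos r - cos d)) * (cos r * sin d) ^ 2 = cos r * (sin w * (1 - cos (w - 2 * r))) := by
    linear_combination sin d * hs2 - (cos r - cos d) * hWm + sin w * (-1) * e2
  have hX : 0 ≤ sin w * (1 - cos (w - 2 * r)) := by
    have := cos_le_one (w - 2 * r)
    exact mul_nonneg h5.le (by linarith)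
  have hN2 : sin w * (1 - cos (w - 2 * r)) ≤ sin A ^ 2 * sin d - W * (cos r - cos d) := by
    have hd1 : sin d ^ 2 ≤ 1 := by nlinarith [sin_le_one d]
    have hc1 := cos_le_one r
    have hp : 0 < (cos r * sin d) ^ 2 := by positivity
    have hle : (cos r * sin d) ^ 2 ≤ cos r := by
      rw [mul_pow]; nlinarith [sq_nonneg (cos r)]
    refine le_of_mul_le_mul_right ?_ hp
    rw [hN, mul_comm]
    exact mul_le_mul_of_nonneg_right hle hX
  have hN3 : sin w * (1 - cos (w - 2 * r)) ≤ (sin A ^ 2 * sin d - W * (cos r - cos d)) / sin A := by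
    rw [le_div_iff₀ hsa]
    nlinarith [sin_le_one A]
  have hfin : π / 3 * (- -sin r) + (-W / sin A * cos r + A * -sin r) -
      1 / (sin r / sin d) * (κ * (-W / sin A) * cos r + sin A * -sin r) = 
      (π / 3 - A) * sin r + (sin A ^ 2 * sin d - W * (cos r - cos d)) / sin A := by
    field_simp
    linear_combination 3 * W * hkc
  have := hfin.ge
  simp only [Function.comp] at *
  unfold Hh
  rw [← hA]
  linarith

theorem calc_main {w r₀ : ℝ} (hw0 : 0 < w) (hw : w ≤ π / 2) (hr0 : 0 < r₀) (hr₀ : r₀ < w / 2)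
    (hk : ka w r₀ = 1 / 2) :
    ∃ m > 0, ∀ r ∈ Icc r₀ (w / 2), m * (r - r₀) ≤ Ph w r - Ph w r₀ := by
  have hc : ContinuousOn (Hh w) (Icc r₀ (w / 2)) := by
    have := al_cont hw0 hw hr0
    unfold Hh
    fun_prop
  obtain ⟨x, hx, hmin⟩ := isCompact_Icc.exists_isMinOn ⟨r₀, left_mem_Icc.2 hr₀.le⟩ hc
  have hpos : 0 < Hh w x := by
    obtain ⟨h1, h2, h3, h4, h5⟩ := trig_pos hw0 hw (hr0.trans_le hx.1) hx.2
    have hal := al_le_third hw0 hw hr0 hk hx.1 hx.2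
    unfold Hh
    rcases eq_or_lt_of_le hx.2 with h | h
    · subst h
      have : w - 2 * (w / 2) = 0 := by ring
      rw [this, cos_zero, al_half hw0 hw]
      have := mul_pos (show 0 < π / 3 - 0 by linarith [pi_pos]) h1
      linarith
    · have hlt : cos (w - 2 * x) < 1 := by
        rw [← cos_zero]
        apply cos_lt_cos_of_nonneg_of_le_pi <;> linarith [hx.1, pi_pos]
      have := mul_pos h5 (sub_pos.2 hlt)
      have := mul_nonneg (sub_nonneg.2 hal) h1.le
      linarith
  refine ⟨Hh w x, hpos, ?_⟩
  intro r hr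
  have hD : ∀ y ∈ interior (Icc r₀ (w / 2)), ∃ D, HasDerivAt (Ph w) D y ∧ Hh w y ≤ D := by
    intro y hy
    rw [interior_Icc] at hy
    exact Ph_deriv hw0 hw (hr0.trans hy.1) hy.2
  refine (convex_Icc r₀ (w / 2)).mul_sub_le_image_sub_of_le_deriv (Ph_cont hw0 hw hr0) ?_ ?_ r₀ 
    (left_mem_Icc.2 hr₀.le) r hr hr.1
  · intro y hy
    obtain ⟨D, h, -⟩ := hD y hy
    exact h.differentiableAt.differentiableWithinAt
  · intro y hy
    obtain ⟨D, h, h'⟩ := hD y hy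
    rw [h.deriv]
    exact (hmin (interior_subset hy)).trans h'

end SPaux

end

section
open Metric Set SphericalPal Real
open scoped RealInnerProductSpace NNReal

namespace SPaux

theorem us {x : E 2} : x ∈ unitSphere 2 ↔ ‖x‖ = 1 := by simp [unitSphere]

theorem gdist_eq {x y : E 2} (hx : ‖x‖ = 1) (hy : ‖y‖ = 1) :
    gdist x y = InnerProductGeometry.angle x y := by
  simp [gdist, InnerProductGeometry.angle, hx, hy]

theorem norm_nrm {X : E 2} (hX : X ≠ 0) : ‖(‖X‖⁻¹ • X)‖ = 1 := by
  rw [norm_smul, norm_inv, norm_norm, inv_mul_cancel₀ (norm_ne_zero_iff.2 hX)]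

/-- Cone over a set. -/
def cn (K : Set (E 2)) : Set (E 2) := {X | X = 0 ∨ ‖X‖⁻¹ • X ∈ K}

theorem cn_of_mem {K : Set (E 2)} (hK : K ⊆ unitSphere 2) {x : E 2} (hx : x ∈ K) : x ∈ cn K := by
  right; rw [us.1 (hK hx)]; simpa

theorem cn_smul {K : Set (E 2)} {X : E 2} (hX : X ∈ cn K) {t : ℝ} (ht : 0 ≤ t) : t • X ∈ cn K := by
  rcases ht.eq_or_lt with rfl | ht
  · left; simp
  rcases hX with rfl | hX
  · left; simp
  · right
    rw [norm_smul, Real.norm_of_nonneg ht.le, mul_inv, smul_smul]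
    rwa [show t⁻¹ * ‖X‖⁻¹ * t = ‖X‖⁻¹ by field_simp]

theorem seg_mem {x y : E 2} (hx : ‖x‖ = 1) (hy : ‖y‖ = 1) {a b : ℝ} (ha : 0 ≤ a) (hb : 0 ≤ b)
    (h : a • x + b • y ≠ 0) : ‖a • x + b • y‖⁻¹ • (a • x + b • y) ∈ seg x y := by
  have hn := norm_nrm h
  refine ⟨us.2 hn, ?_⟩
  rw [gdist_eq hx hn, gdist_eq hn hy, gdist_eq hx hy]
  have hp : 0 < ‖a • x + b • y‖⁻¹ := by positivity
  rw [InnerProductGeometry.angle_smul_left_of_pos _ _ hp, InnerProductGeometry.angle_smul_right_of_pos _ _ hp]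
  symm
  rw [InnerProductGeometry.angle_eq_angle_add_angle_iff h]
  right
  rw [Submodule.mem_span_pair]
  exact ⟨⟨a, ha⟩, ⟨b, hb⟩, rfl⟩

theorem mem_seg {x y z : E 2} (hx : ‖x‖ = 1) (hy : ‖y‖ = 1) (hxy : x ≠ -y) (h : z ∈ seg x y) :
    ∃ a b : ℝ, 0 ≤ a ∧ 0 ≤ b ∧ z = a • x + b • y := by
  obtain ⟨h1, h2⟩ := h
  have hz := us.1 h1
  rw [gdist_eq hx hz, gdist_eq hz hy, gdist_eq hx hy] at h2
  have hz0 : z ≠ 0 := by rintro rfl; simp at hz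
  rcases (InnerProductGeometry.angle_eq_angle_add_angle_iff hz0).1 h2.symm with h | h
  · exfalso
    have := InnerProductGeometry.inner_eq_neg_mul_norm_of_angle_eq_pi h
    rw [hx, hy] at this
    have : ⟪x, -y⟫ = (1:ℝ) := by rw [inner_neg_right, this]; norm_num
    rw [inner_eq_one_iff_of_norm_eq_one hx (by simpa)] at this
    exact hxy this
  · rw [Submodule.mem_span_pair] at h
    obtain ⟨a, b, h⟩ := h
    exact ⟨a, b, a.2, b.2, h.symm⟩

theorem cn_add {K : Set (E 2)} (hK : SConvex K) {X Y : E 2} (hX : X ∈ cn K) (hY : Y ∈ cn K) : X + Y ∈ cn K := by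
  by_cases hX0 : X = 0
  · simpa [hX0]
  by_cases hY0 : Y = 0
  · simpa [hY0]
  by_cases h0 : X + Y = 0
  · left; exact h0
  replace hX := hX.resolve_left hX0
  replace hY := hY.resolve_left hY0
  right
  have hx := norm_nrm hX0
  have hy := norm_nrm hY0
  have e : X + Y = ‖X‖ • (‖X‖⁻¹ • X) + ‖Y‖ • (‖Y‖⁻¹ • Y) := by
    rw [smul_smul, smul_smul, mul_inv_cancel₀ (norm_ne_zero_iff.2 hX0), mul_inv_cancel₀ (norm_ne_zero_iff.2 hY0)]
    simp
  have := seg_mem hx hy (norm_nonneg X) (norm_nonneg Y) (by rw [← e]; exact h0)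
  rw [← e] at this
  exact hK.2.2 _ hX _ hY this

theorem cn_closed {K : Set (E 2)} (hK : IsCompact K) : IsClosed (cn K) := by
  rw [← isOpen_compl_iff]
  have : (cn K)ᶜ = {0}ᶜ ∩ (fun X : E 2 => ‖X‖⁻¹ • X) ⁻¹' Kᶜ := by
    ext X; simp [cn]
  rw [this]
  apply ContinuousOn.isOpen_inter_preimage _ isOpen_compl_singleton hK.isClosed.isOpen_compl
  intro X hX
  apply ContinuousAt.continuousWithinAt
  have : ‖X‖ ≠ 0 := norm_ne_zero_iff.2 hX
  fun_prop (disch := assumption)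

theorem polar_inner {K : Set (E 2)} {X u : E 2} (hX : X ∈ cn K) (hu : u ∈ polar K) : ⟪X, u⟫ ≤ 0 := by
  rcases hX with rfl | hX
  · simp
  · have := hu.2 _ hX
    by_cases h0 : X = 0
    · simp [h0]
    rw [real_inner_smul_left] at this
    have hp : 0 < ‖X‖⁻¹ := by positivity
    by_contra h
    push Not at h
    have := mul_pos hp h
    linarith

theorem bipolar {K : Set (E 2)} (hK : SConvex K) (hc : IsCompact K) {X : E 2}
    (h : ∀ u ∈ polar K, ⟪X, u⟫ ≤ 0) : X ∈ cn K := by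
  by_contra hX
  let C : ProperCone ℝ (E 2) :=
    { carrier := cn K
      add_mem' := cn_add hK
      zero_mem' := Or.inl rfl
      smul_mem' := fun c x hx => cn_smul hx c.2
      isClosed' := cn_closed hc }
  obtain ⟨y, hy, hy0⟩ := C.hyperplane_separation' (x₀ := X) hX
  have hyn : y ≠ 0 := by rintro rfl; simp at hy0
  have hp : 0 < ‖y‖⁻¹ := by positivity
  have hu : ‖y‖⁻¹ • (-y) ∈ polar K := by
    refine ⟨us.2 ?_, ?_⟩
    · rw [← norm_neg y]; exact norm_nrm (neg_ne_zero.2 hyn)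
    · intro a ha
      have := hy a (cn_of_mem hK.1 ha)
      rw [real_inner_smul_right, inner_neg_right]
      have := mul_nonneg hp.le this
      linarith
  have := h _ hu
  rw [real_inner_smul_right, inner_neg_right] at this
  have := mul_neg_of_pos_of_neg hp hy0
  linarith

theorem bipolar1 {K : Set (E 2)} (hK : SConvex K) (hc : IsCompact K) {X : E 2} (hX : ‖X‖ = 1)
    (h : ∀ u ∈ polar K, ⟪X, u⟫ ≤ 0) : X ∈ K := by
  rcases bipolar hK hc h with h | h
  · simp [h] at hX
  · rw [hX] at h; simpa using h

theorem polar_compact (K : Set (E 2)) : IsCompact (polar K) := by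
  have : polar K = unitSphere 2 ∩ ⋂ a ∈ K, {u | ⟪a, u⟫ ≤ 0} := by
    ext u; simp [polar]
  rw [this]
  apply (isCompact_sphere (0 : E 2) 1).inter_right
  exact isClosed_biInter fun a _ => isClosed_le (by fun_prop) continuous_const

theorem polar_nonempty {K : Set (E 2)} (hK : SConvex K) : (polar K).Nonempty := by
  obtain ⟨-, ⟨u, hu, h⟩, -⟩ := hK
  refine ⟨-u, us.2 (by simpa using us.1 hu), fun a ha => ?_⟩
  have := h a ha
  rw [inner_neg_right, real_inner_comm]; linarith

theorem breadth_eq {u v : E 2} (hu : ‖u‖ = 1) (hv : ‖v‖ = 1) (h1 : u ≠ v) (h2 : u ≠ -v) :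
    breadth u v = arccos (-⟪u, v⟫) ∧ -1 < ⟪u, v⟫ ∧ ⟪u, v⟫ < 1 := by
  have huu : ⟪u, u⟫ = (1:ℝ) := by rw [real_inner_self_eq_norm_sq, hu]; norm_num
  have hvv : ⟪v, v⟫ = (1:ℝ) := by rw [real_inner_self_eq_norm_sq, hv]; norm_num
  have hlt : ⟪u, v⟫ < 1 := (inner_lt_one_iff_real_of_norm_eq_one hu hv).2 h1
  have hgt : -1 < ⟪u, v⟫ := by
    have := (inner_lt_one_iff_real_of_norm_eq_one hu (y := -v) (by simpa)).2 h2
    rw [inner_neg_right] at this; linarith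
  refine ⟨?_, hgt, hlt⟩
  set c : ℝ := ⟪u, v⟫ with hc
  have hvu : ⟪v, u⟫ = c := real_inner_comm _ _
  have n1 : ‖c • u - v‖ ^ 2 = 1 - c ^ 2 := by
    rw [← real_inner_self_eq_norm_sq]
    simp only [inner_sub_left, inner_sub_right, real_inner_smul_left, real_inner_smul_right, huu, hvv, hvu, ← hc]; ring
  have n2 : ‖c • v - u‖ ^ 2 = 1 - c ^ 2 := by
    rw [← real_inner_self_eq_norm_sq]
    simp only [inner_sub_left, inner_sub_right, real_inner_smul_left, real_inner_smul_right, huu, hvv, hvu, ← hc]; ring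
  have n3 : ⟪c • u - v, c • v - u⟫ = -c * (1 - c ^ 2) := by
    simp only [inner_sub_left, inner_sub_right, real_inner_smul_left, real_inner_smul_right, huu, hvv, hvu, ← hc]; ring
  have n4 : ‖c • u - v‖ = ‖c • v - u‖ := by
    rw [← sq_eq_sq₀ (norm_nonneg _) (norm_nonneg _), n1, n2]
  have hpos : 0 < 1 - c ^ 2 := by nlinarith
  unfold breadth gdist luneFaceCenter
  rw [← hc, hvu, real_inner_smul_left, real_inner_smul_right, n3, n4]
  congr 1
  have : ‖c • v - u‖⁻¹ * (‖c • v - u‖⁻¹ * (-c * (1 - c ^ 2))) = -c * (1 - c ^ 2) / ‖c • v - u‖ ^ 2 := by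
    field_simp
  rw [this, n2]; field_simp

theorem width_le {K : Set (E 2)} {u v : E 2} (h : IsSupportingLune K u v) : width K ≤ breadth u v := by
  apply csInf_le
  · refine ⟨0, ?_⟩
    rintro b ⟨u, v, -, rfl⟩
    exact arccos_nonneg _
  · exact ⟨u, v, h, rfl⟩

theorem interior_lt {K : Set (E 2)} (hK : K ⊆ unitSphere 2) {x u : E 2} (hx : x ∈ sInterior K) (hu : u ∈ polar K) :
    ⟪x, u⟫ < 0 := by
  obtain ⟨hxK, ε, hε, h⟩ := hx
  refine lt_of_le_of_ne (hu.2 _ hxK) fun h0 => ?_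
  have hxn := us.1 (hK hxK)
  have hun := us.1 hu.1
  set δ := min (ε / 2) 1
  have hδ0 : 0 < δ := by positivity
  have hδ1 : δ < π := (min_le_right _ _).trans_lt (by linarith [pi_gt_three])
  have hδε : δ < ε := (min_le_left _ _).trans_lt (by linarith)
  have hy : ‖cos δ • x + sin δ • u‖ = 1 := by
    rw [← sq_eq_sq₀ (norm_nonneg _) zero_le_one, norm_add_sq_real, norm_smul, norm_smul, hxn, hun,
      real_inner_smul_left, real_inner_smul_right, h0]
    simp
  have hm := h _ (us.2 hy) ?_
  · have := hu.2 _ hm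
    rw [inner_add_left, real_inner_smul_left, real_inner_smul_left, h0, real_inner_self_eq_norm_sq, hun] at this
    have := sin_pos_of_pos_of_lt_pi hδ0 hδ1
    linarith
  · unfold gdist
    rw [inner_add_right, real_inner_smul_right, real_inner_smul_right, h0, real_inner_self_eq_norm_sq, hxn]
    rw [show cos δ * 1 ^ 2 + sin δ * 0 = cos δ by ring, arccos_cos hδ0.le hδ1.le]
    exact hδε

theorem polar_add_smul {K : Set (E 2)} {v v' : E 2} (hv : v ∈ polar K) (hv' : v' ∈ polar K) {t : ℝ} (ht : 0 ≤ t)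
    (h0 : v + t • v' ≠ 0) : ‖v + t • v'‖⁻¹ • (v + t • v') ∈ polar K := by
  refine ⟨us.2 (norm_nrm h0), fun a ha => ?_⟩
  rw [real_inner_smul_right, inner_add_right, real_inner_smul_right]
  have h1 := hv.2 a ha
  have h2 := mul_nonneg ht (neg_nonneg.2 (hv'.2 a ha))
  have := mul_nonneg (inv_nonneg.2 (norm_nonneg (v + t • v'))) (show 0 ≤ -(⟪a, v⟫ + t * ⟪a, v'⟫) by linarith)
  linarith

theorem lemmaW {K : Set (E 2)} (hK : IsConvexBody K) {w : ℝ} (hw : width K = w) (hw2 : w ≤ π / 2) (hw0 : 0 < w)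
    {u : E 2} (hu : u ∈ polar K) {t : E 2} (ht : t ∈ K) (htu : ⟪t, u⟫ = (0:ℝ)) :
    ∃ x ∈ K, sin w ≤ -⟪x, u⟫ := by
  obtain ⟨hS, hc, z, hz⟩ := hK
  have hun := us.1 hu.1
  have huu : ⟪u, u⟫ = (1:ℝ) := by rw [real_inner_self_eq_norm_sq, hun]; norm_num
  obtain ⟨v, hv, hmin⟩ := (polar_compact K).exists_isMinOn (polar_nonempty hS) 
    (f := fun v => ⟪u, v⟫) (by fun_prop)
  have hmin' : ∀ v' ∈ polar K, ⟪u, v⟫ ≤ ⟪u, v'⟫ := fun v' hv' => hmin hv'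
  have hvn := us.1 hv.1
  have hvv : ⟪v, v⟫ = (1:ℝ) := by rw [real_inner_self_eq_norm_sq, hvn]; norm_num
  set m : ℝ := ⟪u, v⟫ with hm
  have hvu : ⟪v, u⟫ = m := real_inner_comm _ _
  rcases le_or_gt 0 m with h0 | h0
  · refine ⟨-u, bipolar1 hS hc (by simpa) fun u' hu' => ?_, ?_⟩
    · rw [inner_neg_left]; linarith [hmin' u' hu']
    · rw [inner_neg_left, huu]; linarith [sin_le_one w]
  have hne : u ≠ v := by rintro rfl; linarith
  have hne' : u ≠ -v := by
    intro h
    have h1 := interior_lt hS.1 hz hu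
    have h2 := interior_lt hS.1 hz hv
    rw [h, inner_neg_right] at h1
    linarith
  obtain ⟨hb, hm1, hm2⟩ := breadth_eq hun hvn hne hne'
  rw [← hm] at hb hm1 hm2
  set q := -u + m • v with hq
  have hqv : ⟪q, v⟫ = (0:ℝ) := by
    rw [hq, inner_add_left, inner_neg_left, real_inner_smul_left, hvv, ← hm]; ring
  have hqu : ⟪q, u⟫ = -(1 - m ^ 2) := by
    rw [hq, inner_add_left, inner_neg_left, real_inner_smul_left, hvu, huu]; ring
  have hqn : ‖q‖ ^ 2 = 1 - m ^ 2 := by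
    rw [← real_inner_self_eq_norm_sq]
    nth_rw 2 [hq]
    rw [inner_add_right, inner_neg_right, real_inner_smul_right, hqv, hqu]; ring
  have hp : 0 < 1 - m ^ 2 := by nlinarith
  have hq0 : q ≠ 0 := by intro h; rw [h] at hqn; simp at hqn; linarith
  have hqp : 0 < ‖q‖ := norm_pos_iff.2 hq0
  have hqK : ‖q‖⁻¹ • q ∈ K := by
    refine (bipolar hS hc fun v' hv' => ?_).resolve_left hq0
    have hvn' := us.1 hv'.1
    have key : ∀ t > (0:ℝ), m * t / 2 ≤ ⟪u, v'⟫ - m * ⟪v, v'⟫ := by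
      intro t ht
      have h1 : m * ‖v + t • v'‖ ≤ m + t * ⟪u, v'⟫ := by
        by_cases hz : v + t • v' = 0
        · have : ⟪u, v + t • v'⟫ = (0:ℝ) := by rw [hz, inner_zero_right]
          rw [inner_add_right, real_inner_smul_right, ← hm] at this
          rw [hz, this]; simp
        · have := hmin' _ (polar_add_smul hv hv' ht.le hz)
          rw [real_inner_smul_right, inner_add_right, real_inner_smul_right, ← hm] at this
          have hpos : 0 < ‖v + t • v'‖ := norm_pos_iff.2 hz
          rw [inv_mul_eq_div, le_div_iff₀ hpos] at this
          exact this
      have h2 : ‖v + t • v'‖ ^ 2 = 1 + 2 * (t * ⟪v, v'⟫) + t ^ 2 := by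
        rw [norm_add_sq_real, norm_smul, hvn, hvn', real_inner_smul_right, mul_one, Real.norm_eq_abs, sq_abs]; ring
      have h3 : ‖v + t • v'‖ ≤ 1 + t * ⟪v, v'⟫ + t ^ 2 / 2 := by
        nlinarith [sq_nonneg (‖v + t • v'‖ - 1)]
      have h4 : m * (1 + t * ⟪v, v'⟫ + t ^ 2 / 2) ≤ m * ‖v + t • v'‖ := mul_le_mul_of_nonpos_left h3 h0.le
      refine le_of_mul_le_mul_left ?_ ht
      linarith
    have : 0 ≤ ⟪u, v'⟫ - m * ⟪v, v'⟫ := by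
      by_contra hcon
      push Not at hcon
      set A := ⟪u, v'⟫ - m * ⟪v, v'⟫
      have := key (A / m) (div_pos_of_neg_of_neg hcon h0)
      rw [mul_div_cancel₀ _ h0.ne] at this
      linarith
    rw [hq, inner_add_left, inner_neg_left, real_inner_smul_left]
    linarith
  have hlune : IsSupportingLune K u v := by
    refine ⟨hu.1, hv.1, hne, hne', fun x hx => ⟨hS.1 hx, hu.2 x hx, hv.2 x hx⟩, ⟨t, ht, hS.1 ht, htu, hv.2 t ht⟩,
      ⟨_, hqK, hS.1 hqK, ?_, hu.2 _ hqK⟩⟩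
    rw [real_inner_smul_left, hqv, mul_zero]
  have hwb := width_le hlune
  rw [hw, hb] at hwb
  refine ⟨_, hqK, ?_⟩
  have h5 : -⟪‖q‖⁻¹ • q, u⟫ = ‖q‖ := by
    rw [real_inner_smul_left, hqu, ← hqn]; field_simp
  rw [h5]
  have h6 : sin (arccos (-m)) = ‖q‖ := by
    rw [sin_arccos, neg_sq, ← hqn, Real.sqrt_sq (norm_nonneg _)]
  rw [← h6]
  apply sin_le_sin_of_le_of_le_pi_div_two (by linarith [pi_pos]) _ hwb
  exact arccos_le_pi_div_two.2 (by linarith)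

theorem lunes_nonempty {K : Set (E 2)} {w : ℝ} (hw : width K = w) (hw0 : 0 < w) :
    {b | ∃ u v : E 2, IsSupportingLune K u v ∧ b = breadth u v}.Nonempty := by
  by_contra h
  rw [not_nonempty_iff_eq_empty] at h
  unfold width at hw
  rw [h, Real.sInf_empty] at hw
  linarith

theorem inradius_le_half {K : Set (E 2)} {w : ℝ} (hw : width K = w) (hw0 : 0 < w) {p : E 2} (hp : ‖p‖ = 1) {r : ℝ} 
    (hr0 : 0 ≤ r) (hr1 : r ≤ π / 2) (h : ∀ u ∈ polar K, ⟪p, u⟫ ≤ -sin r) : r ≤ w / 2 := by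
  suffices 2 * r ≤ width K by linarith
  apply le_csInf (lunes_nonempty hw hw0)
  rintro b ⟨u, v, ⟨hu, hv, h1, h2, hl, -, -⟩, rfl⟩
  have hun := us.1 hu
  have hvn := us.1 hv
  have huP : u ∈ polar K := ⟨hu, fun a ha => (hl ha).2.1⟩
  have hvP : v ∈ polar K := ⟨hv, fun a ha => (hl ha).2.2⟩
  rw [(breadth_eq hun hvn h1 h2).1, arccos_neg]
  have ha : ∀ u ∈ polar K, InnerProductGeometry.angle p (-u) ≤ π / 2 - r := by
    intro u hu
    have := h u hu
    have hn := us.1 hu.1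
    unfold InnerProductGeometry.angle
    rw [norm_neg, hp, hn, inner_neg_right]
    have : cos (π / 2 - r) ≤ -⟪p, u⟫ / (1 * 1) := by rw [cos_pi_div_two_sub]; linarith
    have := arccos_le_arccos this
    rwa [arccos_cos (by linarith) (by linarith [pi_pos])] at this
  have := InnerProductGeometry.angle_le_angle_add_angle (-u) p (-v)
  rw [InnerProductGeometry.angle_neg_neg, InnerProductGeometry.angle_comm (-u)] at this
  have e : InnerProductGeometry.angle u v = arccos ⟪u, v⟫ := by simp [InnerProductGeometry.angle, hun, hvn]
  rw [e] at this
  have := ha u huP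
  have := ha v hvP
  linarith

end SPaux

end

section
open Metric Set SphericalPal Real MeasureTheory
open scoped RealInnerProductSpace NNReal Pointwise

namespace SPaux

theorem inner_self1 {x : E 2} (hx : ‖x‖ = 1) : ⟪x, x⟫ = (1:ℝ) := by
  rw [real_inner_self_eq_norm_sq, hx]; norm_num

theorem exists_perp {p : E 2} (hp : ‖p‖ = 1) : ∃ e : E 2, ‖e‖ = 1 ∧ ⟪p, e⟫ = (0:ℝ) := by
  have ho : Orthonormal ℝ (({0} : Set (Fin 3)).domRestrict ![p, 0, 0]) := by
    constructor
    · rintro ⟨i, hi⟩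
      obtain rfl : i = 0 := hi
      simpa
    · rintro ⟨i, hi⟩ ⟨j, hj⟩ hij
      obtain rfl : i = 0 := hi
      obtain rfl : j = 0 := hj
      simp at hij
  obtain ⟨b, hb⟩ := ho.exists_orthonormalBasis_extension_of_card_eq (by simp)
  have h0 := hb 0 (by simp)
  simp at h0
  refine ⟨b 1, b.orthonormal.1 1, ?_⟩
  rw [← h0]
  exact b.orthonormal.2 (by decide)

theorem decomp {p : E 2} (hp : ‖p‖ = 1) (u : E 2) : ∃ e : E 2, ∃ s : ℝ, ‖e‖ = 1 ∧ ⟪p, e⟫ = (0:ℝ) ∧ 0 ≤ s ∧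
    u = ⟪p, u⟫ • p + s • e ∧ ‖u‖ ^ 2 = ⟪p, u⟫ ^ 2 + s ^ 2 := by
  have hpp := inner_self1 hp
  suffices ∃ e : E 2, ∃ s : ℝ, ‖e‖ = 1 ∧ ⟪p, e⟫ = (0:ℝ) ∧ 0 ≤ s ∧ u = ⟪p, u⟫ • p + s • e by
    obtain ⟨e, s, h1, h2, h3, h4⟩ := this
    refine ⟨e, s, h1, h2, h3, h4, ?_⟩
    conv_lhs => rw [h4]
    rw [norm_add_sq_real, norm_smul, norm_smul, hp, h1, real_inner_smul_left, real_inner_smul_right, h2]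
    simp
  by_cases h : u - ⟪p, u⟫ • p = 0
  · obtain ⟨e, he, hpe⟩ := exists_perp hp
    refine ⟨e, 0, he, hpe, le_rfl, ?_⟩
    rw [zero_smul, add_zero]; exact sub_eq_zero.1 h
  · refine ⟨_, ‖u - ⟪p, u⟫ • p‖, norm_nrm h, ?_, norm_nonneg _, ?_⟩
    · rw [real_inner_smul_right, inner_sub_right, real_inner_smul_right, hpp]; ring
    · rw [smul_smul, mul_inv_cancel₀ (norm_ne_zero_iff.2 h), one_smul]; abel

theorem ball_polar {p u X : E 2} {r : ℝ} (hp : ‖p‖ = 1) (hu : ‖u‖ = 1) (hs : 0 ≤ sin r) (hc : 0 ≤ cos r)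
    (h : ⟪p, u⟫ ≤ -sin r) (hX : cos r * ‖X‖ ≤ ⟪p, X⟫) : ⟪X, u⟫ ≤ 0 := by
  obtain ⟨e, s, he, hpe, hs0, hue, hun⟩ := decomp hp u
  obtain ⟨e', s', he', hpe', hs0', hue', hun'⟩ := decomp hp X
  have hpp := inner_self1 hp
  have hep' : ⟪e', p⟫ = (0:ℝ) := by rw [real_inner_comm]; exact hpe'
  set c : ℝ := ⟪p, u⟫
  set a : ℝ := ⟪p, X⟫
  have e1 : ⟪X, u⟫ = a * c + s' * s * ⟪e', e⟫ := by
    rw [hue', hue]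
    simp only [inner_add_left, inner_add_right, real_inner_smul_left, real_inner_smul_right, hpp, hpe, hep']; ring
  have hcs : ⟪e', e⟫ ≤ (1:ℝ) := by
    have := real_inner_le_norm e' e; rw [he, he'] at this; linarith
  have q := sin_sq_add_cos_sq r
  have hn := norm_nonneg X
  have hsle : s ≤ cos r := by
    rw [hu] at hun
    apply (sq_le_sq₀ hs0 hc).1
    nlinarith
  have hsle' : s' ≤ ‖X‖ * sin r := by
    apply (sq_le_sq₀ hs0' (by positivity)).1
    have : (cos r * ‖X‖) ^ 2 ≤ a ^ 2 := pow_le_pow_left₀ (by positivity) hX 2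
    nlinarith
  have ha : 0 ≤ a := le_trans (by positivity) hX
  have h1 : s' * s * ⟪e', e⟫ ≤ s' * s := by
    have := mul_nonneg hs0' hs0; nlinarith
  have h2 : s' * s ≤ ‖X‖ * sin r * cos r := mul_le_mul hsle' hsle hs0 (by positivity)
  have h3 : a * c ≤ -(a * sin r) := by nlinarith
  have h4 : cos r * ‖X‖ * sin r ≤ a * sin r := mul_le_mul_of_nonneg_right hX hs
  rw [e1]; linarith

/-- Active directions of the inball. -/
def Act (K : Set (E 2)) (p : E 2) (r : ℝ) (e : E 2) : Prop :=
  ‖e‖ = 1 ∧ ⟪p, e⟫ = (0:ℝ) ∧ (-sin r) • p + cos r • e ∈ polar K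

theorem norm_comb {p e : E 2} (hp : ‖p‖ = 1) (he : ‖e‖ = 1) (hpe : ⟪p, e⟫ = (0:ℝ)) (a b : ℝ) :
    ‖a • p + b • e‖ ^ 2 = a ^ 2 + b ^ 2 := by
  rw [norm_add_sq_real, norm_smul, norm_smul, hp, he, real_inner_smul_left, real_inner_smul_right, hpe]
  simp

theorem norm_comb1 {p e : E 2} (hp : ‖p‖ = 1) (he : ‖e‖ = 1) (hpe : ⟪p, e⟫ = (0:ℝ)) (r : ℝ) :
    ‖cos r • p + sin r • e‖ = 1 := by
  rw [← sq_eq_sq₀ (norm_nonneg _) zero_le_one, norm_comb hp he hpe]; simp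

theorem ball_cn {K : Set (E 2)} (hS : SConvex K) (hc : IsCompact K) {p : E 2} (hp : ‖p‖ = 1) {r : ℝ}
    (hr : 0 ≤ sin r) (hr' : 0 ≤ cos r) (hpol : ∀ u ∈ polar K, ⟪p, u⟫ ≤ -sin r) {X : E 2} 
    (hX : cos r * ‖X‖ ≤ ⟪p, X⟫) : X ∈ cn K :=
  bipolar hS hc fun u hu => ball_polar hp (us.1 hu.1) hr hr' (hpol u hu) hX

theorem ball_pt {K : Set (E 2)} (hS : SConvex K) (hc : IsCompact K) {p : E 2} (hp : ‖p‖ = 1) {r : ℝ}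
    (hr : 0 ≤ sin r) (hr' : 0 ≤ cos r) (hpol : ∀ u ∈ polar K, ⟪p, u⟫ ≤ -sin r) {e : E 2} 
    (he : ‖e‖ = 1) (hpe : ⟪p, e⟫ = (0:ℝ)) : cos r • p + sin r • e ∈ cn K := by
  apply ball_cn hS hc hp hr hr' hpol
  rw [norm_comb1 hp he hpe, inner_add_right, real_inner_smul_right, real_inner_smul_right, hpe, inner_self1 hp]
  linarith

/-- Step B -/
theorem stepB {K : Set (E 2)} (hK : IsConvexBody K) {w : ℝ} (hw : width K = w) (hw2 : w ≤ π / 2) (hw0 : 0 < w)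
    {p : E 2} (hp : ‖p‖ = 1) {r : ℝ} (hr0 : 0 < r) (hr : r < w / 2) (hpol : ∀ u ∈ polar K, ⟪p, u⟫ ≤ -sin r)
    {e : E 2} (he : Act K p r e) :
    ∃ f : E 2, ‖f‖ = 1 ∧ ⟪p, f⟫ = (0:ℝ) ∧ cos (w - r) • p + sin (w - r) • f ∈ cn K ∧
      (∀ e', Act K p r e' → ⟪f, e'⟫ ≤ ka w r) ∧ (∀ e', Act K p r e' → ⟪f, e⟫ + ⟪f, e'⟫ < 0) := by
  obtain ⟨h1, h2, h3, h4, h5⟩ := trig_pos hw0 hw2 hr0 hr.le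
  have hpp := inner_self1 hp
  have hS := hK.1
  have hc := hK.2.1
  obtain ⟨hen, hpe, heP⟩ := he
  have hep : ⟪e, p⟫ = (0:ℝ) := by rw [real_inner_comm]; exact hpe
  have hee := inner_self1 hen
  have ht : cos r • p + sin r • e ∈ K := by
    have := ball_pt hS hc hp h1.le h2.le hpol hen hpe
    have hn := norm_comb1 hp hen hpe r
    rcases this with h | h
    · rw [h] at hn; simp at hn
    · rwa [hn, inv_one, one_smul] at h
  have hpK : p ∈ cn K := ball_cn hS hc hp h1.le h2.le hpol (by rw [hp, hpp]; linarith [cos_le_one r])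
  obtain ⟨x, hxK, hxw⟩ := lemmaW hK hw hw2 hw0 heP ht (by
    simp only [inner_add_left, inner_add_right, real_inner_smul_left, real_inner_smul_right, hpp, hpe, hep, hee]
    ring)
  obtain ⟨f, s, hf, hpf, hs0, hx, hxn⟩ := decomp hp x
  have hfp : ⟪f, p⟫ = (0:ℝ) := by rw [real_inner_comm]; exact hpf
  rw [us.1 (hS.1 hxK)] at hxn
  set a : ℝ := ⟪p, x⟫
  have ix : ∀ e' : E 2, ⟪p, e'⟫ = (0:ℝ) → ⟪x, (-sin r) • p + cos r • e'⟫ = -(a * sin r) + s * cos r * ⟪f, e'⟫ := by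
    intro e' he'
    rw [hx]
    simp only [inner_add_left, inner_add_right, real_inner_smul_left, real_inner_smul_right, hpp, he', hfp]
    ring
  rw [ix e hpe] at hxw
  have hfe : -⟪f, e⟫ ≤ (1:ℝ) := by
    have := abs_real_inner_le_norm f e
    rw [hf, hen, abs_le] at this; linarith
  have hle : sin w ≤ a * sin r + s * cos r := by
    have := mul_le_mul_of_nonneg_left hfe (mul_nonneg hs0 h2.le)
    linarith
  have hsr : sin r < sin w := sin_lt_sin_of_lt_of_le_pi_div_two (by linarith [pi_pos]) hw2 (by linarith)
  have hspos : 0 < s := by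
    rcases hs0.eq_or_lt with h | h
    · exfalso
      rw [← h] at hle hxn
      have : a ≤ 1 := by nlinarith
      nlinarith
    · exact h
  have ha1 : a ≤ 1 := by nlinarith
  have ham : -1 ≤ a := by nlinarith
  set D := arccos a with hD
  have hcD : cos D = a := cos_arccos ham ha1
  have hsD : sin D = s := by
    rw [hD, sin_arccos, show 1 - a ^ 2 = s ^ 2 by linarith, Real.sqrt_sq hs0]
  have hD0 : 0 ≤ D := arccos_nonneg _
  have hDpi : D ≤ π := arccos_le_pi _
  have hDd : w - r ≤ D := by
    by_contra hcon
    push Not at hcon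
    have : sin (D + r) < sin w := sin_lt_sin_of_lt_of_le_pi_div_two (by linarith [pi_pos]) hw2 (by linarith)
    rw [sin_add, hcD, hsD] at this
    linarith
  have hy : cos (w - r) • p + sin (w - r) • f ∈ cn K := by
    have e1 : cos (w - r) • p + sin (w - r) • f = (sin (D - (w - r)) / s) • p + (sin (w - r) / s) • x := by
      rw [sin_sub D (w - r), hsD, hcD]
      conv_rhs => rw [hx]
      rw [smul_add, smul_smul, smul_smul, ← add_assoc, ← add_smul]
      congr 2
      · field_simp; ring
      · field_simp
    rw [e1]
    apply cn_add hS
    · apply cn_smul hpK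
      apply div_nonneg _ hs0
      apply sin_nonneg_of_nonneg_of_le_pi <;> linarith
    · exact cn_smul (cn_of_mem hS.1 hxK) (by positivity)
  refine ⟨f, hf, hpf, hy, ?_, ?_⟩
  · intro e' he'
    have := polar_inner hy he'.2.2
    simp only [inner_add_left, inner_add_right, real_inner_smul_left, real_inner_smul_right, hpp, he'.2.1, hfp] at this
    unfold ka
    rw [le_div_iff₀ (by positivity)]
    linarith
  · intro e' he'
    by_contra hcon
    push Not at hcon
    have h6 := polar_inner (cn_of_mem hS.1 hxK) he'.2.2
    rw [ix e' he'.2.1] at h6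
    have h7 := mul_nonneg (mul_nonneg hs0 h2.le) hcon
    have h8 : sin w ≤ 2 * (a * sin r) := by linarith
    have h9 : a < cos r := by
      rw [← hcD]; exact cos_lt_cos_of_nonneg_of_le_pi hr0.le hDpi (by linarith)
    have h10 : sin (2 * r) ≤ sin w := sin_le_sin_of_le_of_le_pi_div_two (by linarith [pi_pos]) hw2 (by linarith)
    rw [sin_two_mul] at h10
    nlinarith

theorem sector {e₂ e₃ f g : E 2} {κ c d x y : ℝ} (h2 : ‖e₂‖ = 1) (h3 : ‖e₃‖ = 1) (hf : ‖f‖ = 1) 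
    (hfe : f = c • e₂ + d • e₃) (hc : 0 < c) (hd : 0 < d) (k2 : ⟪f, e₂⟫ ≤ κ) (k3 : ⟪f, e₃⟫ ≤ κ) (hκ0 : 0 ≤ κ) (hκ1 : κ ≤ 1)
    (hg : g = x • e₂ + y • e₃) (hgf : κ * ‖g‖ < ⟪f, g⟫) : 0 < x ∧ 0 < y := by
  have hff := inner_self1 hf
  have gen : ∀ (e : E 2) (d y Δ : ℝ), ‖e‖ = 1 → ⟪f, e⟫ ≤ κ → 0 < d → y ≤ 0 → d • g - y • f = Δ • e → Δ ≤ 0 := by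
    intro e d y Δ he hk hd hy h
    by_contra hΔ
    push Not at hΔ
    have h1 : ⟪f, d • g - y • f⟫ = Δ * ⟪f, e⟫ := by rw [h, real_inner_smul_right]
    rw [inner_sub_right, real_inner_smul_right, real_inner_smul_right, hff] at h1
    have h2 : Δ ≤ d * ‖g‖ - y := by
      have : ‖Δ • e‖ ≤ d * ‖g‖ + -y := by
        rw [← h]
        refine (norm_sub_le _ _).trans ?_
        rw [norm_smul, norm_smul, hf, Real.norm_of_nonneg hd.le, Real.norm_of_nonpos hy, mul_one]
      rw [norm_smul, he, Real.norm_of_nonneg hΔ.le] at this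
      linarith
    have h3 := mul_lt_mul_of_pos_left hgf hd
    have h4 := mul_le_mul_of_nonneg_left hk hΔ.le
    have h5 := mul_le_mul_of_nonneg_left h2 hκ0
    have h6 : -y * κ ≤ -y := by nlinarith
    linarith
  have E2 : d • g - y • f = (d * x - y * c) • e₂ := by
    rw [hg, hfe]; module
  have E3 : c • g - x • f = (c * y - x * d) • e₃ := by
    rw [hg, hfe]; module
  have F2 := gen e₂ d y (d * x - y * c) h2 k2 hd
  have F3 := gen e₃ c x (c * y - x * d) h3 k3 hc
  have hpos : 0 < ⟪f, g⟫ := lt_of_le_of_lt (by positivity) hgf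
  have degen : ¬ (y ≤ 0 ∧ x ≤ 0) := by
    rintro ⟨hy, hx⟩
    have a1 := F2 hy E2
    have a2 := F3 hx E3
    have : d * x - y * c = 0 := by linarith
    rw [this, zero_smul] at E2
    have : ⟪f, d • g - y • f⟫ = (0:ℝ) := by rw [E2, inner_zero_right]
    rw [inner_sub_right, real_inner_smul_right, real_inner_smul_right, hff] at this
    have := mul_pos hd hpos
    linarith
  constructor
  · by_contra hx
    push Not at hx
    have a2 := F3 hx E3
    apply degen ⟨_, hx⟩
    have : x * d ≤ 0 := mul_nonpos_of_nonpos_of_nonneg hx hd.le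
    by_contra hy; push Not at hy
    have := mul_pos hc hy
    linarith
  · by_contra hy
    push Not at hy
    have a2 := F2 hy E2
    apply degen ⟨hy, _⟩
    have : y * c ≤ 0 := mul_nonpos_of_nonpos_of_nonneg hy hc.le
    by_contra hx; push Not at hx
    have := mul_pos hd hx
    linarith

theorem plane {p a b : E 2} (hp : ‖p‖ = 1) (ha : ‖a‖ = 1) (hb : ‖b‖ = 1) (hpa : ⟪p, a⟫ = (0:ℝ)) (hpb : ⟪p, b⟫ = (0:ℝ))
    (h1 : a ≠ b) (h2 : a ≠ -b) {g : E 2} (hg : ⟪p, g⟫ = (0:ℝ)) : ∃ c d : ℝ, g = c • a + d • b := by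
  obtain ⟨a', hF⟩ := exists_frame hp ha hpa
  have eb := hF.expand b
  have eg := hF.expand g
  rw [hpb, zero_smul, zero_add] at eb
  rw [hg, zero_smul, zero_add] at eg
  set β : ℝ := ⟪a', b⟫
  have hβ : β ≠ 0 := by
    intro h
    rw [h, zero_smul, add_zero] at eb
    have hn := hb
    rw [eb, norm_smul, ha, mul_one, Real.norm_eq_abs] at hn
    rcases abs_eq (zero_le_one) |>.1 hn with h | h
    · rw [h, one_smul] at eb; exact h1 eb.symm
    · rw [h, neg_one_smul] at eb; exact h2 (by rw [eb]; simp)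
  refine ⟨⟪a, g⟫ - ⟪a', g⟫ / β * ⟪a, b⟫, ⟪a', g⟫ / β, ?_⟩
  have : a' = β⁻¹ • (b - ⟪a, b⟫ • a) := by
    have : b - ⟪a, b⟫ • a = β • a' := by rw [sub_eq_iff_eq_add']; exact eb
    rw [this, smul_smul, inv_mul_cancel₀ hβ, one_smul]
  have h3 : ⟪a', g⟫ • a' = (⟪a', g⟫ / β) • (b - ⟪a, b⟫ • a) := by
    rw [div_eq_mul_inv, ← smul_smul, ← this]
  conv_lhs => rw [eg, h3]
  module

theorem uniq {a b : E 2} (ha : ‖a‖ = 1) (hb : ‖b‖ = 1) (h1 : a ≠ b) (h2 : a ≠ -b) {c d : ℝ} (h : c • a + d • b = 0) : 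
    c = 0 := by
  by_contra hc
  have e : a = (-d / c) • b := by
    have : c • a = (-d) • b := by rw [neg_smul]; exact eq_neg_of_add_eq_zero_left h
    rw [div_eq_inv_mul, ← smul_smul, ← this, smul_smul, inv_mul_cancel₀ hc, one_smul]
  have hn := ha
  rw [e, norm_smul, hb, mul_one, Real.norm_eq_abs] at hn
  rcases abs_eq (zero_le_one) |>.1 hn with h | h
  · rw [h, one_smul] at e; exact h1 e
  · rw [h, neg_one_smul] at e; exact h2 e

end SPaux

end

section
open Metric Set SphericalPal Real MeasureTheory
open scoped RealInnerProductSpace NNReal Pointwise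

namespace SPaux

theorem act_of {K : Set (E 2)} {p v : E 2} {r : ℝ} (hp : ‖p‖ = 1) (hc : 0 < cos r) (hv : v ∈ polar K)
    (h : ⟪p, v⟫ = -sin r) : Act K p r ((cos r)⁻¹ • (v + sin r • p)) := by
  have hvn := us.1 hv.1
  have hpp := inner_self1 hp
  refine ⟨?_, ?_, ?_⟩
  · rw [norm_smul, norm_inv, Real.norm_of_nonneg hc.le]
    have : ‖v + sin r • p‖ = cos r := by
      rw [← sq_eq_sq₀ (norm_nonneg _) hc.le, norm_add_sq_real, norm_smul, hvn, hp, real_inner_smul_right,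
        real_inner_comm, h, Real.norm_eq_abs, mul_one, sq_abs]
      linarith [sin_sq_add_cos_sq r]
    rw [this, inv_mul_cancel₀ hc.ne']
  · rw [real_inner_smul_right, inner_add_right, real_inner_smul_right, hpp, h]; ring
  · rw [smul_smul, mul_inv_cancel₀ hc.ne', one_smul]
    have : (-sin r) • p + (v + sin r • p) = v := by module
    rwa [this]

theorem carath {K : Set (E 2)} {p z : E 2} {r : ℝ} (hp : ‖p‖ = 1) (hc : 0 < cos r)
    (hpol : ∀ u ∈ polar K, ⟪p, u⟫ ≤ -sin r) (hz : z ∈ convexHull ℝ (polar K)) (hzp : z = (-sin r) • p) :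
    (∃ e₁ e₂ e₃ : E 2, ∃ l₁ l₂ l₃ : ℝ, Act K p r e₁ ∧ Act K p r e₂ ∧ Act K p r e₃ ∧ 0 < l₁ ∧ 0 < l₂ ∧ 0 < l₃ ∧
      l₁ • e₁ + l₂ • e₂ + l₃ • e₃ = 0) ∨ ∃ e, Act K p r e ∧ Act K p r (-e) := by
  have hpp := inner_self1 hp
  obtain ⟨ι, hι, v, a, hv, hind, ha, hsum, hav⟩ := eq_pos_convex_span_of_mem_convexHull hz
  have hv' : ∀ i, v i ∈ polar K := fun i => hv ⟨i, rfl⟩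
  have hact : ∀ i, ⟪p, v i⟫ = -sin r := by
    have h1 : ∑ i, a i * (-sin r - ⟪p, v i⟫) = 0 := by
      have h2 : ∑ i, a i * ⟪p, v i⟫ = -sin r := by
        have : ⟪p, ∑ i, a i • v i⟫ = -sin r := by
          rw [hav, hzp, real_inner_smul_right, hpp]; ring
        rw [inner_sum] at this
        simpa [real_inner_smul_right] using this
      simp only [mul_sub, Finset.sum_sub_distrib]
      rw [h2, ← Finset.sum_mul, hsum]; ring
    rw [Finset.sum_eq_zero_iff_of_nonneg] at h1
    · intro i
      have := h1 i (Finset.mem_univ i)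
      rcases mul_eq_zero.1 this with h | h
      · exact absurd h (ha i).ne'
      · linarith
    · intro i _
      exact mul_nonneg (ha i).le (by linarith [hpol _ (hv' i)])
  have hA : ∀ i, Act K p r ((cos r)⁻¹ • (v i + sin r • p)) := fun i => act_of hp hc (hv' i) (hact i)
  obtain ⟨e, he⟩ : ∃ e : ι → E 2, ∀ i, e i = (cos r)⁻¹ • (v i + sin r • p) := ⟨_, fun i => rfl⟩
  have hA : ∀ i, Act K p r (e i) := fun i => by rw [he]; exact hA i
  have hcard : Fintype.card ι ≤ 3 := by
    refine hind.card_le_finrank_succ.trans ?_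
    have hle : vectorSpan ℝ (range v) ≤ (Submodule.span ℝ {p})ᗮ := by
      unfold vectorSpan
      rw [Submodule.span_le]
      rintro x ⟨_, ⟨i, rfl⟩, _, ⟨j, rfl⟩, rfl⟩
      rw [SetLike.mem_coe, Submodule.mem_orthogonal_singleton_iff_inner_right]
      simp [inner_sub_right, hact]
    have hp0 : p ≠ 0 := by rintro rfl; simp at hp
    have : Fact (Module.finrank ℝ (E 2) = 2 + 1) := ⟨by simp⟩
    have := Submodule.finrank_mono hle
    rw [Submodule.finrank_orthogonal_span_singleton (n := 2) hp0] at this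
    omega
  have hes : ∑ i, a i • e i = 0 := by
    have : ∑ i, a i • e i = (cos r)⁻¹ • (∑ i, a i • v i + (∑ i, a i) • sin r • p) := by
      rw [Finset.sum_smul, ← Finset.sum_add_distrib, Finset.smul_sum]
      apply Finset.sum_congr rfl
      intro i _
      rw [he]; module
    rw [this, hav, hsum, hzp]; module
  obtain ⟨k, hk⟩ : ∃ k, Fintype.card ι = k := ⟨_, rfl⟩
  let φ : Fin k ≃ ι := (Fintype.equivFinOfCardEq hk).symm
  rw [← φ.sum_comp] at hsum hes
  rw [hk] at hcard
  interval_cases k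
  · simp at hsum
  · exfalso
    simp at hes
    rcases hes with h | h
    · exact (ha _).ne' h
    · have := (hA (φ 0)).1
      rw [h] at this; simp at this
  · right
    rw [Fin.sum_univ_two] at hes
    refine ⟨e (φ 0), hA _, ?_⟩
    have h1 : a (φ 1) • e (φ 1) = a (φ 0) • (-e (φ 0)) := by
      rw [smul_neg]; exact eq_neg_of_add_eq_zero_right hes
    have h2 := congrArg norm h1
    rw [norm_smul, norm_smul, norm_neg, (hA (φ 0)).1, (hA (φ 1)).1, Real.norm_of_nonneg (ha _).le,
      Real.norm_of_nonneg (ha _).le, mul_one, mul_one] at h2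
    rw [h2] at h1
    rw [← smul_right_injective (E 2) (ha (φ 0)).ne' h1]
    exact hA _
  · left
    rw [Fin.sum_univ_three] at hes
    exact ⟨_, _, _, _, _, _, hA _, hA _, hA _, ha _, ha _, ha _, hes⟩

theorem hull_compact {A : Set (E 2)} (hA : IsCompact A) : IsCompact (convexHull ℝ A) := by
  have key : convexHull ℝ A = ⋃ k : Fin 5, (fun q : (Fin k → ℝ) × (Fin k → E 2) => ∑ i, q.1 i • q.2 i) ''
      (stdSimplex ℝ (Fin k) ×ˢ Set.pi univ (fun _ => A)) := by
    apply Subset.antisymm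
    · intro z hz
      obtain ⟨ι, hι, v, a, hv, hind, ha, hsum, hav⟩ := eq_pos_convex_span_of_mem_convexHull hz
      have hcard : Fintype.card ι ≤ 4 := by
        refine hind.card_le_finrank_succ.trans ?_
        have := Submodule.finrank_le (vectorSpan ℝ (range v))
        simp at this
        omega
      rw [mem_iUnion]
      let φ := Fintype.equivFin ι
      refine ⟨⟨Fintype.card ι, by omega⟩, (fun i => a (φ.symm i), fun i => v (φ.symm i)), ⟨⟨fun i => (ha _).le, ?_⟩, ?_⟩, ?_⟩
      · rw [← hsum]; exact φ.symm.sum_comp a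
      · intro i _; exact hv ⟨_, rfl⟩
      · rw [← hav]; exact φ.symm.sum_comp (fun i => a i • v i)
    · apply iUnion_subset
      rintro k _ ⟨⟨a, v⟩, ⟨⟨h1, h2⟩, h3⟩, rfl⟩
      exact (convex_convexHull ℝ A).sum_mem (fun i _ => h1 i) h2 (fun i _ => subset_convexHull ℝ A (h3 i trivial))
  rw [key]
  apply isCompact_iUnion
  intro k
  apply ((isCompact_stdSimplex ℝ (Fin k)).prod (isCompact_univ_pi fun _ => hA)).image
  fun_prop

theorem ball_le {K : Set (E 2)} {p' u : E 2} {r' : ℝ} (hr' : 0 ≤ r') (hp' : ‖p'‖ = 1) (hb : gball p' r' ⊆ K)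
    (hu : u ∈ polar K) : ⟪p', u⟫ ≤ -sin (min r' (π / 2)) := by
  set ρ := min r' (π / 2)
  have hρ0 : 0 ≤ ρ := le_min hr' (by positivity)
  have hρ1 : ρ ≤ π / 2 := min_le_right _ _
  have hρr : ρ ≤ r' := min_le_left _ _
  have hs : 0 ≤ sin ρ := sin_nonneg_of_nonneg_of_le_pi hρ0 (by linarith [pi_pos])
  have hc : 0 ≤ cos ρ := cos_nonneg_of_neg_pi_div_two_le_of_le (by linarith [pi_pos]) hρ1
  obtain ⟨e, s, he, hpe, hs0, hue, hun⟩ := decomp hp' u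
  have hpp := inner_self1 hp'
  have hpK : p' ∈ K := hb ⟨us.2 hp', by rw [gdist, hpp, arccos_one]; exact hr'⟩
  have hc0 := hu.2 _ hpK
  have hy : cos ρ • p' + sin ρ • e ∈ K := by
    refine hb ⟨us.2 (norm_comb1 hp' he hpe _), ?_⟩
    rw [gdist, inner_add_right, real_inner_smul_right, real_inner_smul_right, hpe, hpp]
    rw [show cos ρ * 1 + sin ρ * 0 = cos ρ by ring, arccos_cos hρ0 (by linarith [pi_pos])]
    exact hρr
  have h1 := hu.2 _ hy
  rw [us.1 hu.1] at hun
  have heu : ⟪e, u⟫ = s := by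
    rw [hue, inner_add_right, real_inner_smul_right, real_inner_smul_right, inner_self1 he, real_inner_comm p' e, hpe]
    ring
  rw [inner_add_left, real_inner_smul_left, real_inner_smul_left, heu] at h1
  set c : ℝ := ⟪p', u⟫
  have q := sin_sq_add_cos_sq ρ
  have h2 : sin ρ * s ≤ cos ρ * -c := by linarith
  have h3 : (sin ρ * s) ^ 2 ≤ (cos ρ * -c) ^ 2 := pow_le_pow_left₀ (by positivity) h2 2
  have h4 : sin ρ ^ 2 ≤ (-c) ^ 2 := by nlinarith
  have := (sq_le_sq₀ hs (by linarith)).1 h4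
  linarith

theorem stepA {K : Set (E 2)} (hK : IsConvexBody K) {w : ℝ} (hw : width K = w) (hw2 : w ≤ π / 2) (hw0 : 0 < w) :
    ∃ p : E 2, ∃ r : ℝ, ‖p‖ = 1 ∧ 0 < r ∧ r ≤ w / 2 ∧ (∀ u ∈ polar K, ⟪p, u⟫ ≤ -sin r) ∧ inradius K ≤ r ∧
    ((∃ e₁ e₂ e₃ : E 2, ∃ l₁ l₂ l₃ : ℝ, Act K p r e₁ ∧ Act K p r e₂ ∧ Act K p r e₃ ∧ 0 < l₁ ∧ 0 < l₂ ∧ 0 < l₃ ∧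
      l₁ • e₁ + l₂ • e₂ + l₃ • e₃ = 0) ∨ ∃ e, Act K p r e ∧ Act K p r (-e)) := by
  obtain ⟨hS, hcomp, y, hy⟩ := hK
  have hQc : IsCompact (convexHull ℝ (polar K)) := hull_compact (polar_compact K)
  have hQn : (convexHull ℝ (polar K)).Nonempty := (polar_nonempty hS).convexHull
  obtain ⟨z, hzQ, hz⟩ := exists_norm_eq_iInf_of_complete_convex hQn hQc.isComplete (convex_convexHull ℝ _) 0
  rw [norm_eq_iInf_iff_real_inner_le_zero (convex_convexHull ℝ _) hzQ] at hz
  have hz' : ∀ q ∈ convexHull ℝ (polar K), ‖z‖ ^ 2 ≤ ⟪z, q⟫ := by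
    intro q hq
    have := hz q hq
    rw [zero_sub, inner_neg_left, inner_sub_right, real_inner_self_eq_norm_sq] at this
    linarith
  have hull : ∀ (x : E 2) (c : ℝ), (∀ u ∈ polar K, ⟪x, u⟫ ≤ c) → ∀ q ∈ convexHull ℝ (polar K), ⟪x, q⟫ ≤ c := by
    intro x c h q hq
    have : convexHull ℝ (polar K) ⊆ {q | ⟪x, q⟫ ≤ c} := by
      apply convexHull_min h
      exact convex_halfSpace_le (innerₛₗ ℝ x).isLinear c
    exact this hq
  have hz0 : z ≠ 0 := by
    rintro rfl
    have : convexHull ℝ (polar K) ⊆ {q | ⟪y, q⟫ < 0} := by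
      apply convexHull_min (fun u hu => interior_lt hS.1 hy hu)
      exact convex_halfSpace_lt (innerₛₗ ℝ y).isLinear 0
    have := this hzQ
    simp at this
  have hzp : 0 < ‖z‖ := norm_pos_iff.2 hz0
  have hz1 : ‖z‖ ≤ 1 := by
    have : convexHull ℝ (polar K) ⊆ closedBall 0 1 := by
      apply convexHull_min _ (convex_closedBall _ _)
      intro u hu
      simp [us.1 hu.1]
    simpa using this hzQ
  set r := arcsin ‖z‖ with hr
  have hsr : sin r = ‖z‖ := sin_arcsin (by linarith) hz1
  have hr0 : 0 < r := arcsin_pos.2 hzp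
  have hr1 : r ≤ π / 2 := arcsin_le_pi_div_two _
  set p := ‖z‖⁻¹ • (-z) with hp
  have hpn : ‖p‖ = 1 := by rw [hp, ← norm_neg z]; exact norm_nrm (neg_ne_zero.2 hz0)
  have hpol : ∀ u ∈ polar K, ⟪p, u⟫ ≤ -sin r := by
    intro u hu
    have := hz' u (subset_convexHull ℝ _ hu)
    rw [hp, real_inner_smul_left, inner_neg_left, hsr, mul_neg, neg_le_neg_iff, inv_mul_eq_div, le_div_iff₀ hzp]
    linarith
  have hrw := inradius_le_half hw hw0 hpn hr0.le hr1 hpol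
  have hcr : 0 < cos r := cos_pos_of_mem_Ioo ⟨by linarith, by linarith [pi_pos]⟩
  refine ⟨p, r, hpn, hr0, hrw, hpol, ?_, carath hpn hcr hpol hzQ ?_⟩
  · apply Real.sSup_le _ hr0.le
    rintro r' ⟨hr'0, p', hp', hb⟩
    have hp'n := us.1 hp'
    have h1 : ⟪p', z⟫ ≤ -sin (min r' (π / 2)) := hull p' _ (fun u hu => ball_le hr'0 hp'n hb hu) z hzQ
    have h2 : -‖z‖ ≤ ⟪p', z⟫ := by
      have := abs_real_inner_le_norm p' z
      rw [hp'n, one_mul, abs_le] at this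
      exact this.1
    have h3 : sin (min r' (π / 2)) ≤ sin r := by rw [hsr]; linarith
    by_contra hcon
    push Not at hcon
    have : sin r < sin (min r' (π / 2)) := by
      apply sin_lt_sin_of_lt_of_le_pi_div_two (by linarith) (min_le_right _ _)
      exact lt_min hcon (by linarith [pi_pos])
    linarith
  · rw [hp, hsr, smul_smul, neg_mul, mul_inv_cancel₀ hzp.ne']; simp

end SPaux

end

section
open Metric Set SphericalPal Real MeasureTheory
open scoped RealInnerProductSpace NNReal Pointwise

namespace SPaux

theorem cap_sub1 {K : Set (E 2)} (hS : SConvex K) (hc : IsCompact K) {p f g : E 2} (hF : Frame p f g) {w r : ℝ} 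
    (hw2 : w ≤ π / 2) (hw0 : 0 < w) (hr0 : 0 < r) (hr : r < w / 2) (hpol : ∀ u ∈ polar K, ⟪p, u⟫ ≤ -sin r)
    (hY : cos (w - r) • p + sin (w - r) • f ∈ cn K) {x y z : ℝ} (hy : 0 ≤ y) 
    (h1 : ka w r * √(x ^ 2 + y ^ 2) < x) (h2 : -sin r * z + cos r * (ka w r * x + sin (al w r) * y) ≤ 0) :
    z • p + x • f + y • g ∈ cn K := by
  obtain ⟨t1, t2, t3, t4, t5⟩ := trig_pos hw0 hw2 hr0 hr.le
  obtain ⟨hpp, hff, hgg, hpf, hpg, hfg⟩ := hF.inners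
  have hpn : ‖p‖ = 1 := hF.1 0
  have hfn : ‖f‖ = 1 := hF.1 1
  have hgn : ‖g‖ = 1 := hF.1 2
  have hκ0 := ka_pos hw0 hw2 hr0 hr.le
  have hκα := cos_al hw0 hw2 hr0 hr.le
  have hα0 := al_pos hw0 hw2 hr0 hr
  have hα1 := al_lt hw0 hw2 hr0 hr.le
  have hσ : 0 < sin (al w r) := sin_pos_of_pos_of_lt_pi hα0 (by linarith [pi_pos])
  have hq := sin_sq_add_cos_sq (al w r)
  rw [hκα] at hq
  set σ := sin (al w r)
  have hκd : ka w r * (cos r * sin (w - r)) = sin r * cos (w - r) := by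
    unfold ka; field_simp
  set κ := ka w r
  have hx : 0 < x := lt_of_le_of_lt (by positivity) h1
  have h3 : κ * y ≤ σ * x := by
    have h4 : (κ * √(x ^ 2 + y ^ 2)) ^ 2 ≤ x ^ 2 := pow_le_pow_left₀ (by positivity) h1.le 2
    rw [mul_pow, Real.sq_sqrt (by positivity)] at h4
    apply (sq_le_sq₀ (by positivity) (by positivity)).1
    nlinarith
  have hτ : ‖κ • f + σ • g‖ = 1 := by
    rw [← sq_eq_sq₀ (norm_nonneg _) zero_le_one, norm_comb hfn hgn hfg]; linarith
  have ht := ball_pt hS hc hpn t1.le t2.le hpol hτ (by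
    rw [inner_add_right, real_inner_smul_right, real_inner_smul_right, hpf, hpg]; ring)
  have hp : p ∈ cn K := ball_cn hS hc hpn t1.le t2.le hpol (by rw [hpn, hpp]; linarith [cos_le_one r])
  set a := x - κ * y / σ
  have ha : 0 ≤ a := by
    rw [sub_nonneg, div_le_iff₀ hσ]; linarith
  set A := a / sin (w - r) with hA
  set B := y / σ / sin r with hB
  have hAs : A * sin (w - r) = a := by rw [hA]; field_simp
  have hBs : B * sin r = y / σ := by rw [hB]; field_simp
  have hAc : A * cos (w - r) * sin r = κ * a * cos r := by
    have : A * cos (w - r) * sin r = A * (sin r * cos (w - r)) := by ring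
    rw [this, ← hκd, ← hAs]; ring
  have hR : 0 ≤ z - A * cos (w - r) - B * cos r := by
    have : 0 ≤ sin r * (z - A * cos (w - r) - B * cos r) := by
      have e1 : sin r * (z - A * cos (w - r) - B * cos r) = sin r * z - κ * a * cos r - (y / σ) * cos r := by
        rw [← hAc, ← hBs]; ring
      have e2 : κ * a + y / σ = κ * x + σ * y := by
        have : y / σ = (σ ^ 2 + κ ^ 2) * (y / σ) := by rw [hq, one_mul]
        have h6 : σ * (y / σ) = y := by field_simp
        simp only [a]
        rw [mul_div_assoc]
        linear_combination this + σ * h6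
      rw [e1]
      have : κ * a * cos r + y / σ * cos r = (κ * x + σ * y) * cos r := by rw [← e2]; ring
      linarith
    exact nonneg_of_mul_nonneg_right this t1
  have e : z • p + x • f + y • g = A • (cos (w - r) • p + sin (w - r) • f) + B • (cos r • p + sin r • (κ • f + σ • g)) 
      + (z - A * cos (w - r) - B * cos r) • p := by
    have ex : x = A * sin (w - r) + B * sin r * κ := by
      rw [hAs, hBs]; simp only [a]; ring
    have ey : y = B * sin r * σ := by rw [hBs]; field_simp
    rw [ex]
    conv_lhs => rw [ey]
    module
  rw [e]
  refine cn_add hS (cn_add hS (cn_smul hY (by positivity)) (cn_smul ht (by positivity))) (cn_smul hp hR)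

theorem Frame.neg {p f g : E 2} (h : Frame p f g) : Frame p f (-g) := by
  obtain ⟨hpp, hff, hgg, hpf, hpg, hfg⟩ := h.inners
  have hpn : ‖p‖ = 1 := h.1 0
  have hfn : ‖f‖ = 1 := h.1 1
  have hgn : ‖g‖ = 1 := h.1 2
  have hgp : ⟪g, p⟫ = (0:ℝ) := by rw [real_inner_comm]; exact hpg
  have hgf : ⟪g, f⟫ = (0:ℝ) := by rw [real_inner_comm]; exact hfg
  have hfp : ⟪f, p⟫ = (0:ℝ) := by rw [real_inner_comm]; exact hpf
  constructor
  · intro i; fin_cases i <;> simp [*]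
  · intro i j hij
    fin_cases i <;> fin_cases j <;> simp_all

theorem cap_sub {K : Set (E 2)} (hS : SConvex K) (hc : IsCompact K) {p f g : E 2} (hF : Frame p f g) {w r : ℝ} 
    (hw2 : w ≤ π / 2) (hw0 : 0 < w) (hr0 : 0 < r) (hr : r < w / 2) (hpol : ∀ u ∈ polar K, ⟪p, u⟫ ≤ -sin r)
    (hY : cos (w - r) • p + sin (w - r) • f ∈ cn K) {X : E 2} (hX : X ∈ cap p f g r (al w r)) : X ∈ cn K := by
  obtain ⟨-, h1, -, h2, h3⟩ := hX
  rw [cos_al hw0 hw2 hr0 hr.le] at h1 h2 h3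
  have e := hF.expand X
  rcases le_total 0 (⟪g, X⟫ : ℝ) with h | h
  · rw [e]
    exact cap_sub1 hS hc hF hw2 hw0 hr0 hr hpol hY h h1 h2
  · have : X = (⟪p, X⟫ : ℝ) • p + (⟪f, X⟫ : ℝ) • f + (-⟪g, X⟫ : ℝ) • (-g) := by
      rw [smul_neg, neg_smul, neg_neg]; exact e
    rw [this]
    apply cap_sub1 hS hc hF.neg hw2 hw0 hr0 hr hpol hY (by linarith)
    · rwa [neg_sq]
    · linarith

theorem coneneg {f a b : E 2} {A B : ℝ} (ha : ‖a‖ = 1) (hb : ‖b‖ = 1) (hA : 0 ≤ A) (hB : 0 ≤ B) 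
    (hf : f = A • a + B • b) : 0 ≤ ⟪f, a⟫ + ⟪f, b⟫ := by
  have h1 : -1 ≤ ⟪a, b⟫ := by
    have := abs_real_inner_le_norm a b
    rw [ha, hb, abs_le] at this; linarith
  have h2 : ⟪b, a⟫ = ⟪a, b⟫ := real_inner_comm _ _
  rw [hf]
  simp only [inner_add_left, real_inner_smul_left, inner_self1 ha, inner_self1 hb, h2]
  nlinarith

theorem cpos {f e₁ e₂ e₃ : E 2} {l₁ l₂ l₃ c d : ℝ} (h1 : ‖e₁‖ = 1) (h2 : ‖e₂‖ = 1) (h3 : ‖e₃‖ = 1) (p1 : 0 < l₁) (p2 : 0 < l₂)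
    (p3 : 0 < l₃) (hs : l₁ • e₁ + l₂ • e₂ + l₃ • e₃ = 0) (n2 : ⟪f, e₁⟫ + ⟪f, e₂⟫ < 0) (n3 : ⟪f, e₁⟫ + ⟪f, e₃⟫ < 0)
    (hf : f = c • e₂ + d • e₃) : 0 < c := by
  by_contra hc
  push Not at hc
  have E2 : e₂ = (-l₁ / l₂) • e₁ + (-l₃ / l₂) • e₃ := by
    have : l₂ • e₂ = (-l₁) • e₁ + (-l₃) • e₃ := by
      rw [← sub_eq_zero, ← hs]; module
    rw [div_eq_inv_mul, div_eq_inv_mul, ← smul_smul, ← smul_smul, ← smul_add, ← this, smul_smul, inv_mul_cancel₀ p2.ne', one_smul]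
  have E3 : e₃ = (-l₁ / l₃) • e₁ + (-l₂ / l₃) • e₂ := by
    have : l₃ • e₃ = (-l₁) • e₁ + (-l₂) • e₂ := by
      rw [← sub_eq_zero, ← hs]; module
    rw [div_eq_inv_mul, div_eq_inv_mul, ← smul_smul, ← smul_smul, ← smul_add, ← this, smul_smul, inv_mul_cancel₀ p3.ne', one_smul]
  have F3 : f = (-c * (l₁ / l₂)) • e₁ + (d - c * (l₃ / l₂)) • e₃ := by
    rw [hf]; nth_rw 1 [E2]; module
  have F2 : f = (-d * (l₁ / l₃)) • e₁ + (c - d * (l₂ / l₃)) • e₂ := by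
    rw [hf]; nth_rw 1 [E3]; module
  rcases le_or_gt 0 (d - c * (l₃ / l₂)) with h | h
  · have := coneneg h1 h3 (mul_nonneg (by linarith) (by positivity)) h F3
    linarith
  · have q : 0 < l₃ / l₂ := by positivity
    have hd : d < 0 := by nlinarith
    have : 0 ≤ c - d * (l₂ / l₃) := by
      have h5 : (d - c * (l₃ / l₂)) * (l₂ / l₃) < 0 := mul_neg_of_neg_of_pos h (by positivity)
      have h6 : (d - c * (l₃ / l₂)) * (l₂ / l₃) = d * (l₂ / l₃) - c := by field_simp
      linarith
    have := coneneg h1 h2 (mul_nonneg (by linarith) (by positivity)) this F2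
    linarith

theorem inCone {p f e₁ e₂ e₃ G : E 2} {l₁ l₂ l₃ κ : ℝ} (hp : ‖p‖ = 1) (h1 : ‖e₁‖ = 1) (h2 : ‖e₂‖ = 1) (h3 : ‖e₃‖ = 1) 
    (q2 : ⟪p, e₂⟫ = (0:ℝ)) (q3 : ⟪p, e₃⟫ = (0:ℝ)) (p1 : 0 < l₁) (p2 : 0 < l₂)
    (p3 : 0 < l₃) (hs : l₁ • e₁ + l₂ • e₂ + l₃ • e₃ = 0) (d1 : e₂ ≠ e₃) (d2 : e₂ ≠ -e₃)
    (hf : ‖f‖ = 1) (hpf : ⟪p, f⟫ = (0:ℝ)) (hκ0 : 0 ≤ κ) (hκ1 : κ ≤ 1) (k2 : ⟪f, e₂⟫ ≤ κ) (k3 : ⟪f, e₃⟫ ≤ κ)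
    (n2 : ⟪f, e₁⟫ + ⟪f, e₂⟫ < 0) (n3 : ⟪f, e₁⟫ + ⟪f, e₃⟫ < 0) (hG : ⟪p, G⟫ = (0:ℝ)) (hfG : κ * ‖G‖ < ⟪f, G⟫) :
    ∃ x y : ℝ, 0 < x ∧ 0 < y ∧ G = x • e₂ + y • e₃ := by
  obtain ⟨c, d, hcd⟩ := plane hp h2 h3 q2 q3 d1 d2 hpf
  obtain ⟨x, y, hxy⟩ := plane hp h2 h3 q2 q3 d1 d2 hG
  have hc := cpos h1 h2 h3 p1 p2 p3 hs n2 n3 hcd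
  have hd := cpos h1 h3 h2 p1 p3 p2 (by rw [← hs]; abel) n3 n2 (by rw [hcd]; abel)
  have := sector h2 h3 hf hcd hc hd k2 k3 hκ0 hκ1 hxy hfG
  exact ⟨x, y, this.1, this.2, hxy⟩

theorem disj_aux {e₁ e₂ e₃ G : E 2} {l₁ l₂ l₃ : ℝ} (h2 : ‖e₂‖ = 1) (h3 : ‖e₃‖ = 1) (p1 : 0 < l₁) (p2 : 0 < l₂)
    (hs : l₁ • e₁ + l₂ • e₂ + l₃ • e₃ = 0) (d1 : e₂ ≠ e₃) (d2 : e₂ ≠ -e₃)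
    (hG1 : ∃ x y : ℝ, 0 < x ∧ 0 < y ∧ G = x • e₂ + y • e₃) (hG2 : ∃ x y : ℝ, 0 < x ∧ 0 < y ∧ G = x • e₁ + y • e₃) : False := by
  obtain ⟨x, y, hx, hy, h⟩ := hG1
  obtain ⟨x', y', hx', hy', h'⟩ := hG2
  have : (l₁ * x + x' * l₂) • e₂ + (l₁ * y - l₁ * y' + x' * l₃) • e₃ = 0 := by
    have e : l₁ • (x • e₂ + y • e₃) - l₁ • (x' • e₁ + y' • e₃) + x' • (l₁ • e₁ + l₂ • e₂ + l₃ • e₃) = 0 := by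
      rw [← h, ← h', hs]; simp
    rw [← e]; module
  have := uniq h2 h3 d1 d2 this
  have := mul_pos p1 hx
  have := mul_pos hx' p2
  linarith

theorem ne_of {e₁ e₂ e₃ : E 2} {l₁ l₂ l₃ : ℝ} (h1 : ‖e₁‖ = 1) (h3 : ‖e₃‖ = 1) (p1 : 0 < l₁) (p2 : 0 < l₂)
    (p3 : 0 < l₃) (hs : l₁ • e₁ + l₂ • e₂ + l₃ • e₃ = 0) (d : e₁ ≠ -e₃) : e₁ ≠ e₂ := by
  rintro rfl
  have e : (l₁ + l₂) • e₁ = l₃ • (-e₃) := by rw [← sub_eq_zero, ← hs]; module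
  have h := congrArg norm e
  rw [norm_smul, norm_smul, norm_neg, h1, h3, Real.norm_of_nonneg (by positivity), Real.norm_of_nonneg (by positivity),
    mul_one, mul_one] at h
  rw [h] at e
  exact d (smul_right_injective (E 2) p3.ne' e)

theorem cap_G {p f g X : E 2} (hF : Frame p f g) {r a : ℝ} (hX : X ∈ cap p f g r a) :
    ⟪p, X - ⟪p, X⟫ • p⟫ = (0:ℝ) ∧ cos a * ‖X - ⟪p, X⟫ • p‖ < ⟪f, X - ⟪p, X⟫ • p⟫ := by
  obtain ⟨hpp, hff, hgg, hpf, hpg, hfg⟩ := hF.inners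
  have hfp : ⟪f, p⟫ = (0:ℝ) := by rw [real_inner_comm]; exact hpf
  have hgp : ⟪g, p⟫ = (0:ℝ) := by rw [real_inner_comm]; exact hpg
  have h1 : ⟪p, X - ⟪p, X⟫ • p⟫ = (0:ℝ) := by rw [inner_sub_right, real_inner_smul_right, hpp]; ring
  have h2 : ⟪f, X - ⟪p, X⟫ • p⟫ = ⟪f, X⟫ := by rw [inner_sub_right, real_inner_smul_right, hfp]; ring
  have h3 : ⟪g, X - ⟪p, X⟫ • p⟫ = ⟪g, X⟫ := by rw [inner_sub_right, real_inner_smul_right, hgp]; ring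
  refine ⟨h1, ?_⟩
  have h4 := hF.norm_sq (X - ⟪p, X⟫ • p)
  rw [h1, h2, h3] at h4
  have h5 : ‖X - ⟪p, X⟫ • p‖ = √(⟪f, X⟫ ^ 2 + ⟪g, X⟫ ^ 2) := by
    rw [← Real.sqrt_sq (norm_nonneg (X - ⟪p, X⟫ • p)), h4]; congr 1; ring
  rw [h2, h5]
  exact hX.2.1

theorem cn_ball {K : Set (E 2)} {X : E 2} (hX : X ∈ cn K) (h0 : X ≠ 0) (h1 : ‖X‖ < 1) : X ∈ Ioo (0:ℝ) 1 • K := by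
  rw [Set.mem_smul]
  refine ⟨‖X‖, ⟨norm_pos_iff.2 h0, h1⟩, _, hX.resolve_left h0, ?_⟩
  rw [smul_smul, mul_inv_cancel₀ (norm_ne_zero_iff.2 h0), one_smul]

theorem Ioo_fin {K : Set (E 2)} (hK : K ⊆ unitSphere 2) : volume (Ioo (0:ℝ) 1 • K) ≠ ⊤ := by
  have : Ioo (0:ℝ) 1 • K ⊆ ball 0 1 := by
    intro x hx
    obtain ⟨t, ht, y, hy, rfl⟩ := Set.mem_smul.1 hx
    simp [norm_smul, us.1 (hK hy), abs_of_pos ht.1, ht.2]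
  exact ((measure_mono this).trans_lt measure_ball_lt_top).ne

theorem cap_sub' {K : Set (E 2)} (hS : SConvex K) (hc : IsCompact K) {p f g : E 2} (hF : Frame p f g) {w r : ℝ} 
    (hw2 : w ≤ π / 2) (hw0 : 0 < w) (hr0 : 0 < r) (hr : r < w / 2) (hpol : ∀ u ∈ polar K, ⟪p, u⟫ ≤ -sin r)
    (hY : cos (w - r) • p + sin (w - r) • f ∈ cn K) : cap p f g r (al w r) ⊆ Ioo (0:ℝ) 1 • K := by
  intro X hX
  refine cn_ball (cap_sub hS hc hF hw2 hw0 hr0 hr hpol hY hX) ?_ hX.1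
  rintro rfl
  have := hX.2.1
  simp at this

theorem disk_sub {K : Set (E 2)} (hS : SConvex K) (hc : IsCompact K) {p : E 2} (hp : ‖p‖ = 1) {r : ℝ}
    (hr : 0 ≤ sin r) (hr' : 0 ≤ cos r) (hpol : ∀ u ∈ polar K, ⟪p, u⟫ ≤ -sin r) : disk p r ⊆ Ioo (0:ℝ) 1 • K :=
  fun _ hX => cn_ball (ball_cn hS hc hp hr hr' hpol hX.2.2) hX.1 hX.2.1

theorem lower_half {K : Set (E 2)} (hK : IsConvexBody K) {w : ℝ} (hw2 : w ≤ π / 2) (hw0 : 0 < w) {p : E 2} 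
    (hp : ‖p‖ = 1) (hpol : ∀ u ∈ polar K, ⟪p, u⟫ ≤ -sin (w / 2)) : 
    2 * Ph w (w / 2) ≤ volume.real (Ioo (0:ℝ) 1 • K) := by
  obtain ⟨t1, t2, t3, t4, t5⟩ := trig_pos (r := w / 2) hw0 hw2 (by linarith) le_rfl
  have hsub := disk_sub hK.1 hK.2.1 hp t1.le t2.le hpol
  obtain ⟨f, hf, hpf⟩ := exists_perp hp
  obtain ⟨g, hF⟩ := exists_frame hp hf hpf
  have h1 := measure_mono (μ := volume) hsub
  rw [vol_disk hF _ (by linarith) (by linarith [pi_pos])] at h1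
  have h2 := ENNReal.toReal_mono (Ioo_fin hK.1.1) h1
  rw [Measure.real]
  refine le_trans ?_ h2
  rw [ENNReal.toReal_ofReal']
  refine le_trans ?_ (le_max_left _ _)
  unfold Ph
  rw [al_half hw0 hw2]
  simp
  linarith

theorem disk_cap {p f g : E 2} {r a : ℝ} : Disjoint (disk p r) (cap p f g r a) := by
  rw [Set.disjoint_left]
  intro X h1 h2
  have := h1.2.2
  have := h2.2.2.1
  linarith

theorem lower {K : Set (E 2)} (hK : IsConvexBody K) {w : ℝ} (hw : width K = w) (hw2 : w ≤ π / 2) (hw0 : 0 < w) :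
    ∃ r : ℝ, 0 < r ∧ r ≤ w / 2 ∧ inradius K ≤ r ∧ 2 * Ph w r ≤ volume.real (Ioo (0:ℝ) 1 • K) := by
  obtain ⟨p, r, hp, hr0, hrw, hpol, hin, hor⟩ := stepA hK hw hw2 hw0
  refine ⟨r, hr0, hrw, hin, ?_⟩
  rcases hrw.eq_or_lt with h | hr
  · rw [h] at hpol ⊢
    exact lower_half hK hw2 hw0 hp hpol
  have hB := fun e he => stepB hK hw hw2 hw0 hp hr0 hr hpol (e := e) he
  have hopp : ∀ e e', Act K p r e → Act K p r e' → e ≠ -e' := by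
    rintro e e' he he' rfl
    obtain ⟨f, -, -, -, -, h⟩ := hB _ he
    have := h e' he'
    rw [inner_neg_right] at this
    linarith
  rcases hor with ⟨e₁, e₂, e₃, l₁, l₂, l₃, a1, a2, a3, p1, p2, p3, hs⟩ | ⟨e, h1, h2⟩
  swap
  · exact absurd rfl (hopp _ _ h2 h1)
  have hS := hK.1
  have hc := hK.2.1
  have hs2 : l₂ • e₂ + l₁ • e₁ + l₃ • e₃ = 0 := by rw [← hs]; abel
  have hs3 : l₃ • e₃ + l₁ • e₁ + l₂ • e₂ = 0 := by rw [← hs]; abel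
  have hs4 : l₁ • e₁ + l₃ • e₃ + l₂ • e₂ = 0 := by rw [← hs]; abel
  have hs5 : l₂ • e₂ + l₃ • e₃ + l₁ • e₁ = 0 := by rw [← hs]; abel
  have d12 := ne_of a1.1 a3.1 p1 p2 p3 hs (hopp _ _ a1 a3)
  have d13 := ne_of a1.1 a2.1 p1 p3 p2 hs4 (hopp _ _ a1 a2)
  have d23 := ne_of a2.1 a1.1 p2 p3 p1 hs5 (hopp _ _ a2 a1)
  obtain ⟨f₁, f1n, f1p, f1Y, f1k, f1s⟩ := hB _ a1
  obtain ⟨f₂, f2n, f2p, f2Y, f2k, f2s⟩ := hB _ a2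
  obtain ⟨f₃, f3n, f3p, f3Y, f3k, f3s⟩ := hB _ a3
  obtain ⟨g₁, F1⟩ := exists_frame hp f1n f1p
  obtain ⟨g₂, F2⟩ := exists_frame hp f2n f2p
  obtain ⟨g₃, F3⟩ := exists_frame hp f3n f3p
  obtain ⟨t1, t2, t3, t4, t5⟩ := trig_pos hw0 hw2 hr0 hr.le
  have hκ0 := (ka_pos hw0 hw2 hr0 hr.le).le
  have hκ1 := ka_le hw0 hw2 hr0 hr.le
  have hκα := cos_al hw0 hw2 hr0 hr.le
  have c1 : ∀ X ∈ cap p f₁ g₁ r (al w r), ∃ x y : ℝ, 0 < x ∧ 0 < y ∧ X - (⟪p, X⟫ : ℝ) • p = x • e₂ + y • e₃ := by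
    intro X hX
    obtain ⟨h1, h2⟩ := cap_G F1 hX
    rw [hκα] at h2
    exact inCone hp a1.1 a2.1 a3.1 a2.2.1 a3.2.1 p1 p2 p3 hs d23 (hopp _ _ a2 a3) f1n f1p hκ0 hκ1 (f1k _ a2) (f1k _ a3)
      (f1s _ a2) (f1s _ a3) h1 h2
  have c2 : ∀ X ∈ cap p f₂ g₂ r (al w r), ∃ x y : ℝ, 0 < x ∧ 0 < y ∧ X - (⟪p, X⟫ : ℝ) • p = x • e₁ + y • e₃ := by
    intro X hX
    obtain ⟨h1, h2⟩ := cap_G F2 hX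
    rw [hκα] at h2
    exact inCone hp a2.1 a1.1 a3.1 a1.2.1 a3.2.1 p2 p1 p3 hs2 d13 (hopp _ _ a1 a3) f2n f2p hκ0 hκ1 (f2k _ a1) (f2k _ a3)
      (f2s _ a1) (f2s _ a3) h1 h2
  have c3 : ∀ X ∈ cap p f₃ g₃ r (al w r), ∃ x y : ℝ, 0 < x ∧ 0 < y ∧ X - (⟪p, X⟫ : ℝ) • p = x • e₁ + y • e₂ := by
    intro X hX
    obtain ⟨h1, h2⟩ := cap_G F3 hX
    rw [hκα] at h2
    exact inCone hp a3.1 a1.1 a2.1 a1.2.1 a2.2.1 p3 p1 p2 hs3 d12 (hopp _ _ a1 a2) f3n f3p hκ0 hκ1 (f3k _ a1) (f3k _ a2)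
      (f3s _ a1) (f3s _ a2) h1 h2
  have flip : ∀ {G a b : E 2}, (∃ x y : ℝ, 0 < x ∧ 0 < y ∧ G = x • a + y • b) → ∃ x y : ℝ, 0 < x ∧ 0 < y ∧ G = x • b + y • a := by
    rintro G a b ⟨x, y, hx, hy, h⟩
    exact ⟨y, x, hy, hx, by rw [h]; abel⟩
  have D12 : Disjoint (cap p f₁ g₁ r (al w r)) (cap p f₂ g₂ r (al w r)) := by
    rw [Set.disjoint_left]
    intro X h1 h2
    exact disj_aux a2.1 a3.1 p1 p2 hs d23 (hopp _ _ a2 a3) (c1 X h1) (c2 X h2)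
  have D13 : Disjoint (cap p f₁ g₁ r (al w r)) (cap p f₃ g₃ r (al w r)) := by
    rw [Set.disjoint_left]
    intro X h1 h2
    exact disj_aux a3.1 a2.1 p1 p3 hs4 d23.symm (hopp _ _ a3 a2) (flip (c1 X h1)) (c3 X h2)
  have D23 : Disjoint (cap p f₂ g₂ r (al w r)) (cap p f₃ g₃ r (al w r)) := by
    rw [Set.disjoint_left]
    intro X h1 h2
    exact disj_aux a3.1 a1.1 p2 p3 hs5 d13.symm (hopp _ _ a3 a1) (flip (c2 X h1)) (flip (c3 X h2))
  have hsub : disk p r ∪ (cap p f₁ g₁ r (al w r) ∪ (cap p f₂ g₂ r (al w r) ∪ cap p f₃ g₃ r (al w r))) ⊆ Ioo (0:ℝ) 1 • K :=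
    union_subset (disk_sub hS hc hp t1.le t2.le hpol) (union_subset (cap_sub' hS hc F1 hw2 hw0 hr0 hr hpol f1Y)
      (union_subset (cap_sub' hS hc F2 hw2 hw0 hr0 hr hpol f2Y) (cap_sub' hS hc F3 hw2 hw0 hr0 hr hpol f3Y)))
  have h1 := measure_mono (μ := volume) hsub
  have hα0 := al_pos hw0 hw2 hr0 hr
  have hα1 := al_lt hw0 hw2 hr0 hr.le
  have hrp : r < π / 2 := by linarith [pi_pos]
  rw [measure_union (Disjoint.union_right disk_cap (Disjoint.union_right disk_cap disk_cap))
      ((meas_cap _ _ _ _ _).union ((meas_cap _ _ _ _ _).union (meas_cap _ _ _ _ _))),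
    measure_union (Disjoint.union_right D12 D13) ((meas_cap _ _ _ _ _).union (meas_cap _ _ _ _ _)),
    measure_union D23 (meas_cap _ _ _ _ _), vol_disk F1 _ hr0.le (by linarith), vol_cap F1 _ _ hr0 hrp hα0 hα1,
    vol_cap F2 _ _ hr0 hrp hα0 hα1, vol_cap F3 _ _ hr0 hrp hα0 hα1] at h1
  have h2 := ENNReal.toReal_mono (Ioo_fin hS.1) h1
  rw [Measure.real]
  refine le_trans ?_ h2
  rw [ENNReal.toReal_add (by simp) (by simp), ENNReal.toReal_add (by simp) (by simp), ENNReal.toReal_add (by simp) (by simp)]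
  simp only [ENNReal.toReal_ofReal']
  have m1 := le_max_left (2 * π / 3 * (1 - cos r)) 0
  have m2 := le_max_left (2 / 3 * (al w r * cos r - arcsin (sin (al w r) * cos r))) 0
  unfold Ph
  linarith

end SPaux

end

section
open Metric Set SphericalPal Real MeasureTheory
open scoped RealInnerProductSpace NNReal Pointwise

namespace SPaux

/-- Three directions at angle 120 degrees in the plane orthogonal to `p`. -/
structure T3 (p f₁ f₂ f₃ : E 2) : Prop where
  hp : ‖p‖ = 1
  h1 : ‖f₁‖ = 1
  h2 : ‖f₂‖ = 1
  h3 : ‖f₃‖ = 1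
  q1 : ⟪p, f₁⟫ = (0:ℝ)
  q2 : ⟪p, f₂⟫ = (0:ℝ)
  q3 : ⟪p, f₃⟫ = (0:ℝ)
  hs : f₁ + f₂ + f₃ = 0

theorem T3.swap {p f₁ f₂ f₃ : E 2} (h : T3 p f₁ f₂ f₃) : T3 p f₂ f₁ f₃ :=
  ⟨h.hp, h.h2, h.h1, h.h3, h.q2, h.q1, h.q3, by rw [← h.hs]; abel⟩

theorem T3.rot {p f₁ f₂ f₃ : E 2} (h : T3 p f₁ f₂ f₃) : T3 p f₂ f₃ f₁ :=
  ⟨h.hp, h.h2, h.h3, h.h1, h.q2, h.q3, h.q1, by rw [← h.hs]; abel⟩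

theorem T3.i12 {p f₁ f₂ f₃ : E 2} (h : T3 p f₁ f₂ f₃) : ⟪f₁, f₂⟫ = (-1 / 2:ℝ) := by
  have e : f₃ = -(f₁ + f₂) := eq_neg_of_add_eq_zero_right h.hs
  have := h.h3
  rw [e, norm_neg] at this
  have h2 : ‖f₁ + f₂‖ ^ 2 = 1 := by rw [this]; norm_num
  rw [norm_add_sq_real, h.h1, h.h2] at h2
  linarith

theorem T3.i13 {p f₁ f₂ f₃ : E 2} (h : T3 p f₁ f₂ f₃) : ⟪f₁, f₃⟫ = (-1 / 2:ℝ) := by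
  rw [real_inner_comm]; exact h.rot.rot.i12

theorem T3.i23 {p f₁ f₂ f₃ : E 2} (h : T3 p f₁ f₂ f₃) : ⟪f₂, f₃⟫ = (-1 / 2:ℝ) := h.rot.i12

theorem T3.frame {p f₁ f₂ f₃ : E 2} (h : T3 p f₁ f₂ f₃) : Frame p f₁ ((√3)⁻¹ • (f₂ - f₃)) := by
  have h12 := h.i12
  have h13 := h.i13
  have h23 := h.i23
  have hq1 := h.q1
  have hq2 := h.q2
  have hq3 := h.q3
  have hn : ‖(√3)⁻¹ • (f₂ - f₃)‖ = 1 := by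
    rw [← sq_eq_sq₀ (norm_nonneg _) zero_le_one, norm_smul, mul_pow, norm_sub_sq_real, h.h2, h.h3, h23, Real.norm_eq_abs, 
      sq_abs, inv_pow, Real.sq_sqrt (by norm_num)]
    norm_num
  have a1 : ⟪p, (√3)⁻¹ • (f₂ - f₃)⟫ = (0:ℝ) := by
    rw [real_inner_smul_right, inner_sub_right, hq2, hq3]; ring
  have a2 : ⟪f₁, (√3)⁻¹ • (f₂ - f₃)⟫ = (0:ℝ) := by
    rw [real_inner_smul_right, inner_sub_right, h12, h13]; ring
  have b1 : ⟪(√3)⁻¹ • (f₂ - f₃), p⟫ = (0:ℝ) := by rw [real_inner_comm]; exact a1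
  have b2 : ⟪(√3)⁻¹ • (f₂ - f₃), f₁⟫ = (0:ℝ) := by rw [real_inner_comm]; exact a2
  have b3 : ⟪f₁, p⟫ = (0:ℝ) := by rw [real_inner_comm]; exact hq1
  generalize (√3)⁻¹ • (f₂ - f₃) = g at *
  have hp := h.hp
  have h1 := h.h1
  constructor
  · intro i; fin_cases i <;> simp [*]
  · intro i j hij
    fin_cases i <;> fin_cases j <;> simp_all

theorem T3.Fsum {p f₁ f₂ f₃ : E 2} (h : T3 p f₁ f₂ f₃) (X : E 2) : ⟪f₁, X⟫ + ⟪f₂, X⟫ + ⟪f₃, X⟫ = (0:ℝ) := by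
  rw [← inner_add_left, ← inner_add_left, h.hs, inner_zero_left]

theorem T3.expand {p f₁ f₂ f₃ : E 2} (h : T3 p f₁ f₂ f₃) (X : E 2) : 
    X = ⟪p, X⟫ • p + (2 / 3 : ℝ) • (⟪f₁, X⟫ • f₁ + ⟪f₂, X⟫ • f₂ + ⟪f₃, X⟫ • f₃) := by
  have e := h.frame.expand X
  have hF := h.Fsum X
  rw [real_inner_smul_left, inner_sub_left, smul_smul] at e
  have e3 : f₃ = -(f₁ + f₂) := eq_neg_of_add_eq_zero_right h.hs
  have hF3 : ⟪f₃, X⟫ = -⟪f₁, X⟫ - (⟪f₂, X⟫:ℝ) := by linarith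
  have s3 : (√3)⁻¹ * (√3)⁻¹ = (1 / 3 : ℝ) := by
    rw [← mul_inv, Real.mul_self_sqrt (by norm_num)]; norm_num
  have : (√3)⁻¹ * (⟪f₂, X⟫ - ⟪f₃, X⟫) * (√3)⁻¹ = (1 / 3) * (⟪f₂, X⟫ - (⟪f₃, X⟫:ℝ)) := by
    rw [← s3]; ring
  rw [this, hF3] at e
  rw [hF3]
  generalize (⟪f₂, X⟫:ℝ) = F2 at *
  generalize (⟪f₁, X⟫:ℝ) = F1 at *
  generalize (⟪p, X⟫:ℝ) = z at *
  rw [e, e3]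
  module

theorem tri_cap {p f₁ f₂ f₃ X : E 2} (h : T3 p f₁ f₂ f₃) {r : ℝ} 
    (hX1 : ‖X‖ < 1) (hd : ⟪p, X⟫ < cos r * ‖X‖)
    (c2 : 0 ≤ sin r * ⟪p, X⟫ + cos r * ⟪f₂, X⟫) (c3 : 0 ≤ sin r * ⟪p, X⟫ + cos r * ⟪f₃, X⟫) 
    (m2 : ⟪f₂, X⟫ < ⟪f₁, X⟫) (m3 : ⟪f₃, X⟫ < ⟪f₁, X⟫) : X ∈ cap p f₁ ((√3)⁻¹ • (f₂ - f₃)) r (π / 3) := by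
  have hF := h.Fsum X
  have eg : ⟪(√3)⁻¹ • (f₂ - f₃), X⟫ = (√3)⁻¹ * (⟪f₂, X⟫ - ⟪f₃, X⟫) := by
    rw [real_inner_smul_left, inner_sub_left]
  have s3 : 0 < √3 := by positivity
  have s3' : √3 ^ 2 = 3 := Real.sq_sqrt (by norm_num)
  have s4 : ((√3)⁻¹) ^ 2 = 1 / 3 := by rw [inv_pow, s3']; norm_num
  refine ⟨hX1, ?_, hd, ?_, ?_⟩
  · rw [eg, cos_pi_div_three, mul_pow, s4]
    generalize (⟪f₂, X⟫:ℝ) = F2 at *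
    generalize (⟪f₁, X⟫:ℝ) = F1 at *
    generalize (⟪f₃, X⟫:ℝ) = F3 at *
    have hF1 : 0 < F1 := by linarith
    have : √(F1 ^ 2 + 1 / 3 * (F2 - F3) ^ 2) < 2 * F1 := by
      rw [Real.sqrt_lt' (by linarith)]
      have : F1 = -F2 - F3 := by linarith
      subst this
      nlinarith [mul_pos (show 0 < -F2 - F3 - F2 by linarith) (show 0 < -F2 - F3 - F3 by linarith)]
    linarith
  · rw [eg, cos_pi_div_three, sin_pi_div_three]
    have : √3 / 2 * ((√3)⁻¹ * (⟪f₂, X⟫ - ⟪f₃, X⟫)) = 1 / 2 * (⟪f₂, X⟫ - (⟪f₃, X⟫:ℝ)) := by field_simp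
    rw [this]
    have : 1 / 2 * ⟪f₁, X⟫ + 1 / 2 * (⟪f₂, X⟫ - ⟪f₃, X⟫) = -(⟪f₃, X⟫:ℝ) := by linarith
    rw [this]; linarith
  · rw [eg, cos_pi_div_three, sin_pi_div_three]
    have : √3 / 2 * ((√3)⁻¹ * (⟪f₂, X⟫ - ⟪f₃, X⟫)) = 1 / 2 * (⟪f₂, X⟫ - (⟪f₃, X⟫:ℝ)) := by field_simp
    rw [this]
    have : 1 / 2 * ⟪f₁, X⟫ - 1 / 2 * (⟪f₂, X⟫ - ⟪f₃, X⟫) = -(⟪f₂, X⟫:ℝ) := by linarith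
    rw [this]; linarith

theorem tri_tie {p f₁ f₂ f₃ X : E 2} (h : T3 p f₁ f₂ f₃) {r : ℝ} (hs : 0 < sin r) (hc : 0 < cos r)
    (c3 : 0 ≤ sin r * ⟪p, X⟫ + cos r * ⟪f₃, X⟫) 
    (m2 : ⟪f₁, X⟫ = (⟪f₂, X⟫:ℝ)) (m3 : ⟪f₃, X⟫ ≤ (⟪f₁, X⟫:ℝ)) : cos r * ‖X‖ ≤ ⟪p, X⟫ := by
  have hF := h.Fsum X
  have hn := h.frame.norm_sq X
  rw [real_inner_smul_left, inner_sub_left, mul_pow, inv_pow, Real.sq_sqrt (by norm_num)] at hn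
  rw [← m2] at hn hF
  generalize (⟪f₂, X⟫:ℝ) = F2 at *
  generalize (⟪f₁, X⟫:ℝ) = F1 at *
  generalize (⟪p, X⟫:ℝ) = z at *
  have : (⟪f₃, X⟫:ℝ) = -2 * F1 := by linarith
  rw [this] at hn c3 m3
  have hF1 : 0 ≤ F1 := by linarith
  have h1 : cos r * (2 * F1) ≤ sin r * z := by linarith
  have h2 : (cos r * (2 * F1)) ^ 2 ≤ (sin r * z) ^ 2 := pow_le_pow_left₀ (by positivity) h1 2
  have hz : 0 ≤ z := by
    have : 0 ≤ sin r * z := le_trans (by positivity) h1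
    exact nonneg_of_mul_nonneg_right this hs
  apply (sq_le_sq₀ (by positivity) hz).1
  rw [mul_pow, hn]
  have q := sin_sq_add_cos_sq r
  have : sin r ^ 2 = 1 - cos r ^ 2 := by linarith
  rw [mul_pow, mul_pow (sin r), this] at h2
  nlinarith

theorem tri_vol {p f₁ f₂ f₃ : E 2} (h : T3 p f₁ f₂ f₃) {r : ℝ} (hr0 : 0 < r) (hr1 : r < π / 2) {K : Set (E 2)}
    (hK : ∀ X ∈ K, ‖X‖ = 1 ∧ 0 ≤ sin r * ⟪p, X⟫ + cos r * ⟪f₁, X⟫ ∧ 0 ≤ sin r * ⟪p, X⟫ + cos r * ⟪f₂, X⟫ ∧ 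
      0 ≤ sin r * ⟪p, X⟫ + cos r * ⟪f₃, X⟫) : 
    volume.real (Ioo (0:ℝ) 1 • K) ≤ 2 * (π / 3 * (1 - cos r) + π / 3 * cos r - arcsin (sin (π / 3) * cos r)) := by
  have hs : 0 < sin r := sin_pos_of_pos_of_lt_pi hr0 (by linarith [pi_pos])
  have hc : 0 < cos r := cos_pos_of_mem_Ioo ⟨by linarith [pi_pos], hr1⟩
  have hsub : Ioo (0:ℝ) 1 • K ⊆ disk p r ∪ (cap p f₁ ((√3)⁻¹ • (f₂ - f₃)) r (π / 3) ∪ 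
      (cap p f₂ ((√3)⁻¹ • (f₃ - f₁)) r (π / 3) ∪ cap p f₃ ((√3)⁻¹ • (f₁ - f₂)) r (π / 3))) := by
    intro X hX
    obtain ⟨t, ht, y, hy, rfl⟩ := Set.mem_smul.1 hX
    obtain ⟨hyn, k1, k2, k3⟩ := hK y hy
    have hn : ‖t • y‖ = t := by rw [norm_smul, hyn, Real.norm_of_nonneg ht.1.le, mul_one]
    have hn1 : ‖t • y‖ < 1 := by rw [hn]; exact ht.2
    have hX0 : t • y ≠ 0 := by intro h; rw [h] at hn; simp at hn; linarith [ht.1]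
    have tr : ∀ f : E 2, 0 ≤ sin r * ⟪p, y⟫ + cos r * ⟪f, y⟫ → 0 ≤ sin r * ⟪p, t • y⟫ + cos r * ⟪f, t • y⟫ := by
      intro f hf
      rw [real_inner_smul_right, real_inner_smul_right]
      have := mul_nonneg ht.1.le hf
      linarith
    replace k1 := tr _ k1
    replace k2 := tr _ k2
    replace k3 := tr _ k3
    generalize t • y = X at *
    by_cases hd : cos r * ‖X‖ ≤ ⟪p, X⟫
    · left; exact ⟨hX0, hn1, hd⟩
    right
    by_contra hcon
    simp only [mem_union, not_or] at hcon
    obtain ⟨n1, n2, n3⟩ := hcon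
    have hd' := hd
    push Not at hd'
    have a1 : ¬ ((⟪f₂, X⟫:ℝ) < ⟪f₁, X⟫ ∧ (⟪f₃, X⟫:ℝ) < ⟪f₁, X⟫) := fun hh => n1 (tri_cap h hn1 hd' k2 k3 hh.1 hh.2)
    have a2 : ¬ ((⟪f₃, X⟫:ℝ) < ⟪f₂, X⟫ ∧ (⟪f₁, X⟫:ℝ) < ⟪f₂, X⟫) := fun hh => n2 (tri_cap h.rot hn1 hd' k3 k1 hh.1 hh.2)
    have a3 : ¬ ((⟪f₁, X⟫:ℝ) < ⟪f₃, X⟫ ∧ (⟪f₂, X⟫:ℝ) < ⟪f₃, X⟫) := fun hh => n3 (tri_cap h.rot.rot hn1 hd' k1 k2 hh.1 hh.2)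
    have b3 : ¬ ((⟪f₁, X⟫:ℝ) = ⟪f₂, X⟫ ∧ (⟪f₃, X⟫:ℝ) ≤ ⟪f₁, X⟫) := fun hh => hd (tri_tie h hs hc k3 hh.1 hh.2)
    have b1 : ¬ ((⟪f₂, X⟫:ℝ) = ⟪f₃, X⟫ ∧ (⟪f₁, X⟫:ℝ) ≤ ⟪f₂, X⟫) := fun hh => hd (tri_tie h.rot hs hc k1 hh.1 hh.2)
    have b2 : ¬ ((⟪f₃, X⟫:ℝ) = ⟪f₁, X⟫ ∧ (⟪f₂, X⟫:ℝ) ≤ ⟪f₃, X⟫) := fun hh => hd (tri_tie h.rot.rot hs hc k2 hh.1 hh.2)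
    generalize (⟪f₂, X⟫:ℝ) = F2 at *
    generalize (⟪f₁, X⟫:ℝ) = F1 at *
    generalize (⟪f₃, X⟫:ℝ) = F3 at *
    grind
  have h1 := measure_mono (μ := volume) hsub
  have h2 := h1.trans ((measure_union_le _ _).trans (add_le_add le_rfl ((measure_union_le _ _).trans 
    (add_le_add le_rfl (measure_union_le _ _)))))
  rw [vol_disk h.frame _ hr0.le (by linarith), vol_cap h.frame _ _ hr0 hr1 (by positivity) (by linarith [pi_pos]),
    vol_cap h.rot.frame _ _ hr0 hr1 (by positivity) (by linarith [pi_pos]),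
    vol_cap h.rot.rot.frame _ _ hr0 hr1 (by positivity) (by linarith [pi_pos])] at h2
  have h3 := ENNReal.toReal_mono (by simp) h2
  rw [Measure.real]
  refine h3.trans ?_
  rw [ENNReal.toReal_add (by simp) (by simp), ENNReal.toReal_add (by simp) (by simp), ENNReal.toReal_add (by simp) (by simp)]
  simp only [ENNReal.toReal_ofReal']
  have p1 : 0 ≤ 2 * π / 3 * (1 - cos r) := mul_nonneg (by positivity) (by linarith [cos_le_one r])
  have p2 : 0 ≤ 2 / 3 * (π / 3 * cos r - arcsin (sin (π / 3) * cos r)) := by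
    have hc1 := cos_le_one r
    have hcc : 0 ≤ cos r := cos_nonneg_of_mem_Icc ⟨by linarith [pi_pos], hr1.le⟩
    have hcv := (strictConcaveOn_sin_Icc.concaveOn).2 (show (0:ℝ) ∈ Icc 0 π from ⟨le_rfl, pi_pos.le⟩)
      (show π / 3 ∈ Icc 0 π from ⟨by positivity, by linarith [pi_pos]⟩) (show 0 ≤ 1 - cos r by linarith) hcc (by ring)
    simp only [smul_eq_mul, sin_zero, mul_zero, zero_add] at hcv
    have h6 : cos r * (π / 3) ≤ π / 3 := by nlinarith [pi_pos]
    have h7 : arcsin (sin (π / 3) * cos r) ≤ cos r * (π / 3) := by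
      rw [mul_comm (sin _)]
      refine (arcsin_le_arcsin hcv).trans ?_
      rw [arcsin_sin (by nlinarith [pi_pos]) (by linarith [pi_pos])]
    linarith
  rw [max_eq_left p1, max_eq_left p2]
  linarith

end SPaux

end

section
open Metric Set SphericalPal Real MeasureTheory
open scoped RealInnerProductSpace NNReal Pointwise

namespace SPaux

theorem tri_setup {v₁ v₂ v₃ : E 2} {e : ℝ} (n1 : ‖v₁‖ = 1) (n2 : ‖v₂‖ = 1) (n3 : ‖v₃‖ = 1) (h12 : ⟪v₁, v₂⟫ = e)
    (h13 : ⟪v₁, v₃⟫ = e) (h23 : ⟪v₂, v₃⟫ = e) (he : -1 / 2 < e) (he1 : e < 1) :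
    ∃ p f₁ f₂ f₃ : E 2, ∃ r R : ℝ, T3 p f₁ f₂ f₃ ∧ 0 < r ∧ r < π / 2 ∧ 0 < R ∧ R < π / 2 ∧
      cos r * sin R = 2 * (sin r * cos R) ∧ v₁ = cos R • p + sin R • f₁ ∧ v₂ = cos R • p + sin R • f₂ ∧
      v₃ = cos R • p + sin R • f₃ := by
  set D := √((1 + 2 * e) / 3) with hD
  have hD0 : 0 < D := Real.sqrt_pos.2 (by linarith)
  have hD2 : D ^ 2 = (1 + 2 * e) / 3 := Real.sq_sqrt (by linarith)
  have hD1 : D < 1 := by nlinarith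
  set R := arccos D with hR
  have hR0 : 0 < R := arccos_pos.2 hD1
  have hR1 : R < π / 2 := arccos_lt_pi_div_two.2 hD0
  have hC : cos R = D := cos_arccos (by linarith) hD1.le
  have hS0 : 0 < sin R := sin_pos_of_pos_of_lt_pi hR0 (by linarith [pi_pos])
  have hS2 : sin R ^ 2 = 1 - D ^ 2 := by rw [sin_sq, hC]
  set r := arctan (tan R / 2) with hr
  have ht : 0 < tan R := tan_pos_of_pos_of_lt_pi_div_two hR0 hR1
  have hr0 : 0 < r := arctan_pos.2 (by linarith)
  have hr1 : r < π / 2 := arctan_lt_pi_div_two _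
  have hcr : 0 < cos r := cos_arctan_pos _
  have hrel : cos r * sin R = 2 * (sin r * cos R) := by
    have : tan r = tan R / 2 := tan_arctan _
    rw [tan_eq_sin_div_cos, tan_eq_sin_div_cos, hC] at this
    rw [hC]
    field_simp at this
    linarith
  have g1 := inner_self1 n1
  have g2 := inner_self1 n2
  have g3 := inner_self1 n3
  have h21 : ⟪v₂, v₁⟫ = e := by rw [real_inner_comm]; exact h12
  have h31 : ⟪v₃, v₁⟫ = e := by rw [real_inner_comm]; exact h13
  have h32 : ⟪v₃, v₂⟫ = e := by rw [real_inner_comm]; exact h23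
  set p := (3 * D)⁻¹ • (v₁ + v₂ + v₃) with hp
  have hpv : ∀ v : E 2, ⟪v₁, v⟫ + ⟪v₂, v⟫ + ⟪v₃, v⟫ = 1 + 2 * e → ⟪p, v⟫ = D := by
    intro v hv
    rw [hp, real_inner_smul_left, inner_add_left, inner_add_left, hv]
    field_simp; linarith
  have p1 := hpv v₁ (by linarith)
  have p2 := hpv v₂ (by linarith)
  have p3 := hpv v₃ (by linarith)
  have hpp : ⟪p, p⟫ = (1:ℝ) := by
    nth_rw 2 [hp]
    rw [real_inner_smul_right, inner_add_right, inner_add_right, p1, p2, p3]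
    field_simp; norm_num
  have hpn : ‖p‖ = 1 := by
    rw [real_inner_self_eq_norm_sq] at hpp
    nlinarith [norm_nonneg p]
  have hf : ∀ v : E 2, ‖v‖ = 1 → ⟪p, v⟫ = D → ‖(sin R)⁻¹ • (v - D • p)‖ = 1 ∧ ⟪p, (sin R)⁻¹ • (v - D • p)⟫ = (0:ℝ) ∧
      v = cos R • p + sin R • ((sin R)⁻¹ • (v - D • p)) := by
    intro v hv hvp
    refine ⟨?_, ?_, ?_⟩
    · rw [← sq_eq_sq₀ (norm_nonneg _) zero_le_one, norm_smul, mul_pow, norm_sub_sq_real, norm_smul, hv, hpn,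
        real_inner_smul_right, real_inner_comm, hvp, norm_inv, Real.norm_of_nonneg hS0.le, Real.norm_of_nonneg hD0.le, inv_pow, hS2]
      have : 1 - D ^ 2 ≠ 0 := by nlinarith
      field_simp; ring
    · rw [real_inner_smul_right, inner_sub_right, real_inner_smul_right, hpp, hvp]; ring
    · rw [smul_inv_smul₀ hS0.ne', hC]; module
  obtain ⟨a1, b1, c1⟩ := hf v₁ n1 p1
  obtain ⟨a2, b2, c2⟩ := hf v₂ n2 p2
  obtain ⟨a3, b3, c3⟩ := hf v₃ n3 p3
  refine ⟨p, _, _, _, r, R, ⟨hpn, a1, a2, a3, b1, b2, b3, ?_⟩, hr0, hr1, hR0, hR1, hrel, c1, c2, c3⟩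
  have : v₁ + v₂ + v₃ = (3 * D) • p := by rw [hp, smul_smul, mul_inv_cancel₀ (by positivity), one_smul]
  rw [← smul_add, ← smul_add]
  have h0 : v₁ - D • p + (v₂ - D • p) + (v₃ - D • p) = (v₁ + v₂ + v₃) - (3 * D) • p := by module
  rw [h0, this, sub_self, smul_zero]

/-- A regular triangle together with its dual triangle. -/
structure TD (v₁ v₂ v₃ u₁ u₂ u₃ : E 2) (e H : ℝ) : Prop where
  nv1 : ‖v₁‖ = 1
  nv2 : ‖v₂‖ = 1
  nv3 : ‖v₃‖ = 1
  nu1 : ‖u₁‖ = 1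
  nu2 : ‖u₂‖ = 1
  nu3 : ‖u₃‖ = 1
  vv12 : ⟪v₁, v₂⟫ = e
  vv13 : ⟪v₁, v₃⟫ = e
  vv23 : ⟪v₂, v₃⟫ = e
  uu12 : (1 + e) * ⟪u₁, u₂⟫ = -e
  uu13 : (1 + e) * ⟪u₁, u₃⟫ = -e
  uu23 : (1 + e) * ⟪u₂, u₃⟫ = -e
  vu11 : ⟪v₁, u₁⟫ = -H
  vu12 : ⟪v₁, u₂⟫ = (0:ℝ)
  vu13 : ⟪v₁, u₃⟫ = (0:ℝ)
  vu21 : ⟪v₂, u₁⟫ = (0:ℝ)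
  vu22 : ⟪v₂, u₂⟫ = -H
  vu23 : ⟪v₂, u₃⟫ = (0:ℝ)
  vu31 : ⟪v₃, u₁⟫ = (0:ℝ)
  vu32 : ⟪v₃, u₂⟫ = (0:ℝ)
  vu33 : ⟪v₃, u₃⟫ = -H
  H0 : 0 < H
  e0 : -1 / 2 < e
  e1 : e < 1
  hH : H ^ 2 * (1 + e) = (1 - e) * (1 + 2 * e)
  expv : ∀ X : E 2, H • X = -(⟪X, u₁⟫ • v₁ + ⟪X, u₂⟫ • v₂ + ⟪X, u₃⟫ • v₃)
  expu : ∀ X : E 2, H • X = -(⟪v₁, X⟫ • u₁ + ⟪v₂, X⟫ • u₂ + ⟪v₃, X⟫ • u₃)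

variable {v₁ v₂ v₃ u₁ u₂ u₃ : E 2} {e H : ℝ}

theorem TD.swap (h : TD v₁ v₂ v₃ u₁ u₂ u₃ e H) : TD v₂ v₁ v₃ u₂ u₁ u₃ e H :=
  ⟨h.nv2, h.nv1, h.nv3, h.nu2, h.nu1, h.nu3, by rw [real_inner_comm]; exact h.vv12, h.vv23, h.vv13,
    by rw [real_inner_comm]; exact h.uu12, h.uu23, h.uu13, h.vu22, h.vu21, h.vu23, h.vu12, h.vu11, h.vu13, h.vu32, h.vu31,
    h.vu33, h.H0, h.e0, h.e1, h.hH, fun X => by rw [h.expv X]; abel, fun X => by rw [h.expu X]; abel⟩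

theorem TD.rot (h : TD v₁ v₂ v₃ u₁ u₂ u₃ e H) : TD v₂ v₃ v₁ u₂ u₃ u₁ e H :=
  ⟨h.nv2, h.nv3, h.nv1, h.nu2, h.nu3, h.nu1, h.vv23, by rw [real_inner_comm]; exact h.vv12,
    by rw [real_inner_comm]; exact h.vv13, h.uu23, by rw [real_inner_comm]; exact h.uu12, by rw [real_inner_comm]; exact h.uu13,
    h.vu22, h.vu23, h.vu21, h.vu32, h.vu33, h.vu31, h.vu12, h.vu13, h.vu11,
    h.H0, h.e0, h.e1, h.hH, fun X => by rw [h.expv X]; abel, fun X => by rw [h.expu X]; abel⟩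

theorem rc {x y : E 2} {a : ℝ} (h : ⟪x, y⟫ = a) : ⟪y, x⟫ = a := by rw [real_inner_comm]; exact h

theorem dual_exp (a11 : ⟪v₁, u₁⟫ = -H) (a12 : ⟪v₁, u₂⟫ = (0:ℝ)) (a13 : ⟪v₁, u₃⟫ = (0:ℝ)) (a21 : ⟪v₂, u₁⟫ = (0:ℝ))
    (a22 : ⟪v₂, u₂⟫ = -H) (a23 : ⟪v₂, u₃⟫ = (0:ℝ)) (a31 : ⟪v₃, u₁⟫ = (0:ℝ)) (a32 : ⟪v₃, u₂⟫ = (0:ℝ))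
    (a33 : ⟪v₃, u₃⟫ = -H) 
    (hz : ∀ Y : E 2, ⟪Y, u₁⟫ = (0:ℝ) → ⟪Y, u₂⟫ = (0:ℝ) → ⟪Y, u₃⟫ = (0:ℝ) → Y = 0) (X : E 2) :
    H • X = -(⟪X, u₁⟫ • v₁ + ⟪X, u₂⟫ • v₂ + ⟪X, u₃⟫ • v₃) := by
  rw [← add_eq_zero_iff_eq_neg]
  apply hz <;>
  · simp only [inner_add_left, real_inner_smul_left, a11, a12, a13, a21, a22, a23, a31, a32, a33]
    ring

theorem T3.td {p f₁ f₂ f₃ : E 2} (h : T3 p f₁ f₂ f₃) {r R : ℝ} (hr0 : 0 < r) (hr1 : r < π / 2) (hR0 : 0 < R) (hR1 : R < π / 2)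
    (hrel : cos r * sin R = 2 * (sin r * cos R)) :
    TD (cos R • p + sin R • f₁) (cos R • p + sin R • f₂) (cos R • p + sin R • f₃) 
      (-(sin r • p + cos r • f₁)) (-(sin r • p + cos r • f₂)) (-(sin r • p + cos r • f₃)) 
      (cos R ^ 2 - sin R ^ 2 / 2) (3 * (sin r * cos R)) := by
  have hs : 0 < sin r := sin_pos_of_pos_of_lt_pi hr0 (by linarith [pi_pos])
  have hc : 0 < cos r := cos_pos_of_mem_Ioo ⟨by linarith [pi_pos], hr1⟩
  have hS : 0 < sin R := sin_pos_of_pos_of_lt_pi hR0 (by linarith [pi_pos])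
  have hC : 0 < cos R := cos_pos_of_mem_Ioo ⟨by linarith [pi_pos], hR1⟩
  have k1 := sin_sq_add_cos_sq r
  have k2 := sin_sq_add_cos_sq R
  have h12 := h.i12
  have h13 := h.i13
  have h23 := h.i23
  have h21 : ⟪f₂, f₁⟫ = (-1 / 2:ℝ) := by rw [real_inner_comm]; exact h12
  have h31 : ⟪f₃, f₁⟫ = (-1 / 2:ℝ) := by rw [real_inner_comm]; exact h13
  have h32 : ⟪f₃, f₂⟫ = (-1 / 2:ℝ) := by rw [real_inner_comm]; exact h23
  have pp := inner_self1 h.hp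
  have g1 := inner_self1 h.h1
  have g2 := inner_self1 h.h2
  have g3 := inner_self1 h.h3
  have q1 := h.q1
  have q2 := h.q2
  have q3 := h.q3
  have q1' : ⟪f₁, p⟫ = (0:ℝ) := by rw [real_inner_comm]; exact h.q1
  have q2' : ⟪f₂, p⟫ = (0:ℝ) := by rw [real_inner_comm]; exact h.q2
  have q3' : ⟪f₃, p⟫ = (0:ℝ) := by rw [real_inner_comm]; exact h.q3
  have hexp := h.expand
  have hFs := h.Fsum
  have hp := h.hp
  have h1 := h.h1
  have h2 := h.h2
  have h3 := h.h3
  have nv : ∀ f : E 2, ‖f‖ = 1 → ⟪p, f⟫ = (0:ℝ) → ‖cos R • p + sin R • f‖ = 1 := fun f a b => norm_comb1 hp a b R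
  have nu : ∀ f : E 2, ‖f‖ = 1 → ⟪p, f⟫ = (0:ℝ) → ‖-(sin r • p + cos r • f)‖ = 1 := by
    intro f a b
    rw [norm_neg, ← sq_eq_sq₀ (norm_nonneg _) zero_le_one, norm_comb hp a b, k1]; norm_num
  have key : (cos r * sin R) ^ 2 = 4 * (sin r * cos R) ^ 2 := by rw [hrel]; ring
  generalize sin r = s at *
  generalize cos r = c at *
  generalize sin R = S at *
  generalize cos R = D at *
  clear hr0 hr1 hR0 hR1 h
  have hee : 1 + (D ^ 2 - S ^ 2 / 2) = 2 - 3 / 2 * S ^ 2 := by linarith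
  have hD2 : D ^ 2 = 1 - S ^ 2 := by linarith
  have hc2 : c ^ 2 = 1 - s ^ 2 := by linarith
  have key2 : s ^ 2 * (4 - 3 * S ^ 2) = S ^ 2 := by
    have : c ^ 2 * S ^ 2 = 4 * (s ^ 2 * D ^ 2) := by linarith [key, mul_pow c S 2, mul_pow s D 2]
    rw [hD2, hc2] at this; linarith
  have uu : ∀ f f' : E 2, ⟪p, f⟫ = (0:ℝ) → ⟪p, f'⟫ = (0:ℝ) → ⟪f, f'⟫ = (-1 / 2:ℝ) →
      (1 + (D ^ 2 - S ^ 2 / 2)) * ⟪-(s • p + c • f), -(s • p + c • f')⟫ = -(D ^ 2 - S ^ 2 / 2) := by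
    intro f f' a b cc
    have a' : ⟪f, p⟫ = (0:ℝ) := by rw [real_inner_comm]; exact a
    simp only [inner_neg_left, inner_neg_right, inner_add_left, inner_add_right, real_inner_smul_left, real_inner_smul_right,
      a', b, cc, pp]
    rw [hee]
    have : -(-(s * (s * 1) + s * (c * 0)) + -(c * (s * 0) + c * (c * (-1 / 2)))) = 3 / 2 * s ^ 2 - 1 / 2 := by
      linarith
    rw [this]; linarith
  have vu : ∀ f f' : E 2, ⟪p, f⟫ = (0:ℝ) → ⟪p, f'⟫ = (0:ℝ) → ⟪f, f'⟫ = (-1 / 2:ℝ) →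
      ⟪D • p + S • f, -(s • p + c • f')⟫ = (0:ℝ) := by
    intro f f' a b cc
    have a' : ⟪f, p⟫ = (0:ℝ) := by rw [real_inner_comm]; exact a
    simp only [inner_neg_left, inner_neg_right, inner_add_left, inner_add_right, real_inner_smul_left, real_inner_smul_right,
      a', b, cc, pp]
    linarith
  have vu' : ∀ f : E 2, ⟪p, f⟫ = (0:ℝ) → ‖f‖ = 1 → ⟪D • p + S • f, -(s • p + c • f)⟫ = -(3 * (s * D)) := by
    intro f a cc
    have a' : ⟪f, p⟫ = (0:ℝ) := by rw [real_inner_comm]; exact a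
    simp only [inner_neg_left, inner_neg_right, inner_add_left, inner_add_right, real_inner_smul_left, real_inner_smul_right,
      a', a, inner_self1 cc, pp]
    linarith
  have vv : ∀ f f' : E 2, ⟪p, f⟫ = (0:ℝ) → ⟪p, f'⟫ = (0:ℝ) → ⟪f, f'⟫ = (-1 / 2:ℝ) →
      ⟪D • p + S • f, D • p + S • f'⟫ = D ^ 2 - S ^ 2 / 2 := by
    intro f f' a b cc
    have a' : ⟪f, p⟫ = (0:ℝ) := by rw [real_inner_comm]; exact a
    simp only [inner_neg_left, inner_neg_right, inner_add_left, inner_add_right, real_inner_smul_left, real_inner_smul_right,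
      a', b, cc, pp]
    ring
  have zero : ∀ (Y : E 2) (a b : ℝ), 0 < a → 0 < b → a * ⟪p, Y⟫ + b * ⟪f₁, Y⟫ = 0 → a * ⟪p, Y⟫ + b * ⟪f₂, Y⟫ = 0 →
      a * ⟪p, Y⟫ + b * ⟪f₃, Y⟫ = 0 → Y = 0 := by
    intro Y a b ha hb y1 y2 y3
    have := hFs Y
    have y0 : ⟪p, Y⟫ = (0:ℝ) := by
      have : 3 * a * ⟪p, Y⟫ + b * (⟪f₁, Y⟫ + ⟪f₂, Y⟫ + ⟪f₃, Y⟫) = 0 := by linarith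
      rw [hFs, mul_zero, add_zero] at this
      rcases mul_eq_zero.1 this with h | h
      · linarith
      · exact h
    have z : ∀ f : E 2, a * ⟪p, Y⟫ + b * ⟪f, Y⟫ = 0 → ⟪f, Y⟫ = (0:ℝ) := by
      intro f hf
      rw [y0, mul_zero, zero_add] at hf
      rcases mul_eq_zero.1 hf with h | h
      · linarith
      · exact h
    rw [hexp Y, y0, z _ y1, z _ y2, z _ y3]; simp
  have V12 := vu _ _ q1 q2 h12
  have V13 := vu _ _ q1 q3 h13
  have V21 := vu _ _ q2 q1 h21
  have V23 := vu _ _ q2 q3 h23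
  have V31 := vu _ _ q3 q1 h31
  have V32 := vu _ _ q3 q2 h32
  have V11 := vu' _ q1 h1
  have V22 := vu' _ q2 h2
  have V33 := vu' _ q3 h3
  refine ⟨nv _ h1 q1, nv _ h2 q2, nv _ h3 q3, nu _ h1 q1, nu _ h2 q2, nu _ h3 q3, vv _ _ q1 q2 h12, vv _ _ q1 q3 h13,
    vv _ _ q2 q3 h23, uu _ _ q1 q2 h12, uu _ _ q1 q3 h13, uu _ _ q2 q3 h23, V11, V12, V13, V21, V22, V23, V31, V32, V33,
    by positivity, by linarith [pow_pos hC 2], by linarith [pow_pos hS 2], ?_, ?_, ?_⟩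
  · rw [hee, mul_pow, mul_pow, hD2]
    linear_combination (9 / 2 * (1 - S ^ 2)) * key2
  · have q : ∀ (Y f : E 2), ⟪Y, -(s • p + c • f)⟫ = (0:ℝ) → s * ⟪p, Y⟫ + c * ⟪f, Y⟫ = 0 := by
      intro Y f hY
      rw [real_inner_comm] at hY
      simp only [inner_neg_left, inner_add_left, real_inner_smul_left] at hY
      linarith
    exact dual_exp V11 V12 V13 V21 V22 V23 V31 V32 V33 fun Y y1 y2 y3 => zero Y s c hs hc (q _ _ y1) (q _ _ y2) (q _ _ y3)
  · have q : ∀ (Y f : E 2), ⟪Y, D • p + S • f⟫ = (0:ℝ) → D * ⟪p, Y⟫ + S * ⟪f, Y⟫ = 0 := by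
      intro Y f hY
      rw [real_inner_comm] at hY
      simp only [inner_add_left, real_inner_smul_left] at hY
      linarith
    have key := dual_exp (rc V11) (rc V21) (rc V31) (rc V12) (rc V22) (rc V32) (rc V13) (rc V23) (rc V33) 
      fun Y y1 y2 y3 => zero Y D S hC hS (q _ _ y1) (q _ _ y2) (q _ _ y3)
    intro X
    rw [key X, real_inner_comm X, real_inner_comm X, real_inner_comm X]

end SPaux

end

section
open Metric Set SphericalPal Real MeasureTheory
open scoped RealInnerProductSpace NNReal Pointwise

namespace SPaux

/-- Triangle given by its three half-spaces. -/
def Tset (u₁ u₂ u₃ : E 2) : Set (E 2) := {X | ‖X‖ = 1 ∧ ⟪X, u₁⟫ ≤ 0 ∧ ⟪X, u₂⟫ ≤ 0 ∧ ⟪X, u₃⟫ ≤ 0}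

variable {v₁ v₂ v₃ u₁ u₂ u₃ : E 2} {e H : ℝ}

theorem TD.eq_comb (h : TD v₁ v₂ v₃ u₁ u₂ u₃ e H) (X : E 2) :
    X = (-⟪X, u₁⟫ / H) • v₁ + (-⟪X, u₂⟫ / H) • v₂ + (-⟪X, u₃⟫ / H) • v₃ := by
  have := h.expv X
  have h0 := h.H0
  have h2 : X = H⁻¹ • (H • X) := by rw [smul_smul, inv_mul_cancel₀ h0.ne', one_smul]
  nth_rw 1 [h2, this]
  simp only [div_eq_mul_inv]
  module

theorem TD.eq_combu (h : TD v₁ v₂ v₃ u₁ u₂ u₃ e H) (X : E 2) :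
    X = (-⟪v₁, X⟫ / H) • u₁ + (-⟪v₂, X⟫ / H) • u₂ + (-⟪v₃, X⟫ / H) • u₃ := by
  have := h.expu X
  have h0 := h.H0
  have h2 : X = H⁻¹ • (H • X) := by rw [smul_smul, inv_mul_cancel₀ h0.ne', one_smul]
  nth_rw 1 [h2, this]
  simp only [div_eq_mul_inv]
  module

theorem TD.pos (h : TD v₁ v₂ v₃ u₁ u₂ u₃ e H) {p : E 2} (p1 : 0 < ⟪p, v₁⟫) (p2 : 0 < ⟪p, v₂⟫) (p3 : 0 < ⟪p, v₃⟫)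
    {X : E 2} (hX : X ∈ Tset u₁ u₂ u₃) : 0 < ⟪p, X⟫ := by
  obtain ⟨hn, a1, a2, a3⟩ := hX
  have e := h.expv X
  have h0 := h.H0
  have e2 : H * ⟪p, X⟫ = -⟪X, u₁⟫ * ⟪p, v₁⟫ + -⟪X, u₂⟫ * ⟪p, v₂⟫ + -⟪X, u₃⟫ * ⟪p, v₃⟫ := by
    rw [← real_inner_smul_right, e]
    simp only [inner_neg_right, inner_add_right, real_inner_smul_right]; ring
  have b1 := mul_nonneg (neg_nonneg.2 a1) p1.le
  have b2 := mul_nonneg (neg_nonneg.2 a2) p2.le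
  have b3 := mul_nonneg (neg_nonneg.2 a3) p3.le
  by_contra hc
  push Not at hc
  have hle : H * ⟪p, X⟫ ≤ 0 := mul_nonpos_of_nonneg_of_nonpos h0.le hc
  have c1 : ⟪X, u₁⟫ = (0:ℝ) := by
    rcases mul_eq_zero.1 (show -⟪X, u₁⟫ * ⟪p, v₁⟫ = 0 by linarith) with h | h <;> linarith
  have c2 : ⟪X, u₂⟫ = (0:ℝ) := by
    rcases mul_eq_zero.1 (show -⟪X, u₂⟫ * ⟪p, v₂⟫ = 0 by linarith) with h | h <;> linarith
  have c3 : ⟪X, u₃⟫ = (0:ℝ) := by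
    rcases mul_eq_zero.1 (show -⟪X, u₃⟫ * ⟪p, v₃⟫ = 0 by linarith) with h | h <;> linarith
  have := h.eq_comb X
  rw [c1, c2, c3] at this
  rw [this] at hn
  simp at hn

theorem TD.sconvex (h : TD v₁ v₂ v₃ u₁ u₂ u₃ e H) {p : E 2} (hp : ‖p‖ = 1) (p1 : 0 < ⟪p, v₁⟫) (p2 : 0 < ⟪p, v₂⟫) 
    (p3 : 0 < ⟪p, v₃⟫) : SConvex (Tset u₁ u₂ u₃) := by
  refine ⟨fun X hX => us.2 hX.1, ⟨p, us.2 hp, fun X hX => h.pos p1 p2 p3 hX⟩, ?_⟩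
  intro x hx y hy z hz
  have hxy : x ≠ -y := by
    rintro rfl
    have := h.pos p1 p2 p3 hx
    rw [inner_neg_right] at this
    linarith [h.pos p1 p2 p3 hy]
  obtain ⟨a, b, ha, hb, hzz⟩ := mem_seg hx.1 hy.1 hxy hz
  have key : ∀ u : E 2, ⟪x, u⟫ ≤ 0 → ⟪y, u⟫ ≤ 0 → ⟪z, u⟫ ≤ 0 := by
    intro u h1 h2
    rw [hzz, inner_add_left, real_inner_smul_left, real_inner_smul_left]
    have := mul_nonpos_of_nonneg_of_nonpos ha h1
    have := mul_nonpos_of_nonneg_of_nonpos hb h2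
    linarith
  exact ⟨us.1 hz.1, key _ hx.2.1 hy.2.1, key _ hx.2.2.1 hy.2.2.1, key _ hx.2.2.2 hy.2.2.2⟩

theorem TD.mem1 (h : TD v₁ v₂ v₃ u₁ u₂ u₃ e H) : v₁ ∈ Tset u₁ u₂ u₃ :=
  ⟨h.nv1, by rw [h.vu11]; linarith [h.H0], h.vu12.le, h.vu13.le⟩

theorem TD.mem2 (h : TD v₁ v₂ v₃ u₁ u₂ u₃ e H) : v₂ ∈ Tset u₁ u₂ u₃ :=
  ⟨h.nv2, h.vu21.le, by rw [h.vu22]; linarith [h.H0], h.vu23.le⟩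

theorem TD.mem3 (h : TD v₁ v₂ v₃ u₁ u₂ u₃ e H) : v₃ ∈ Tset u₁ u₂ u₃ :=
  ⟨h.nv3, h.vu31.le, h.vu32.le, by rw [h.vu33]; linarith [h.H0]⟩

theorem TD.sconv_eq (h : TD v₁ v₂ v₃ u₁ u₂ u₃ e H) {p : E 2} (hp : ‖p‖ = 1) (p1 : 0 < ⟪p, v₁⟫) (p2 : 0 < ⟪p, v₂⟫) 
    (p3 : 0 < ⟪p, v₃⟫) : sconv {v₁, v₂, v₃} = Tset u₁ u₂ u₃ := by
  apply Subset.antisymm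
  · intro X hX
    refine hX (Tset u₁ u₂ u₃) ⟨h.sconvex hp p1 p2 p3, ?_⟩
    rintro x (rfl | rfl | rfl)
    · exact h.mem1
    · exact h.mem2
    · exact h.mem3
  · rintro X ⟨hn, a1, a2, a3⟩ C ⟨hC, hs⟩
    have k1 : v₁ ∈ cn C := cn_of_mem hC.1 (hs (by simp))
    have k2 : v₂ ∈ cn C := cn_of_mem hC.1 (hs (by simp))
    have k3 : v₃ ∈ cn C := cn_of_mem hC.1 (hs (by simp))
    have h0 := h.H0.le
    have hXC : X ∈ cn C := by
      rw [h.eq_comb X]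
      exact cn_add hC (cn_add hC (cn_smul k1 (div_nonneg (neg_nonneg.2 a1) h0)) (cn_smul k2 (div_nonneg (neg_nonneg.2 a2) h0)))
        (cn_smul k3 (div_nonneg (neg_nonneg.2 a3) h0))
    rcases hXC with h | h
    · simp [h] at hn
    · rw [hn] at h; simpa using h

theorem Tset_closed (u₁ u₂ u₃ : E 2) : IsClosed (Tset u₁ u₂ u₃) := by
  unfold Tset
  apply IsClosed.inter (s₁ := {X : E 2 | ‖X‖ = 1}) (isClosed_eq (by fun_prop) (by fun_prop))
  apply IsClosed.inter (s₁ := {X : E 2 | ⟪X, u₁⟫ ≤ 0}) (isClosed_le (by fun_prop) (by fun_prop))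
  apply IsClosed.inter (s₁ := {X : E 2 | ⟪X, u₂⟫ ≤ 0}) (isClosed_le (by fun_prop) (by fun_prop))
  exact isClosed_le (f := fun X : E 2 => ⟪X, u₃⟫) (g := fun _ => (0:ℝ)) (by fun_prop) (by fun_prop)

theorem Tset_sub (u₁ u₂ u₃ : E 2) : Tset u₁ u₂ u₃ ⊆ unitSphere 2 := fun _ hX => us.2 hX.1

theorem Tset_compact (u₁ u₂ u₃ : E 2) : IsCompact (Tset u₁ u₂ u₃) :=
  (isCompact_sphere (0 : E 2) 1).of_isClosed_subset (Tset_closed _ _ _) (Tset_sub _ _ _)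

theorem Tset_ball {p : E 2} {r : ℝ} (hp : ‖p‖ = 1) (n1 : ‖u₁‖ = 1) (n2 : ‖u₂‖ = 1) (n3 : ‖u₃‖ = 1)
    (hr0 : 0 < r) (hr1 : r < π / 2) (h1 : ⟪p, u₁⟫ = -sin r) (h2 : ⟪p, u₂⟫ = -sin r) (h3 : ⟪p, u₃⟫ = -sin r) :
    gball p r ⊆ Tset u₁ u₂ u₃ := by
  have hs : 0 < sin r := sin_pos_of_pos_of_lt_pi hr0 (by linarith [pi_pos])
  have hc : 0 < cos r := cos_pos_of_mem_Ioo ⟨by linarith [pi_pos], hr1⟩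
  rintro x ⟨hx, hd⟩
  have hxn := us.1 hx
  unfold gdist at hd
  have hxp : cos r * ‖x‖ ≤ ⟪p, x⟫ := by
    rw [hxn, mul_one]
    have := abs_real_inner_le_norm p x
    rw [hp, hxn, mul_one, abs_le] at this
    have h2 := cos_le_cos_of_nonneg_of_le_pi (arccos_nonneg _) (by linarith [pi_pos]) hd
    rwa [cos_arccos this.1 this.2] at h2
  exact ⟨hxn, ball_polar hp n1 hs.le hc.le h1.le hxp, ball_polar hp n2 hs.le hc.le h2.le hxp, 
    ball_polar hp n3 hs.le hc.le h3.le hxp⟩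

theorem le_inradius {K : Set (E 2)} (hK : SConvex K) {p : E 2} (hp : ‖p‖ = 1) {r : ℝ} (hr : 0 ≤ r) (hb : gball p r ⊆ K) :
    r ≤ inradius K := by
  apply le_csSup
  · refine ⟨π, ?_⟩
    rintro r' ⟨-, q, hq, hqK⟩
    by_contra hc
    push Not at hc
    obtain ⟨-, ⟨u, -, hu⟩, -⟩ := hK
    have h1 := hu q (hqK ⟨hq, (arccos_le_pi _).trans hc.le⟩)
    have h2 := hu (-q) (hqK ⟨us.2 (by rw [norm_neg]; exact us.1 hq), (arccos_le_pi _).trans hc.le⟩)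
    rw [inner_neg_right] at h2
    linarith
  · exact ⟨hr, p, us.2 hp, hb⟩

theorem body_of_ball {K : Set (E 2)} (hK : SConvex K) (hc : IsCompact K) {p : E 2} (hp : ‖p‖ = 1) {r : ℝ} (hr : 0 < r) 
    (hb : gball p r ⊆ K) : IsConvexBody K := by
  refine ⟨hK, hc, p, hb ⟨us.2 hp, ?_⟩, r, hr, fun y hy hd => hb ⟨hy, hd.le⟩⟩
  unfold gdist
  rw [inner_self1 hp, arccos_one]; exact hr.le

theorem lune_bound {u v x : E 2} (hu : ‖u‖ = 1) (hv : ‖v‖ = 1) (hx : ‖x‖ = 1) (hxu : ⟪x, u⟫ ≤ 0) (hxv : ⟪x, v⟫ ≤ 0) 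
    (hm : ⟪u, v⟫ ≤ 0) : (⟪x, u⟫:ℝ) ^ 2 ≤ 1 - (⟪u, v⟫:ℝ) ^ 2 := by
  have guu := inner_self1 hu
  have gvv := inner_self1 hv
  have gxx := inner_self1 hx
  have cs := real_inner_mul_inner_self_le (x - (⟪x, u⟫:ℝ) • u) (v - (⟪u, v⟫:ℝ) • u)
  have c1 : ⟪v, u⟫ = (⟪u, v⟫ : ℝ) := real_inner_comm _ _
  have c2 : ⟪u, x⟫ = (⟪x, u⟫ : ℝ) := real_inner_comm _ _
  simp only [inner_sub_left, inner_sub_right, real_inner_smul_left, real_inner_smul_right, guu, gvv, gxx, c1, c2] at cs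
  generalize (⟪u, v⟫:ℝ) = m at *
  generalize (⟪x, u⟫:ℝ) = t at *
  generalize (⟪x, v⟫:ℝ) = k at *
  have h1 : 0 ≤ t * m := mul_nonneg_of_nonpos_of_nonpos hxu hm
  have h2 : (t * m) ^ 2 ≤ (k - t * m) ^ 2 := by nlinarith
  nlinarith

theorem Wpos_aux (h : TD v₁ v₂ v₃ u₁ u₂ u₃ e H) (he : 0 ≤ e) {a₁ a₂ : ℝ} (h1 : 0 ≤ a₁) (h2 : 0 ≤ a₂) (h12 : a₂ ≤ a₁) {u : E 2} 
    (hu : ‖u‖ = 1) (hu' : u = a₁ • u₁ + a₂ • u₂) :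
    ∃ b₁ b₂ : ℝ, 0 ≤ b₁ ∧ 0 ≤ b₂ ∧ b₁ • v₁ + b₂ • v₂ ≠ 0 ∧ H * ‖b₁ • v₁ + b₂ • v₂‖ ≤ -⟪b₁ • v₁ + b₂ • v₂, u⟫ := by
  have hk := h.uu12
  have guu := inner_self1 hu
  have hn : (1 + e) * (a₁ ^ 2 + a₂ ^ 2) - 2 * e * (a₁ * a₂) = 1 + e := by
    rw [hu'] at guu
    simp only [inner_add_left, inner_add_right, real_inner_smul_left, real_inner_smul_right, inner_self1 h.nu1, inner_self1 h.nu2,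
      real_inner_comm u₁ u₂] at guu
    linear_combination (1 + e) * guu - 2 * a₁ * a₂ * hk
  have hH := h.H0
  have he1 := h.e1
  have yu : ∀ b₁ b₂ : ℝ, -⟪b₁ • v₁ + b₂ • v₂, u⟫ = H * (b₁ * a₁ + b₂ * a₂) := by
    intro b₁ b₂
    rw [hu']
    simp only [inner_add_left, inner_add_right, real_inner_smul_left, real_inner_smul_right, h.vu11, h.vu12, h.vu21, h.vu22]
    ring
  by_cases hc : a₂ ≤ e * a₁
  · refine ⟨1, 0, zero_le_one, le_rfl, ?_, ?_⟩
    · intro h0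
      have : ‖v₁‖ = 0 := by simpa using h0
      rw [h.nv1] at this; linarith
    · rw [yu]
      simp only [one_smul, zero_smul, add_zero, h.nv1]
      apply mul_le_mul_of_nonneg_left _ hH.le
      have : a₂ * ((1 + e) * a₂ - 2 * e * a₁) ≤ 0 := by
        apply mul_nonpos_of_nonneg_of_nonpos h2
        nlinarith [mul_nonneg he h1]
      have : 1 ≤ a₁ ^ 2 := by
        by_contra hcon
        push Not at hcon
        nlinarith
      nlinarith
  · push Not at hc
    have hP : 2 * (a₁ * a₂) ≤ 1 + e := by
      nlinarith [sq_nonneg (a₁ - a₂)]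
    set q := a₁ ^ 2 + a₂ ^ 2 - 2 * e * (a₁ * a₂) with hq
    have hqe : 1 - e ^ 2 ≤ q := by
      have : (1 + e) * q = (1 + e) - e ^ 2 * (2 * (a₁ * a₂)) := by rw [hq]; linear_combination hn
      have h3 : e ^ 2 * (2 * (a₁ * a₂)) ≤ e ^ 2 * (1 + e) := mul_le_mul_of_nonneg_left hP (sq_nonneg e)
      have h4 : (1 + e) * (1 - e ^ 2) ≤ (1 + e) * q := by rw [this]; linarith
      exact le_of_mul_le_mul_left h4 (by linarith)
    have hq0 : 0 < q := by nlinarith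
    have hi := yu (a₁ - e * a₂) (a₂ - e * a₁)
    have hi' : -⟪(a₁ - e * a₂) • v₁ + (a₂ - e * a₁) • v₂, u⟫ = H * q := by rw [hi, hq]; ring
    refine ⟨a₁ - e * a₂, a₂ - e * a₁, by nlinarith, by linarith, ?_, ?_⟩
    · intro h0
      rw [h0, inner_zero_left, neg_zero] at hi'
      have := mul_pos hH hq0
      linarith
    · rw [hi']
      apply mul_le_mul_of_nonneg_left _ hH.le
      rw [← sq_le_sq₀ (norm_nonneg _) hq0.le, norm_add_sq_real, norm_smul, norm_smul, h.nv1, h.nv2, real_inner_smul_left, 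
        real_inner_smul_right, h.vv12, mul_one, mul_one, Real.norm_eq_abs, Real.norm_eq_abs, sq_abs, sq_abs]
      have : (a₁ - e * a₂) ^ 2 + 2 * ((a₁ - e * a₂) * ((a₂ - e * a₁) * e)) + (a₂ - e * a₁) ^ 2 = (1 - e ^ 2) * q := by
        rw [hq]; ring
      rw [this, sq q]
      exact mul_le_mul_of_nonneg_right hqe hq0.le

theorem Wpos (h : TD v₁ v₂ v₃ u₁ u₂ u₃ e H) (he : 0 ≤ e) {u : E 2} (hu : ‖u‖ = 1) (h1 : ⟪v₁, u⟫ ≤ 0) (h2 : ⟪v₂, u⟫ ≤ 0)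
    (h3 : ⟪v₃, u⟫ = (0:ℝ)) :
    ∃ b₁ b₂ : ℝ, 0 ≤ b₁ ∧ 0 ≤ b₂ ∧ b₁ • v₁ + b₂ • v₂ ≠ 0 ∧ H * ‖b₁ • v₁ + b₂ • v₂‖ ≤ -⟪b₁ • v₁ + b₂ • v₂, u⟫ := by
  have ex := h.eq_combu u
  rw [h3, neg_zero, zero_div, zero_smul, add_zero] at ex
  have A1 : 0 ≤ -⟪v₁, u⟫ / H := div_nonneg (neg_nonneg.2 h1) h.H0.le
  have A2 : 0 ≤ -⟪v₂, u⟫ / H := div_nonneg (neg_nonneg.2 h2) h.H0.le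
  rcases le_total (-⟪v₂, u⟫ / H) (-⟪v₁, u⟫ / H) with hle | hle
  · exact Wpos_aux h he A1 A2 hle hu ex
  · obtain ⟨b₁, b₂, x1, x2, x3, x4⟩ := Wpos_aux h.swap he A2 A1 hle hu (by rw [add_comm]; exact ex)
    exact ⟨b₂, b₁, x2, x1, by rw [add_comm]; exact x3, by rw [add_comm (b₂ • v₁)]; exact x4⟩

theorem Wpt (h : TD v₁ v₂ v₃ u₁ u₂ u₃ e H) (hS : SConvex (Tset u₁ u₂ u₃)) (he : 0 ≤ e) {u : E 2} (hu : ‖u‖ = 1) 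
    (h1 : ⟪v₁, u⟫ ≤ 0) (h2 : ⟪v₂, u⟫ ≤ 0) (h3 : ⟪v₃, u⟫ = (0:ℝ)) : ∃ x ∈ Tset u₁ u₂ u₃, H ≤ -⟪x, u⟫ := by
  obtain ⟨b₁, b₂, x1, x2, x3, x4⟩ := Wpos h he hu h1 h2 h3
  have hc : b₁ • v₁ + b₂ • v₂ ∈ cn (Tset u₁ u₂ u₃) := 
    cn_add hS (cn_smul (cn_of_mem hS.1 h.mem1) x1) (cn_smul (cn_of_mem hS.1 h.mem2) x2)
  generalize b₁ • v₁ + b₂ • v₂ = y at *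
  rcases hc with hc | hc
  · exact absurd hc x3
  refine ⟨_, hc, ?_⟩
  have hn : 0 < ‖y‖ := norm_pos_iff.2 x3
  rw [real_inner_smul_left, ← mul_neg, inv_mul_eq_div, le_div_iff₀ hn]
  exact x4

theorem Tset_rot : Tset u₂ u₃ u₁ = Tset u₁ u₂ u₃ := by
  ext X; simp only [Tset, mem_ofPred_eq]; tauto

theorem Wany (h : TD v₁ v₂ v₃ u₁ u₂ u₃ e H) (hS : SConvex (Tset u₁ u₂ u₃)) (he : 0 ≤ e) {u x : E 2} 
    (hu : u ∈ polar (Tset u₁ u₂ u₃)) (hx : x ∈ Tset u₁ u₂ u₃) (hxu : ⟪x, u⟫ = (0:ℝ)) : ∃ y ∈ Tset u₁ u₂ u₃, H ≤ -⟪y, u⟫ := by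
  have hun := us.1 hu.1
  have w1 := hu.2 _ h.mem1
  have w2 := hu.2 _ h.mem2
  have w3 := hu.2 _ h.mem3
  by_cases c3 : ⟪v₃, u⟫ = (0:ℝ)
  · exact Wpt h hS he hun w1 w2 c3
  by_cases c1 : ⟪v₁, u⟫ = (0:ℝ)
  · have hS' := hS
    rw [← Tset_rot] at hS' ⊢
    exact Wpt h.rot hS' he hun w2 w3 c1
  by_cases c2 : ⟪v₂, u⟫ = (0:ℝ)
  · have hS' := hS
    rw [← Tset_rot, ← Tset_rot] at hS' ⊢
    exact Wpt h.rot.rot hS' he hun w3 w1 c2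
  exfalso
  have := h.pos (p := -u) (by rw [inner_neg_left, real_inner_comm]; exact neg_pos.2 (lt_of_le_of_ne w1 c1))
    (by rw [inner_neg_left, real_inner_comm]; exact neg_pos.2 (lt_of_le_of_ne w2 c2))
    (by rw [inner_neg_left, real_inner_comm]; exact neg_pos.2 (lt_of_le_of_ne w3 c3)) hx
  rw [inner_neg_left, real_inner_comm, hxu] at this
  linarith

theorem width_ge (h : TD v₁ v₂ v₃ u₁ u₂ u₃ e H) (hS : SConvex (Tset u₁ u₂ u₃)) (he : 0 ≤ e) {w : ℝ} (hw : width (Tset u₁ u₂ u₃) = w)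
    (hw0 : 0 < w) : arcsin H ≤ w := by
  rw [← hw]
  apply le_csInf (lunes_nonempty hw hw0)
  rintro b ⟨u, v, ⟨hu, hv, h1, h2, hl, ⟨x0, hx0, hx0'⟩, -⟩, rfl⟩
  have hun := us.1 hu
  have hvn := us.1 hv
  obtain ⟨hb, m1, m2⟩ := breadth_eq hun hvn h1 h2
  rw [hb]
  rcases le_or_gt (⟪u, v⟫ : ℝ) 0 with hm | hm
  · obtain ⟨y, hy, hyH⟩ := Wany h hS he ⟨hu, fun a ha => (hl ha).2.1⟩ hx0 hx0'.2.1
    have hy2 := lune_bound hun hvn hy.1 (hl hy).2.1 (hl hy).2.2 hm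
    have hb1 : arccos (-⟪u, v⟫) ≤ π / 2 := arccos_le_pi_div_two.2 (by linarith)
    have hsin : H ≤ sin (arccos (-⟪u, v⟫)) := by
      rw [sin_arccos]
      apply Real.le_sqrt_of_sq_le
      rw [neg_sq]
      nlinarith [h.H0]
    refine (arcsin_le_arcsin hsin).trans (arcsin_sin ?_ hb1).le
    linarith [arccos_nonneg (-⟪u, v⟫ : ℝ), pi_pos]
  · refine (arcsin_le_pi_div_two H).trans ?_
    by_contra hc
    push Not at hc
    linarith [arccos_le_pi_div_two.1 hc.le]

theorem e_nonneg (h : TD v₁ v₂ v₃ u₁ u₂ u₃ e H) {w : ℝ} (hw : width (Tset u₁ u₂ u₃) = w)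
    (hw0 : 0 < w) (hw2 : w ≤ π / 2) : 0 ≤ e := by
  by_contra hneg
  push Not at hneg
  have he0 := h.e0
  have h0 := h.H0
  set k := -e / (1 + e) with hk
  have hk0 : 0 < k := div_pos (by linarith) (by linarith)
  have hk1 : k < 1 := by rw [hk, div_lt_one (by linarith)]; linarith
  have kk : ∀ t : ℝ, (1 + e) * t = -e → t = k := by
    intro t ht
    rw [hk, eq_div_iff (by linarith)]; linarith
  have k12 := kk _ h.uu12
  have k13 := kk _ h.uu13
  have k23 := kk _ h.uu23
  have k21 := rc k12
  have k31 := rc k13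
  have k32 := rc k23
  have g1 := inner_self1 h.nu1
  have g2 := inner_self1 h.nu2
  have g3 := inner_self1 h.nu3
  have comb : ∀ u ∈ polar (Tset u₁ u₂ u₃), ∃ a b c : ℝ, 0 ≤ a ∧ 0 ≤ b ∧ 0 ≤ c ∧ u = a • u₁ + b • u₂ + c • u₃ ∧ 1 ≤ a + b + c := by
    intro u hu
    have A1 : 0 ≤ -⟪v₁, u⟫ / H := div_nonneg (neg_nonneg.2 (hu.2 _ h.mem1)) h0.le
    have A2 : 0 ≤ -⟪v₂, u⟫ / H := div_nonneg (neg_nonneg.2 (hu.2 _ h.mem2)) h0.le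
    have A3 : 0 ≤ -⟪v₃, u⟫ / H := div_nonneg (neg_nonneg.2 (hu.2 _ h.mem3)) h0.le
    refine ⟨_, _, _, A1, A2, A3, h.eq_combu u, ?_⟩
    have hn := us.1 hu.1
    rw [h.eq_combu u] at hn
    rw [← hn]
    refine (norm_add_le _ _).trans (add_le_add ((norm_add_le _ _).trans (add_le_add ?_ ?_)) ?_)
    · rw [norm_smul, h.nu1, mul_one, Real.norm_of_nonneg A1]
    · rw [norm_smul, h.nu2, mul_one, Real.norm_of_nonneg A2]
    · rw [norm_smul, h.nu3, mul_one, Real.norm_of_nonneg A3]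
  have : arccos (-k) ≤ width (Tset u₁ u₂ u₃) := by
    apply le_csInf (lunes_nonempty hw hw0)
    rintro b ⟨u, v, ⟨hu, hv, h1, h2, hl, -, -⟩, rfl⟩
    rw [(breadth_eq (us.1 hu) (us.1 hv) h1 h2).1]
    apply arccos_le_arccos
    apply neg_le_neg
    obtain ⟨a, b, c, ha, hb, hc, hu', hs⟩ := comb u ⟨hu, fun a ha => (hl ha).2.1⟩
    obtain ⟨a', b', c', ha', hb', hc', hv', hs'⟩ := comb v ⟨hv, fun a ha => (hl ha).2.2⟩
    have : ⟪u, v⟫ = (1 - k) * (a * a' + b * b' + c * c') + k * ((a + b + c) * (a' + b' + c')) := by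
      rw [hu', hv']
      simp only [inner_add_left, inner_add_right, real_inner_smul_left, real_inner_smul_right, k12, k13, k23, k21, k31, k32, g1, g2, g3]
      ring
    rw [this]
    have x1 : 0 ≤ (1 - k) * (a * a' + b * b' + c * c') := mul_nonneg (by linarith) (by positivity)
    have x2 : 1 ≤ (a + b + c) * (a' + b' + c') := one_le_mul_of_one_le_of_one_le hs hs'
    have x3 : k * 1 ≤ k * ((a + b + c) * (a' + b' + c')) := mul_le_mul_of_nonneg_left x2 hk0.le
    linarith
  have h9 : π / 2 < arccos (-k) := by
    by_contra hc
    push Not at hc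
    linarith [arccos_le_pi_div_two.1 hc]
  linarith

end SPaux

end

section
open Metric Set SphericalPal Real MeasureTheory
open scoped RealInnerProductSpace NNReal Pointwise

namespace SPaux

variable {v₁ v₂ v₃ u₁ u₂ u₃ : E 2} {e H : ℝ}

theorem u3_le (h : TD v₁ v₂ v₃ u₁ u₂ u₃ e H) (he : 0 ≤ e) {x : E 2} (hx : x ∈ Tset u₁ u₂ u₃) : -⟪x, u₃⟫ ≤ H := by
  obtain ⟨hn, a1, a2, a3⟩ := hx
  have h0 := h.H0
  have A1 : 0 ≤ -⟪x, u₁⟫ / H := div_nonneg (neg_nonneg.2 a1) h0.le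
  have A2 : 0 ≤ -⟪x, u₂⟫ / H := div_nonneg (neg_nonneg.2 a2) h0.le
  have A3 : 0 ≤ -⟪x, u₃⟫ / H := div_nonneg (neg_nonneg.2 a3) h0.le
  have ex := h.eq_comb x
  suffices -⟪x, u₃⟫ / H ≤ 1 by rwa [div_le_one h0] at this
  have gx := inner_self1 hn
  generalize -⟪x, u₁⟫ / H = a at *
  generalize -⟪x, u₂⟫ / H = b at *
  generalize -⟪x, u₃⟫ / H = c at *
  rw [ex] at gx
  simp only [inner_add_left, inner_add_right, real_inner_smul_left, real_inner_smul_right, h.vv12, h.vv13, h.vv23, 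
    rc h.vv12, rc h.vv13, rc h.vv23, inner_self1 h.nv1, inner_self1 h.nv2, inner_self1 h.nv3] at gx
  have y1 : 0 ≤ e * (a * b) := by positivity
  have y2 : 0 ≤ e * (a * c) := by positivity
  have y3 : 0 ≤ e * (b * c) := by positivity
  nlinarith [sq_nonneg a, sq_nonneg b]

theorem tri_e {v₁ v₂ v₃ : E 2} (n1 : ‖v₁‖ = 1) (n2 : ‖v₂‖ = 1) (n3 : ‖v₃‖ = 1) (hli : LinearIndependent ℝ ![v₁, v₂, v₃])
    (d1 : gdist v₁ v₂ = gdist v₂ v₃) (d2 : gdist v₂ v₃ = gdist v₁ v₃) :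
    ∃ e : ℝ, ⟪v₁, v₂⟫ = e ∧ ⟪v₁, v₃⟫ = e ∧ ⟪v₂, v₃⟫ = e ∧ -1 / 2 < e ∧ e < 1 := by
  have b : ∀ x y : E 2, ‖x‖ = 1 → ‖y‖ = 1 → ⟪x, y⟫ ∈ Icc (-1:ℝ) 1 := by
    intro x y hx hy
    have := abs_real_inner_le_norm x y
    rw [hx, hy, mul_one, abs_le] at this
    exact this
  have e1 := arccos_injOn (b _ _ n1 n2) (b _ _ n2 n3) d1
  have e2 := arccos_injOn (b _ _ n2 n3) (b _ _ n1 n3) d2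
  refine ⟨⟪v₁, v₂⟫, rfl, by rw [← e2, ← e1], e1.symm, ?_, ?_⟩
  · have hne : v₁ + v₂ + v₃ ≠ 0 := by
      intro h0
      have := Fintype.linearIndependent_iff.1 hli ![1, 1, 1] (by simpa [Fin.sum_univ_three] using h0) 0
      simp at this
    have hpos : 0 < ⟪v₁ + v₂ + v₃, v₁ + v₂ + v₃⟫ := real_inner_self_pos.2 hne
    simp only [inner_add_left, inner_add_right, inner_self1 n1, inner_self1 n2, inner_self1 n3, real_inner_comm v₁ v₂, 
      real_inner_comm v₂ v₃, real_inner_comm v₁ v₃] at hpos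
    linarith
  · rw [inner_lt_one_iff_real_of_norm_eq_one n1 n2]
    intro h0
    have := Fintype.linearIndependent_iff.1 hli ![1, -1, 0] (by simp [Fin.sum_univ_three, h0]) 0
    simp at this

theorem tri_out {T : Set (E 2)} (hT : IsRegularTriangle T) {w : ℝ} (hw : width T = w) (hw0 : 0 < w) (hw2 : w ≤ π / 2) :
    ∃ r : ℝ, 0 < r ∧ r < w / 2 ∧ ka w r = 1 / 2 ∧ r ≤ inradius T ∧ volume.real (Ioo (0:ℝ) 1 • T) ≤ 2 * Ph w r ∧ MeasurableSet T ∧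
      T ⊆ sphere 0 1 := by
  obtain ⟨v₁, v₂, v₃, n1, n2, n3, hli, d1, d2, rfl⟩ := hT
  obtain ⟨e, h12, h13, h23, he0, he1⟩ := tri_e (us.1 n1) (us.1 n2) (us.1 n3) hli d1 d2
  obtain ⟨p, f₁, f₂, f₃, r, R, h3, hr0, hr1, hR0, hR1, hrel, rfl, rfl, rfl⟩ := 
    tri_setup (us.1 n1) (us.1 n2) (us.1 n3) h12 h13 h23 he0 he1
  have td := h3.td hr0 hr1 hR0 hR1 hrel
  have hs : 0 < sin r := sin_pos_of_pos_of_lt_pi hr0 (by linarith [pi_pos])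
  have hc : 0 < cos r := cos_pos_of_mem_Ioo ⟨by linarith [pi_pos], hr1⟩
  have hS : 0 < sin R := sin_pos_of_pos_of_lt_pi hR0 (by linarith [pi_pos])
  have hC : 0 < cos R := cos_pos_of_mem_Ioo ⟨by linarith [pi_pos], hR1⟩
  have pp := inner_self1 h3.hp
  have pv : ∀ f : E 2, ⟪p, f⟫ = (0:ℝ) → 0 < ⟪p, cos R • p + sin R • f⟫ := by
    intro f hf
    rw [inner_add_right, real_inner_smul_right, real_inner_smul_right, pp, hf]; linarith
  have pu : ∀ f : E 2, ⟪p, f⟫ = (0:ℝ) → ⟪p, -(sin r • p + cos r • f)⟫ = -sin r := by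
    intro f hf
    rw [inner_neg_right, inner_add_right, real_inner_smul_right, real_inner_smul_right, pp, hf]; ring
  have hTe := td.sconv_eq h3.hp (pv _ h3.q1) (pv _ h3.q2) (pv _ h3.q3)
  have hSc := td.sconvex h3.hp (pv _ h3.q1) (pv _ h3.q2) (pv _ h3.q3)
  rw [hTe] at hw ⊢
  have hball := Tset_ball h3.hp td.nu1 td.nu2 td.nu3 hr0 hr1 (pu _ h3.q1) (pu _ h3.q2) (pu _ h3.q3)
  have hbody := body_of_ball hSc (Tset_compact _ _ _) h3.hp hr0 hball
  have he := e_nonneg td hw hw0 hw2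
  have hge := width_ge td hSc he hw hw0
  obtain ⟨x, hx, hxs⟩ := lemmaW hbody hw hw2 hw0 (u := -(sin r • p + cos r • f₃)) 
    ⟨us.2 td.nu3, fun a ha => ha.2.2.2⟩ td.mem1 td.vu13
  have hle := hxs.trans (u3_le td he hx)
  have k1 := sin_sq_add_cos_sq r
  have k2 := sin_sq_add_cos_sq R
  have hH : 3 * (sin r * cos R) = sin (r + R) := by rw [sin_add]; linarith
  have hcos : 0 ≤ cos (r + R) := by
    rw [cos_add]
    have h1 : sin R ^ 2 ≤ 2 * cos R ^ 2 := by linarith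
    have h2 : sin R * (sin r * sin R) ≤ sin R * (cos r * cos R) := by
      have e1 : sin R * (sin r * sin R) = sin r * sin R ^ 2 := by ring
      have e2 : sin R * (cos r * cos R) = sin r * (2 * cos R ^ 2) := by linear_combination cos R * hrel
      rw [e1, e2]
      exact mul_le_mul_of_nonneg_left h1 hs.le
    have := le_of_mul_le_mul_left h2 hS
    linarith
  have hrR : r + R ≤ π / 2 := by
    by_contra hcon
    push Not at hcon
    have := cos_neg_of_pi_div_two_lt_of_lt hcon (by linarith)
    linarith
  rw [hH] at hge hle
  have hwr : w = r + R := by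
    apply le_antisymm
    · by_contra hcon
      push Not at hcon
      have := sin_lt_sin_of_lt_of_le_pi_div_two (by linarith) hw2 hcon
      linarith
    · rwa [arcsin_sin (by linarith) hrR] at hge
  have hwR : w - r = R := by linarith
  have hka : ka w r = 1 / 2 := by
    unfold ka
    rw [hwR, hrel]
    field_simp
  have hrw : r < w / 2 := by
    by_contra hcon
    push Not at hcon
    have hRr : R ≤ r := by linarith
    have := sin_nonneg_of_nonneg_of_le_pi (sub_nonneg.2 hRr) (by linarith)
    rw [sin_sub] at this
    have := mul_pos hs hC
    linarith
  refine ⟨r, hr0, hrw, hka, le_inradius hSc h3.hp hr0.le hball, ?_, (Tset_closed _ _ _).measurableSet, Tset_sub _ _ _⟩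
  have hv := tri_vol h3 hr0 hr1 (K := Tset (-(sin r • p + cos r • f₁)) (-(sin r • p + cos r • f₂)) (-(sin r • p + cos r • f₃))) (by
    rintro X ⟨hn, a1, a2, a3⟩
    have tr : ∀ f : E 2, ⟪X, -(sin r • p + cos r • f)⟫ ≤ 0 → 0 ≤ sin r * ⟪p, X⟫ + cos r * ⟪f, X⟫ := by
      intro f hf
      rw [inner_neg_right, inner_add_right, real_inner_smul_right, real_inner_smul_right, real_inner_comm p X, real_inner_comm f X] at hf
      linarith
    exact ⟨hn, tr _ a1, tr _ a2, tr _ a3⟩)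
  unfold Ph
  rw [al_r0 hka]
  exact hv

end SPaux

namespace SPaux

theorem main_result (w : ℝ) (hw0 : 0 < w) (hw : w ≤ π / 2)
    (T_w : Set (E 2)) (hT : IsRegularTriangle T_w) (hTw : width T_w = w) :
    ∃ c > 0, ∀ ε ≥ (0:ℝ), ∀ K : Set (E 2), IsConvexBody K → width K = w →
      area K ≤ area T_w + ε → inradius K ≤ inradius T_w + c * ε := by
  obtain ⟨r₀, h0, h1, hk, hin, hvol, hmeas, hsub⟩ := tri_out hT hTw hw0 hw
  obtain ⟨m, hm, hm'⟩ := calc_main hw0 hw h0 h1 hk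
  obtain ⟨C, hC, harea⟩ := area_eq
  have h2C : 0 < 2 * C * m := by positivity
  refine ⟨1 / (2 * C * m), by positivity, ?_⟩
  intro ε hε K hK hKw hA
  obtain ⟨r, hr0, hr1, hr2, hr3⟩ := lower hK hKw hw hw0
  have hcε : 0 ≤ 1 / (2 * C * m) * ε := by positivity
  rcases le_or_gt r r₀ with hle | hlt
  · linarith
  rw [harea K hK.2.1.measurableSet hK.1.1, harea _ hmeas hsub] at hA
  have h4 := hm' r ⟨hlt.le, hr1⟩
  have h5 : 2 * m * (r - r₀) ≤ volume.real (Ioo (0:ℝ) 1 • K) - volume.real (Ioo (0:ℝ) 1 • T_w) := by linarith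
  have h6 := mul_le_mul_of_nonneg_left h5 hC.le
  have h7 : r - r₀ ≤ 1 / (2 * C * m) * ε := by
    rw [one_div, inv_mul_eq_div, le_div_iff₀ h2C]
    linarith
  linarith

end SPaux

end

/-- stability of the inradius: `r(K) ≤ r(T_w) + c_w·ε` whenever
`area K ≤ area T_w + ε`. -/
theorem inradius_stability (w : ℝ) (hw0 : 0 < w) (hw : w ≤ π / 2)
    (T_w : Set (E 2)) (hT : IsRegularTriangle T_w) (hTw : width T_w = w) :
    ∃ c > 0, ∀ ε ≥ (0:ℝ), ∀ K : Set (E 2), IsConvexBody K → width K = w →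
      area K ≤ area T_w + ε → inradius K ≤ inradius T_w + c * ε := by
  exact SPaux.main_result w hw0 hw T_w hT hTw
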